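/- arXiv:1410.7705 — 3 statements merged into one kernel-verified Lean document; each statement's English description precedes it below -/
import Mathlib

section
/- Let K be a field of characteristic zero and let f be a K-algebra endomorphism of K[x,y] with Jac(P,Q) a nonzero element of K, where P = f(x) and Q = f(y). Then f satisfies the restriction condition, namely α(P) ∈ T and α(Q) ∈ T where α is the exchange involution and T = K[P,Q] is the image of f, if and only if f is a K-algebra automorphism of K[x,y]. -/
open MvPolynomial

/-- The Jacobian of two polynomials in `K[x,y]` (variables indexed by `Fin 2`). -/
noncomputable def Jac {K : Type*} [CommRing K]
    (P Q : MvPolynomial (Fin 2) K) : MvPolynomial (Fin 2) K :=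
  pderiv 0 P * pderiv 1 Q - pderiv 1 P * pderiv 0 Q

/-- The exchange involution `α` on `K[x,y]`, swapping the two variables. -/
noncomputable def exch (K : Type*) [CommSemiring K] :
    MvPolynomial (Fin 2) K ≃ₐ[K] MvPolynomial (Fin 2) K :=
  MvPolynomial.renameEquiv K (Equiv.swap 0 1)

/-- An involution on a `K`-algebra: an algebra automorphism of order 2. -/
def IsInvolution {K R : Type*} [CommSemiring K] [Semiring R] [Algebra K R]
    (γ : R ≃ₐ[K] R) : Prop :=
  (∀ p, γ (γ p) = p) ∧ γ ≠ AlgEquiv.refl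


section helpers
variable {K : Type*} [Field K]

local notation "R2" => MvPolynomial (Fin 2) K

theorem chain_rule (f : R2 →ₐ[K] R2) (i : Fin 2) (F : R2) :
    pderiv i (f F) = f (pderiv 0 F) * pderiv i (f (X 0)) + f (pderiv 1 F) * pderiv i (f (X 1)) := by
  induction F using MvPolynomial.induction_on with
  | C a =>
    have : f (C a) = C a := f.commutes a
    simp [this]
  | add p q hp hq => simp only [map_add, hp, hq]; ring
  | mul_X p j hp =>
    simp only [map_mul, Derivation.leibniz, hp, smul_eq_mul, map_add]
    fin_cases j <;> simp [pderiv_X] <;> ring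

theorem Jac_comp (f : R2 →ₐ[K] R2) (F G : R2) :
    Jac (f F) (f G) = f (Jac F G) * Jac (f (X 0)) (f (X 1)) := by
  unfold Jac
  simp only [chain_rule f _ F, chain_rule f _ G, map_sub, map_mul]
  ring

theorem algHom_C2 (f : R2 →ₐ[K] R2) (a : K) : f (C a) = C a := f.commutes a

theorem algHom_ext2 {f g : R2 →ₐ[K] R2} (h0 : f (X 0) = g (X 0)) (h1 : f (X 1) = g (X 1)) :
    f = g := by
  apply MvPolynomial.algHom_ext
  intro i
  fin_cases i
  · exact h0
  · exact h1

theorem range_le2 {f : R2 →ₐ[K] R2} {S : Subalgebra K R2} (h0 : f (X 0) ∈ S) (h1 : f (X 1) ∈ S) :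
    f.range ≤ S := by
  rintro _ ⟨F, rfl⟩
  show f F ∈ S
  induction F using MvPolynomial.induction_on with
  | C a => rw [algHom_C2]; exact S.algebraMap_mem a
  | add p q hp hq => rw [map_add]; exact S.add_mem hp hq
  | mul_X p j hp =>
    rw [map_mul]
    refine S.mul_mem hp ?_
    fin_cases j
    · exact h0
    · exact h1

/-- the exponent `(i,j)` -/
noncomputable def ex (i j : ℕ) : Fin 2 →₀ ℕ := Finsupp.single 0 i + Finsupp.single 1 j

@[simp] theorem ex_zero (i j : ℕ) : ex i j 0 = i := by simp [ex]
@[simp] theorem ex_one (i j : ℕ) : ex i j 1 = j := by simp [ex]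

theorem ex_ext {s t : Fin 2 →₀ ℕ} (h0 : s 0 = t 0) (h1 : s 1 = t 1) : s = t := by
  ext i; fin_cases i
  · exact h0
  · exact h1

theorem monomial_eq2 (s : Fin 2 →₀ ℕ) (a : K) :
    (monomial s a : R2) = C a * (X 0 ^ s 0 * X 1 ^ s 1) := by
  rw [MvPolynomial.monomial_eq, Finsupp.prod_fintype _ _ (by simp)]
  simp

theorem const_of_pderiv [CharZero K] {F : R2} (h0 : pderiv 0 F = 0) (h1 : pderiv 1 F = 0) :
    F = C (coeff 0 F) := by
  ext s
  rw [coeff_C]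
  split_ifs with hs
  · rw [hs]
  · by_cases hs0 : s 0 = 0
    · have hs1 : s 1 ≠ 0 := by
        intro h; apply hs; symm; exact ex_ext hs0 h
      have h := coeff_pderiv (i := 1) F (s - Finsupp.single 1 1)
      rw [h1, coeff_zero] at h
      have e : s - Finsupp.single 1 1 + Finsupp.single 1 1 = s := by
        apply ex_ext <;> simp; omega
      rw [e] at h
      rcases mul_eq_zero.1 h.symm with h | h
      · exact h
      · norm_cast at h
    · have h := coeff_pderiv (i := 0) F (s - Finsupp.single 0 1)
      rw [h0, coeff_zero] at h
      have e : s - Finsupp.single 0 1 + Finsupp.single 0 1 = s := by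
        apply ex_ext <;> simp; omega
      rw [e] at h
      rcases mul_eq_zero.1 h.symm with h | h
      · exact h
      · norm_cast at h

theorem totalDegree_pderiv_lt {F : R2} (i : Fin 2) (h : pderiv i F ≠ 0) :
    (pderiv i F).totalDegree < F.totalDegree := by
  obtain ⟨s, hs, hs'⟩ := Finset.exists_mem_eq_sup (pderiv i F).support
    (by simpa [Finset.nonempty_iff_ne_empty] using h) (fun s => s.sum fun _ e => e)
  have hd : (pderiv i F).totalDegree = s.sum fun _ e => e := hs'
  rw [mem_support_iff, coeff_pderiv] at hs
  have := le_totalDegree (mem_support_iff.2 (left_ne_zero_of_mul hs))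
  rw [Finsupp.sum_add_index' (by simp) (by simp), Finsupp.sum_single_index rfl] at this
  omega

theorem keller_inj [CharZero K] (f : R2 →ₐ[K] R2) (hJ : Jac (f (X 0)) (f (X 1)) ≠ 0) :
    Function.Injective f := by
  rw [injective_iff_map_eq_zero]
  have key : ∀ n : ℕ, ∀ F : R2, F.totalDegree ≤ n → f F = 0 → F = 0 := by
    intro n
    induction n using Nat.strong_induction_on with
    | _ n ih =>
    intro F hF h
    have e0 := chain_rule f 0 F
    have e1 := chain_rule f 1 F
    rw [h, map_zero] at e0 e1
    have d0 : f (pderiv 0 F) = 0 := by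
      have : f (pderiv 0 F) * Jac (f (X 0)) (f (X 1)) = 0 := by
        unfold Jac
        linear_combination (pderiv 0 (f (X 1))) * e1 - (pderiv 1 (f (X 1))) * e0
      exact (mul_eq_zero.1 this).resolve_right hJ
    have d1 : f (pderiv 1 F) = 0 := by
      have : f (pderiv 1 F) * Jac (f (X 0)) (f (X 1)) = 0 := by
        unfold Jac
        linear_combination (pderiv 1 (f (X 0))) * e0 - (pderiv 0 (f (X 0))) * e1
      exact (mul_eq_zero.1 this).resolve_right hJ
    have z : ∀ i, f (pderiv i F) = 0 → pderiv i F = 0 := by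
      intro i hi
      by_contra hne
      have := totalDegree_pderiv_lt i hne
      exact hne (ih _ (lt_of_lt_of_le this hF) _ le_rfl hi)
    have hc := const_of_pderiv (z 0 d0) (z 1 d1)
    rw [hc, algHom_C2] at h
    rw [hc, h]
  intro F h
  exact key _ F le_rfl h

/-- sign change of the second variable -/
noncomputable def eps (K : Type*) [Field K] :
    MvPolynomial (Fin 2) K →ₐ[K] MvPolynomial (Fin 2) K := aeval ![X 0, - X 1]

theorem eps_X0 : eps K (X 0) = X 0 := by simp [eps]
theorem eps_X1 : eps K (X 1) = - X 1 := by simp [eps]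
theorem eps_eps (F : R2) : eps K (eps K F) = F := by
  have : (eps K).comp (eps K) = AlgHom.id K R2 := by
    apply algHom_ext2 <;> simp [eps_X0, eps_X1]
  exact DFunLike.congr_fun this F

theorem coeff_eps (F : R2) (s : Fin 2 →₀ ℕ) : coeff s (eps K F) = (-1) ^ (s 1) * coeff s F := by
  classical
  induction F using MvPolynomial.induction_on' with
  | monomial t a =>
    rw [monomial_eq2, map_mul, map_mul, map_pow, map_pow, algHom_C2, eps_X0, eps_X1, ← monomial_eq2]
    have : (C a * (X 0 ^ t 0 * (- X 1) ^ t 1) : R2) = C ((-1) ^ t 1) * monomial t a := by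
      rw [monomial_eq2, neg_pow]; simp; ring
    rw [this, coeff_C_mul, coeff_monomial]
    split_ifs with h
    · rw [h]
    · simp
  | add p q hp hq => rw [map_add, coeff_add, hp, hq, coeff_add]; ring

theorem Jac_eps (F G : R2) : Jac (eps K F) (eps K G) = - eps K (Jac F G) := by
  rw [Jac_comp, eps_X0, eps_X1]
  simp [Jac]

/-- Leading exponent lemma. -/
theorem jac_lead {Γ : Type*} [AddCommMonoid Γ] [LinearOrder Γ] [IsOrderedCancelAddMonoid Γ]
    [CharZero K] (l : (Fin 2 →₀ ℕ) →+ Γ) {P Q : R2} {e e' : Fin 2 →₀ ℕ}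
    (hP : ∀ s, coeff s P ≠ 0 → s = e ∨ l s < l e) (hQ : ∀ s, coeff s Q ≠ 0 → s = e' ∨ l s < l e')
    (he : coeff e P ≠ 0) (he' : coeff e' Q ≠ 0) (hdet : e 0 * e' 1 ≠ e 1 * e' 0)
    {c : K} (hJ : Jac P Q = C c) : e + e' = ex 1 1 := by
  classical
  have euler : ∀ (i : Fin 2) (F : R2) (s), coeff s (X i * pderiv i F) = s i * coeff s F := by
    intro i F s
    rw [coeff_X_mul']
    split_ifs with h
    · rw [coeff_pderiv]
      have h1 : s i ≠ 0 := by simpa using h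
      have e : s - Finsupp.single i 1 + Finsupp.single i 1 = s := by
        ext j
        by_cases hj : i = j
        · subst hj; simp; omega
        · simp [hj]
      rw [e, Finsupp.tsub_apply, Finsupp.single_eq_same, mul_comm]
      congr 1
      norm_cast
      omega
    · have : s i = 0 := by simpa using h
      simp [this]
  have h1 : coeff (e + e') (X 0 * X 1 * Jac P Q) =
      (e 0 * e' 1 - e 1 * e' 0) * (coeff e P * coeff e' Q) := by
    have : X 0 * X 1 * Jac P Q = (X 0 * pderiv 0 P) * (X 1 * pderiv 1 Q)
      - (X 1 * pderiv 1 P) * (X 0 * pderiv 0 Q) := by unfold Jac; ring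
    rw [this, coeff_sub, coeff_mul, coeff_mul, ← Finset.sum_sub_distrib]
    rw [Finset.sum_eq_single (e, e')]
    · simp only [euler]; ring
    · rintro ⟨s, t⟩ hst hne
      simp only [euler]
      have hst : s + t = e + e' := by simpa using hst
      by_cases hs : coeff s P = 0
      · simp [hs]
      by_cases ht : coeff t Q = 0
      · simp [ht]
      exfalso
      have hl : l s + l t = l e + l e' := by rw [← map_add, hst, map_add]
      rcases hP s hs with rfl | h1
      · exact hne (by rw [add_left_cancel hst])
      · rcases hQ t ht with rfl | h2
        · exact hne (by rw [add_right_cancel hst])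
        · exact absurd hl (add_lt_add h1 h2).ne
    · intro h; simp at h
  have h2 : coeff (e + e') (X 0 * X 1 * Jac P Q) ≠ 0 := by
    rw [h1]
    refine mul_ne_zero ?_ (mul_ne_zero he he')
    rw [sub_ne_zero]
    exact_mod_cast hdet
  rw [hJ] at h2
  have h3 : (X 0 * X 1 * C c : R2) = monomial (ex 1 1) c := by
    rw [monomial_eq2]; simp; ring
  rw [h3, coeff_monomial] at h2
  by_contra hne
  exact h2 (if_neg (fun h => hne h.symm))

/-- a lexicographic weight on exponents -/
noncomputable def lexHom (a b c d : ℚ) : (Fin 2 →₀ ℕ) →+ ℚ ×ₗ ℚ where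
  toFun s := toLex (a * s 0 + b * s 1, c * s 0 + d * s 1)
  map_zero' := by simp
  map_add' s t := by
    apply ofLex.injective
    ext <;> simp <;> ring

theorem lexHom_lt {a b c d : ℚ} {s t : Fin 2 →₀ ℕ} : lexHom a b c d s < lexHom a b c d t ↔
    a * s 0 + b * s 1 < a * t 0 + b * t 1 ∨ (a * s 0 + b * s 1 = a * t 0 + b * t 1 ∧
      c * s 0 + d * s 1 < c * t 0 + d * t 1) := by
  exact Prod.Lex.toLex_lt_toLex

theorem exists_lead {Γ : Type*} [LinearOrder Γ] (l : (Fin 2 →₀ ℕ) → Γ)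
    (hl : Function.Injective l) {P : R2} (hP : P ≠ 0) :
    ∃ e, coeff e P ≠ 0 ∧ ∀ s, coeff s P ≠ 0 → s = e ∨ l s < l e := by
  obtain ⟨e, he, h⟩ := Finset.exists_max_image P.support l
    (by simpa [Finset.nonempty_iff_ne_empty] using hP)
  refine ⟨e, mem_support_iff.1 he, fun s hs => ?_⟩
  rcases (h s (mem_support_iff.2 hs)).lt_or_eq with h | h
  · exact Or.inr h
  · exact Or.inl (hl h)

theorem lexHom_inj {a b c d : ℚ} (h : a * d - b * c ≠ 0) : Function.Injective (lexHom a b c d) := by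
  intro s t hst
  have h1 : a * s 0 + b * s 1 = a * t 0 + b * t 1 := congrArg (fun z => (ofLex z).1) hst
  have h2 : c * s 0 + d * s 1 = c * t 0 + d * t 1 := congrArg (fun z => (ofLex z).2) hst
  apply ex_ext
  · have : (a * d - b * c) * ((s 0 : ℚ) - t 0) = 0 := by linear_combination d * h1 - b * h2
    have := (mul_eq_zero.1 this).resolve_left h
    exact_mod_cast sub_eq_zero.1 this
  · have : (a * d - b * c) * ((s 1 : ℚ) - t 1) = 0 := by linear_combination a * h2 - c * h1
    have := (mul_eq_zero.1 this).resolve_left h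
    exact_mod_cast sub_eq_zero.1 this

theorem exists_slope (S T : Finset (Fin 2 →₀ ℕ)) (hS : ∀ s ∈ S, s 1 = 0 → s 0 ≤ 1)
    (hT0 : ∀ s ∈ T, s 1 ≠ 0) (hT : ∀ s ∈ T, s 1 = 1 → s 0 = 0) :
    ∃ μ : ℚ, 0 ≤ μ ∧ (∀ s ∈ S, (s 0 : ℚ) - μ * s 1 ≤ 1) ∧ (∀ s ∈ T, (s 0 : ℚ) - μ * s 1 ≤ - μ) ∧
      (μ = 0 ∨ (∃ s ∈ S, 0 < s 1 ∧ (s 0 : ℚ) - μ * s 1 = 1) ∨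
        (∃ s ∈ T, 1 < s 1 ∧ (s 0 : ℚ) - μ * s 1 = - μ)) := by
  classical
  let U : Finset ℚ := insert 0 (((S.filter (fun s => 0 < s 1)).image
    (fun s => ((s 0 : ℚ) - 1) / s 1)) ∪ ((T.filter (fun s => 1 < s 1)).image
    (fun s => (s 0 : ℚ) / ((s 1 : ℚ) - 1))))
  have hU : U.Nonempty := ⟨0, by simp [U]⟩
  have hmem := U.max'_mem hU
  have hmax := fun x hx => U.le_max' x hx
  set μ := U.max' hU with hμ
  refine ⟨μ, hmax 0 (by simp [U]), ?_, ?_, ?_⟩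
  · intro s hs
    by_cases h0 : s 1 = 0
    · rw [h0]; simpa using hS s hs h0
    · have h := hmax (((s 0 : ℚ) - 1) / s 1) (by
        simp only [U, Finset.mem_insert, Finset.mem_union, Finset.mem_image, Finset.mem_filter]
        exact Or.inr (Or.inl ⟨s, ⟨hs, by omega⟩, rfl⟩))
      have : (0 : ℚ) < s 1 := by exact_mod_cast Nat.pos_of_ne_zero h0
      rw [div_le_iff₀ this] at h
      linarith
  · intro s hs
    by_cases h0 : s 1 = 1
    · rw [h0, hT s hs h0]; simp
    · have h1 := hT0 s hs
      have h := hmax ((s 0 : ℚ) / ((s 1 : ℚ) - 1)) (by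
        simp only [U, Finset.mem_insert, Finset.mem_union, Finset.mem_image, Finset.mem_filter]
        exact Or.inr (Or.inr ⟨s, ⟨hs, by omega⟩, rfl⟩))
      have : (1 : ℚ) < s 1 := by exact_mod_cast (show 1 < s 1 by omega)
      rw [div_le_iff₀ (by linarith)] at h
      linarith
  · simp only [U, Finset.mem_insert, Finset.mem_union, Finset.mem_image, Finset.mem_filter] at hmem
    rcases hmem with h | ⟨s, ⟨hs, h1⟩, h⟩ | ⟨s, ⟨hs, h1⟩, h⟩
    · exact Or.inl h
    · refine Or.inr (Or.inl ⟨s, hs, h1, ?_⟩)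
      have : (0 : ℚ) < s 1 := by exact_mod_cast h1
      rw [div_eq_iff this.ne'] at h
      linarith
    · refine Or.inr (Or.inr ⟨s, hs, h1, ?_⟩)
      have : (1 : ℚ) < s 1 := by exact_mod_cast h1
      rw [div_eq_iff (by linarith)] at h
      linarith

theorem coeff_zero_Jac (P Q : R2) : coeff 0 (Jac P Q) =
    coeff (ex 1 0) P * coeff (ex 0 1) Q - coeff (ex 0 1) P * coeff (ex 1 0) Q := by
  have h0 : ∀ F : R2, constantCoeff (pderiv 0 F) = coeff (ex 1 0) F := by
    intro F
    rw [constantCoeff_eq, coeff_pderiv]; simp [ex]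
  have h1 : ∀ F : R2, constantCoeff (pderiv 1 F) = coeff (ex 0 1) F := by
    intro F
    rw [constantCoeff_eq, coeff_pderiv]; simp [ex]
  rw [← constantCoeff_eq]
  simp only [Jac, map_sub, map_mul, h0, h1]

theorem even_odd [CharZero K] {P Q : R2} (hP : eps K P = P) (hQ : eps K Q = - Q) {c : K}
    (hc : c ≠ 0) (hJ : Jac P Q = C c) {S : Subalgebra K R2} (hPS : P ∈ S) (hQS : Q ∈ S) :
    X 0 ∈ S ∧ X 1 ∈ S := by
  have p01 : coeff (ex 0 1) P = 0 := by
    have := coeff_eps P (ex 0 1)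
    rw [hP] at this
    simp at this
    exact self_eq_neg.1 this
  have qi0 : ∀ s : Fin 2 →₀ ℕ, coeff s Q ≠ 0 → s 1 ≠ 0 := by
    intro s hs h
    have := coeff_eps Q s
    rw [hQ, h] at this
    simp at this
    exact hs (neg_eq_self.1 this)
  have h00 := coeff_zero_Jac P Q
  rw [hJ, p01] at h00
  simp at h00
  have p10 : coeff (ex 1 0) P ≠ 0 := by rintro h; rw [h] at h00; simp at h00; exact hc h00
  have q01 : coeff (ex 0 1) Q ≠ 0 := by rintro h; rw [h] at h00; simp at h00; exact hc h00
  have P0 : P ≠ 0 := by rintro rfl; simp at p10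
  have Q0 : Q ≠ 0 := by rintro rfl; simp at q01
  -- first step
  have step1 : (∀ s ∈ P.support, s 1 = 0 → s 0 ≤ 1) ∧ (∀ s ∈ Q.support, s 1 = 1 → s 0 = 0) := by
    have hinj : Function.Injective (lexHom 0 (-1) 1 0) := lexHom_inj (by norm_num)
    obtain ⟨e, he, hel⟩ := exists_lead _ hinj P0
    obtain ⟨e', he', hel'⟩ := exists_lead _ hinj Q0
    have a1 : e 1 = 0 ∧ 1 ≤ e 0 := by
      rcases hel _ p10 with h | h
      · rw [← h]; simp
      · rw [lexHom_lt] at h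
        simp at h
        rcases h with h | h
        · have : (0 : ℚ) ≤ e 1 := by positivity
          linarith
        · exact ⟨h.1, by have := h.2; exact_mod_cast this.le⟩
    have a2 : e' 1 = 1 := by
      have hne := qi0 _ he'
      rcases hel' _ q01 with h | h
      · rw [← h]; simp
      · rw [lexHom_lt] at h
        simp at h
        rcases h with h | h
        · exact absurd h hne
        · exact_mod_cast h.1.symm
    have a3 := jac_lead _ hel hel' he he' (by rw [a1.1, a2]; omega) hJ
    have a4 : e 0 + e' 0 = 1 := by simpa using DFunLike.congr_fun a3 0
    constructor
    · intro s hs hs1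
      rcases hel _ (mem_support_iff.1 hs) with rfl | h
      · omega
      · rw [lexHom_lt, a1.1, hs1] at h
        simp at h
        omega
    · intro s hs hs1
      rcases hel' _ (mem_support_iff.1 hs) with rfl | h
      · omega
      · rw [lexHom_lt, a2, hs1] at h
        simp at h
        omega
  obtain ⟨μ, hμ, mS, mT, hm⟩ := exists_slope P.support Q.support step1.1
    (fun s hs => qi0 s (mem_support_iff.1 hs)) step1.2
  have hinj : Function.Injective (lexHom 1 (-μ) 0 1) := lexHom_inj (by norm_num)
  obtain ⟨e, he, hel⟩ := exists_lead _ hinj P0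
  obtain ⟨e', he', hel'⟩ := exists_lead _ hinj Q0
  have w1 : (e 0 : ℚ) - μ * e 1 = 1 := by
    apply le_antisymm (mS e (mem_support_iff.2 he))
    rcases hel _ p10 with h | h
    · rw [← h]; simp
    · rw [lexHom_lt] at h
      simp at h
      rcases h with h | h
      · linarith
      · linarith [h.1]
  have w2 : (e' 0 : ℚ) - μ * e' 1 = - μ := by
    apply le_antisymm (mT e' (mem_support_iff.2 he'))
    rcases hel' _ q01 with h | h
    · rw [← h]; simp
    · rw [lexHom_lt] at h
      simp at h
      rcases h with h | h
      · linarith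
      · linarith [h.1]
  have ne1 := qi0 _ he'
  have hdet : e 0 * e' 1 ≠ e 1 * e' 0 := by
    intro h
    have h : (e 0 : ℚ) * e' 1 = e 1 * e' 0 := by exact_mod_cast h
    have : (e' 1 : ℚ) + μ * e 1 = 0 := by linear_combination h - w1 * e' 1 + w2 * e 1
    have h1 : (0 : ℚ) < e' 1 := by exact_mod_cast Nat.pos_of_ne_zero ne1
    have h2 : (0 : ℚ) ≤ μ * e 1 := by positivity
    linarith
  have a3 := jac_lead _ hel hel' he he' hdet hJ
  have a4 : e 0 + e' 0 = 1 := by simpa using DFunLike.congr_fun a3 0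
  have a5 : e 1 + e' 1 = 1 := by simpa using DFunLike.congr_fun a3 1
  have e1 : e 1 = 0 := by omega
  have e1' : e' 1 = 1 := by omega
  have strictP : ∀ s ∈ P.support, 0 < s 1 → (s 0 : ℚ) - μ * s 1 < 1 := by
    intro s hs h1
    rcases hel _ (mem_support_iff.1 hs) with rfl | h
    · omega
    · rw [lexHom_lt] at h
      rcases h with h | ⟨_, h⟩
      · linarith
      · simp at h
        omega
  have strictQ : ∀ s ∈ Q.support, 1 < s 1 → (s 0 : ℚ) - μ * s 1 < - μ := by
    intro s hs h1
    rcases hel' _ (mem_support_iff.1 hs) with rfl | h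
    · omega
    · rw [lexHom_lt] at h
      rcases h with h | ⟨_, h⟩
      · linarith
      · simp at h
        omega
  have μ0 : μ = 0 := by
    rcases hm with h | ⟨s, hs, h1, h2⟩ | ⟨s, hs, h1, h2⟩
    · exact h
    · exact absurd h2 (strictP s hs h1).ne
    · exact absurd h2 (strictQ s hs h1).ne
  subst μ0
  have sQ : ∀ s, coeff s Q ≠ 0 → s = ex 0 1 := by
    intro s hs
    have hs' := mem_support_iff.2 hs
    have h1 := qi0 s hs
    by_cases h : s 1 = 1
    · apply ex_ext
      · simp [step1.2 s hs' h]
      · simp [h]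
    · have := strictQ s hs' (by omega)
      have h3 : (0 : ℚ) ≤ s 0 := by positivity
      simp at this
      linarith
  have sP : ∀ s, coeff s P ≠ 0 → s = ex 1 0 ∨ s 0 = 0 := by
    intro s hs
    have hs' := mem_support_iff.2 hs
    by_cases h : s 1 = 0
    · have := step1.1 s hs' h
      by_cases h0 : s 0 = 0
      · exact Or.inr h0
      · left; apply ex_ext <;> simp <;> omega
    · have := strictP s hs' (by omega)
      simp at this
      exact Or.inr this
  have X1S : X 1 ∈ S := by
    have : Q = C (coeff (ex 0 1) Q) * X 1 := by
      have : Q = monomial (ex 0 1) (coeff (ex 0 1) Q) := by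
        classical
        ext s
        rw [coeff_monomial]
        split_ifs with h
        · rw [h]
        · by_contra h'; exact h (sQ s h').symm
      rw [monomial_eq2] at this
      simpa using this
    have h2 : X 1 = (coeff (ex 0 1) Q)⁻¹ • Q := by
      rw [this, smul_eq_C_mul]
      simp only [coeff_C_mul]
      have : coeff (ex 0 1) (X 1 : R2) = 1 := by simp [ex, coeff_X]
      rw [this, mul_one, ← mul_assoc, ← C_mul, inv_mul_cancel₀ q01]; simp
    rw [h2]
    exact S.smul_mem hQS _
  refine ⟨?_, X1S⟩
  have hdec : P - C (coeff (ex 1 0) P) * X 0 ∈ S := by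
    rw [as_sum (P - C (coeff (ex 1 0) P) * X 0)]
    refine S.sum_mem fun s hs => ?_
    have hs0 : s 0 = 0 := by
      by_contra h
      rw [mem_support_iff, coeff_sub] at hs
      have hX : (C (coeff (ex 1 0) P) * X 0 : R2) = monomial (ex 1 0) (coeff (ex 1 0) P) := by
        rw [monomial_eq2]; simp
      classical
      rw [hX, coeff_monomial] at hs
      split_ifs at hs with h1
      · rw [h1] at hs; simp at hs
      · rw [sub_zero] at hs
        rcases sP s hs with h2 | h2
        · exact h1 h2.symm
        · exact h h2
    rw [monomial_eq2, hs0, pow_zero, one_mul, ← smul_eq_C_mul]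
    exact S.smul_mem (S.pow_mem X1S _) _
  have h2 : (X 0 : R2) = (coeff (ex 1 0) P)⁻¹ • (P - (P - C (coeff (ex 1 0) P) * X 0)) := by
    rw [sub_sub_cancel, smul_eq_C_mul, ← mul_assoc, ← C_mul, inv_mul_cancel₀ p10]; simp
  rw [h2]
  exact S.smul_mem (S.sub_mem hPS hdec) _

/-- the Jacobian derivation -/
noncomputable def JD (A : R2) : Derivation K R2 R2 := pderiv 0 A • pderiv 1 - pderiv 1 A • pderiv 0

theorem JD_apply (A F : R2) : JD A F = Jac A F := by simp [JD, Jac]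

/-- local nilpotency -/
def LND (D : Derivation K R2 R2) : Prop := ∀ F : R2, ∃ n : ℕ, D^[n] F = 0

theorem iter_zero_mono (D : Derivation K R2 R2) {F : R2} {a b : ℕ} (hab : a ≤ b)
    (h : D^[a] F = 0) : D^[b] F = 0 := by
  obtain ⟨c, rfl⟩ := Nat.exists_eq_add_of_le' hab
  rw [Function.iterate_add_apply, h]
  exact iterate_map_zero D c

theorem leib (D : Derivation K R2 R2) : ∀ (n a b : ℕ) (F G : R2), a + b = n → D^[a + 1] F = 0 →
    D^[b + 1] G = 0 → ∃ N : ℕ, 0 < N ∧ D^[a + b] (F * G) = (N : R2) * (D^[a] F * D^[b] G) := by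
  intro n
  induction n with
  | zero =>
    intro a b F G h _ _
    obtain ⟨rfl, rfl⟩ : a = 0 ∧ b = 0 := by omega
    exact ⟨1, one_pos, by simp⟩
  | succ n ih =>
    intro a b F G h hF hG
    have hD : D (F * G) = F * D G + D F * G := by
      rw [Derivation.leibniz, smul_eq_mul, smul_eq_mul]; ring
    rcases a with _ | a
    · rcases b with _ | b
      · omega
      · have hF' : D F = 0 := hF
        obtain ⟨N, hN, e⟩ := ih 0 b F (D G) (by omega) hF hG
        refine ⟨N, hN, ?_⟩
        have : 0 + (b + 1) = (0 + b) + 1 := by omega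
        rw [this, Function.iterate_succ_apply, hD, hF', zero_mul, add_zero, e,
          Function.iterate_succ_apply]
    · rcases b with _ | b
      · have hG' : D G = 0 := hG
        obtain ⟨N, hN, e⟩ := ih a 0 (D F) G (by omega) hF hG
        refine ⟨N, hN, ?_⟩
        show D^[a + 1] (F * G) = (N : R2) * (D^[a + 1] F * G)
        rw [Function.iterate_succ_apply, hD, hG', mul_zero, zero_add,
          Function.iterate_succ_apply]
        exact e
      · obtain ⟨N, hN, e⟩ := ih (a + 1) b F (D G) (by omega) hF hG
        obtain ⟨N', hN', e'⟩ := ih a (b + 1) (D F) G (by omega) hF hG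
        refine ⟨N + N', by omega, ?_⟩
        have h1 : a + 1 + (b + 1) = (a + 1 + b) + 1 := by omega
        have h2 : a + 1 + b = a + (b + 1) := by omega
        rw [h1, Function.iterate_succ_apply, hD, iterate_map_add, e, h2, e',
          Function.iterate_succ_apply D b, Function.iterate_succ_apply D a]
        push_cast; ring

theorem exists_ord {D : Derivation K R2 R2} (hD : LND D) {F : R2} (hF : F ≠ 0) :
    ∃ a, D^[a] F ≠ 0 ∧ D^[a + 1] F = 0 := by
  classical
  have h := hD F
  have h0 : Nat.find h ≠ 0 := by
    intro h0
    have := Nat.find_spec h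
    rw [h0] at this
    exact hF this
  obtain ⟨a, ha⟩ := Nat.exists_eq_succ_of_ne_zero h0
  refine ⟨a, Nat.find_min h (by omega), ?_⟩
  have := Nat.find_spec h
  rwa [ha] at this

theorem ord_mul [CharZero K] {D : Derivation K R2 R2} (hD : LND D) {F G : R2} {a : ℕ}
    (h1 : D^[a] F ≠ 0) (h2 : D^[a + 1] F = 0) (hG : G ≠ 0) : D^[a] (F * G) ≠ 0 := by
  obtain ⟨b, hb, hb'⟩ := exists_ord hD hG
  obtain ⟨N, hN, e⟩ := leib D _ a b F G rfl h2 hb'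
  intro h
  have := iter_zero_mono D (Nat.le_add_right a b) h
  rw [e] at this
  have hN' : (N : R2) ≠ 0 := by exact_mod_cast hN.ne'
  exact mul_ne_zero hN' (mul_ne_zero h1 hb) this

theorem ord_step [CharZero K] {D : Derivation K R2 R2} (hD : LND D) {x y g : R2} {a b : ℕ}
    (ha' : D^[a + 1] x = 0) (hb : D^[b] y ≠ 0) (hb' : D^[b + 1] y = 0)
    (h : D x = y * g) (hx : D x ≠ 0) : b + 1 ≤ a := by
  have hg : g ≠ 0 := by rintro rfl; exact hx (by simp [h])
  have h1 := ord_mul hD hb hb' hg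
  rw [← h, ← Function.iterate_succ_apply] at h1
  by_contra hlt
  exact h1 (iter_zero_mono D (by omega) ha')

theorem no_self [CharZero K] {D : Derivation K R2 R2} (hD : LND D) {x g : R2}
    (h : D x = x * g) (hx : D x ≠ 0) : False := by
  have x0 : x ≠ 0 := by rintro rfl; simp at hx
  obtain ⟨a, ha, ha'⟩ := exists_ord hD x0
  have := ord_step hD ha' ha ha' h hx
  omega

theorem no_cross [CharZero K] {D : Derivation K R2 R2} (hD : LND D) {x y g k : R2}
    (h : D x = y * g) (hx : D x ≠ 0) (h' : D y = x * k) (hy : D y ≠ 0) : False := by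
  have x0 : x ≠ 0 := by rintro rfl; simp at hx
  have y0 : y ≠ 0 := by rintro rfl; simp at hy
  obtain ⟨a, ha, ha'⟩ := exists_ord hD x0
  obtain ⟨b, hb, hb'⟩ := exists_ord hD y0
  have := ord_step hD ha' hb hb' h hx
  have := ord_step hD hb' ha ha' h' hy
  omega

/-- weight bounded above -/
def WLE (a b k : ℤ) (F : R2) : Prop := ∀ s, coeff s F ≠ 0 → a * s 0 + b * s 1 ≤ k

theorem WLE.add {a b k : ℤ} {F G : R2} (hF : WLE a b k F) (hG : WLE a b k G) :
    WLE a b k (F + G) := by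
  intro s hs
  by_cases h : coeff s F = 0
  · apply hG s; intro h'; exact hs (by rw [coeff_add, h, h', add_zero])
  · exact hF s h

theorem WLE.neg {a b k : ℤ} {F : R2} (hF : WLE a b k F) : WLE a b k (-F) := by
  intro s hs
  apply hF s; simpa using hs

theorem WLE.sub {a b k : ℤ} {F G : R2} (hF : WLE a b k F) (hG : WLE a b k G) :
    WLE a b k (F - G) := by
  rw [sub_eq_add_neg]; exact hF.add hG.neg

theorem WLE.mul {a b k l : ℤ} {F G : R2} (hF : WLE a b k F) (hG : WLE a b l G) :
    WLE a b (k + l) (F * G) := by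
  classical
  intro s hs
  rw [coeff_mul] at hs
  obtain ⟨⟨p, q⟩, hpq, hne⟩ := Finset.exists_ne_zero_of_sum_ne_zero hs
  have hpq : p + q = s := by simpa using hpq
  have h1 := hF p (left_ne_zero_of_mul hne)
  have h2 := hG q (right_ne_zero_of_mul hne)
  subst hpq
  simp only [Finsupp.add_apply]
  push_cast
  linarith

theorem WLE.pd0 {a b k : ℤ} {F : R2} (hF : WLE a b k F) : WLE a b (k - a) (pderiv 0 F) := by
  intro s hs
  rw [coeff_pderiv] at hs
  have := hF _ (left_ne_zero_of_mul hs)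
  simp at this
  linarith

theorem WLE.pd1 {a b k : ℤ} {F : R2} (hF : WLE a b k F) : WLE a b (k - b) (pderiv 1 F) := by
  intro s hs
  rw [coeff_pderiv] at hs
  have := hF _ (left_ne_zero_of_mul hs)
  simp at this
  linarith

theorem WLE.jac {a b k l t : ℤ} {F G : R2} (hF : WLE a b k F) (hG : WLE a b l G)
    (ht : t = l + (k - a - b)) : WLE a b t (Jac F G) := by
  have h1 := hF.pd0.mul hG.pd1
  have h2 := hF.pd1.mul hG.pd0
  have e1 : k - a + (l - b) = t := by omega
  have e2 : k - b + (l - a) = t := by omega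
  rw [e1] at h1
  rw [e2] at h2
  exact h1.sub h2

theorem graded_lnd {m n N : ℤ} {A Ap : R2} (h1 : WLE m n N Ap) (h2 : WLE (-m) (-n) (-N) Ap)
    (h3 : WLE m n (N - 1) (A - Ap)) (hA : LND (JD A)) : LND (JD Ap) := by
  have hA1 : WLE m n N A := by
    have : A = Ap + (A - Ap) := by ring
    rw [this]
    refine h1.add ?_
    intro s hs; have := h3 s hs; omega
  intro F
  induction F using MvPolynomial.induction_on' with
  | monomial t c =>
    classical
    set F : R2 := monomial t c with hF
    set k : ℤ := m * t 0 + n * t 1 with hk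
    have f1 : WLE m n k F := by
      intro s hs
      rw [hF, coeff_monomial] at hs
      split_ifs at hs with h
      · rw [← h]
      · exact absurd rfl hs
    have f2 : WLE (-m) (-n) (-k) F := by
      intro s hs
      rw [hF, coeff_monomial] at hs
      split_ifs at hs with h
      · rw [← h, hk]; apply le_of_eq; ring
      · exact absurd rfl hs
    have key : ∀ j : ℕ, WLE m n (k + j * (N - m - n)) ((JD Ap)^[j] F) ∧
        WLE (-m) (-n) (-(k + j * (N - m - n))) ((JD Ap)^[j] F) ∧
        WLE m n (k + j * (N - m - n) - 1) ((JD A)^[j] F - (JD Ap)^[j] F) := by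
      intro j
      induction j with
      | zero =>
        refine ⟨by simpa using f1, by simpa using f2, ?_⟩
        intro s hs; simp at hs
      | succ j ih =>
        obtain ⟨i1, i2, i3⟩ := ih
        rw [Function.iterate_succ_apply', Function.iterate_succ_apply', JD_apply, JD_apply]
        refine ⟨h1.jac i1 (by push_cast; ring), h2.jac i2 (by push_cast; ring), ?_⟩
        have : Jac A ((JD A)^[j] F) - Jac Ap ((JD Ap)^[j] F) =
          Jac A ((JD A)^[j] F - (JD Ap)^[j] F) + Jac (A - Ap) ((JD Ap)^[j] F) := by
          simp only [Jac, map_sub]; ring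
        rw [this]
        exact (hA1.jac i3 (by push_cast; ring)).add (h3.jac i1 (by push_cast; ring))
    obtain ⟨j, hj⟩ := hA F
    refine ⟨j, ?_⟩
    obtain ⟨i1, i2, i3⟩ := key j
    rw [hj, zero_sub] at i3
    ext s
    rw [coeff_zero]
    by_contra hs
    have a1 := i2 s hs
    have a2 := i3.neg s (by simpa using hs)
    linarith
  | add p q hp hq =>
    obtain ⟨a, ha⟩ := hp
    obtain ⟨b, hb⟩ := hq
    refine ⟨a + b, ?_⟩
    rw [iterate_map_add, iter_zero_mono _ (Nat.le_add_right a b) ha,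
      iter_zero_mono _ (Nat.le_add_left b a) hb, add_zero]

theorem X_dvd_of_supp {F : R2} (i : Fin 2) (h : ∀ s, coeff s F ≠ 0 → s i ≠ 0) : X i ∣ F := by
  rw [as_sum F]
  refine Finset.dvd_sum fun s hs => ?_
  have := h s (mem_support_iff.1 hs)
  rw [monomial_eq2]
  refine Dvd.dvd.mul_left ?_ _
  fin_cases i
  · exact Dvd.dvd.mul_right (dvd_pow_self _ this) _
  · exact Dvd.dvd.mul_left (dvd_pow_self _ this) _

theorem supp_of_pderiv_zero [CharZero K] {F : R2} {i : Fin 2} (h : pderiv i F = 0)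
    {s : Fin 2 →₀ ℕ} (hs : coeff s F ≠ 0) : s i = 0 := by
  by_contra hi
  have h1 := coeff_pderiv (i := i) F (s - Finsupp.single i 1)
  rw [h, coeff_zero] at h1
  have e : s - Finsupp.single i 1 + Finsupp.single i 1 = s := by
    ext j
    by_cases hj : i = j
    · subst hj; simp; omega
    · simp [hj]
  rw [e] at h1
  rcases mul_eq_zero.1 h1.symm with h | h
  · exact hs h
  · norm_cast at h

theorem lead_pure [CharZero K] {A : R2} (hA0 : A ≠ 0) (hA : LND (JD A)) {m n : ℕ} (hm : 0 < m)
    (hn : 0 < n) (hmn : ¬ m ∣ n) (hnm : ¬ n ∣ m) :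
    ∃ k, coeff k A ≠ 0 ∧ (k 0 = 0 ∨ k 1 = 0) ∧
      ∀ s, coeff s A ≠ 0 → s = k ∨ m * s 0 + n * s 1 < m * k 0 + n * k 1 := by
  classical
  obtain ⟨k, hk, hmax⟩ := Finset.exists_max_image A.support (fun s => m * s 0 + n * s 1)
    (by simpa [Finset.nonempty_iff_ne_empty] using hA0)
  set N := m * k 0 + n * k 1 with hN
  set Ap : R2 := ∑ s ∈ A.support.filter (fun s => m * s 0 + n * s 1 = N), monomial s (coeff s A)
    with hAp
  have cAp : ∀ s, coeff s Ap = if m * s 0 + n * s 1 = N then coeff s A else 0 := by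
    intro s
    rw [hAp, coeff_sum]
    simp only [coeff_monomial]
    rw [Finset.sum_ite_eq']
    by_cases h : m * s 0 + n * s 1 = N
    · by_cases h' : coeff s A = 0 <;> simp [h, h']
    · simp [h]
  have wAp : ∀ s, coeff s Ap ≠ 0 → m * s 0 + n * s 1 = N ∧ coeff s A ≠ 0 := by
    intro s hs
    rw [cAp] at hs
    split_ifs at hs with h
    · exact ⟨h, hs⟩
    · exact absurd rfl hs
  have kAp : coeff k Ap ≠ 0 := by
    rw [cAp, if_pos rfl]; exact mem_support_iff.1 hk
  have hD : LND (JD Ap) := by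
    refine graded_lnd (m := m) (n := n) (N := N) ?_ ?_ ?_ hA
    · intro s hs
      have := (wAp s hs).1
      exact_mod_cast this.le
    · intro s hs
      have : ((m * s 0 + n * s 1 : ℕ) : ℤ) = N := by rw [(wAp s hs).1]
      push_cast at this
      linarith
    · intro s hs
      rw [coeff_sub, cAp] at hs
      split_ifs at hs with h
      · simp at hs
      · rw [sub_zero] at hs
        have h1 : m * s 0 + n * s 1 ≤ N := hmax s (mem_support_iff.2 hs)
        have h2 : ((m * s 0 + n * s 1 : ℕ) : ℤ) ≤ N - 1 := by omega
        exact_mod_cast h2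
  have fin : ∀ s, coeff s A ≠ 0 → (coeff s Ap ≠ 0 → s = k) →
      s = k ∨ m * s 0 + n * s 1 < N := by
    intro s hs h
    have h1 : m * s 0 + n * s 1 ≤ N := hmax s (mem_support_iff.2 hs)
    rcases h1.lt_or_eq with h2 | h2
    · exact Or.inr h2
    · exact Or.inl (h (by rw [cAp, if_pos h2]; exact hs))
  by_cases d0 : pderiv 0 Ap = 0
  · have hk0 := supp_of_pderiv_zero d0 kAp
    refine ⟨k, mem_support_iff.1 hk, Or.inl hk0, fun s hs => fin s hs fun hs' => ?_⟩
    have hs0 := supp_of_pderiv_zero d0 hs'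
    have := (wAp s hs').1
    rw [hN, hs0, hk0] at this
    simp at this
    exact ex_ext (by omega) (this.resolve_right hn.ne')
  by_cases d1 : pderiv 1 Ap = 0
  · have hk0 := supp_of_pderiv_zero d1 kAp
    refine ⟨k, mem_support_iff.1 hk, Or.inr hk0, fun s hs => fin s hs fun hs' => ?_⟩
    have hs0 := supp_of_pderiv_zero d1 hs'
    have := (wAp s hs').1
    rw [hN, hs0, hk0] at this
    simp at this
    exact ex_ext (this.resolve_right hm.ne') (by omega)
  exfalso
  have D0 : JD Ap (X 0) = - pderiv 1 Ap := by simp [JD]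
  have D1 : JD Ap (X 1) = pderiv 0 Ap := by simp [JD]
  have ne0 : JD Ap (X 0) ≠ 0 := by rw [D0]; exact neg_ne_zero.2 d1
  have ne1 : JD Ap (X 1) ≠ 0 := by rw [D1]; exact d0
  -- a pure power of the second variable
  obtain ⟨j, hj⟩ : ∃ j, N = n * j := by
    by_contra hcon
    push Not at hcon
    have : (X 0 : R2) ∣ JD Ap (X 0) := by
      rw [D0, dvd_neg]
      apply X_dvd_of_supp
      intro s hs h0
      rw [coeff_pderiv] at hs
      have := (wAp _ (left_ne_zero_of_mul hs)).1
      simp [h0] at this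
      exact hcon _ this.symm
    obtain ⟨g, hg⟩ := this
    exact no_self hD hg ne0
  obtain ⟨i, hi⟩ : ∃ i, N = m * i := by
    by_contra hcon
    push Not at hcon
    have : (X 1 : R2) ∣ JD Ap (X 1) := by
      rw [D1]
      apply X_dvd_of_supp
      intro s hs h0
      rw [coeff_pderiv] at hs
      have := (wAp _ (left_ne_zero_of_mul hs)).1
      simp [h0] at this
      exact hcon _ this.symm
    obtain ⟨g, hg⟩ := this
    exact no_self hD hg ne1
  have c0 : (X 1 : R2) ∣ JD Ap (X 0) := by
    rw [D0, dvd_neg]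
    apply X_dvd_of_supp
    intro s hs h0
    rw [coeff_pderiv] at hs
    have := (wAp _ (left_ne_zero_of_mul hs)).1
    simp [h0] at this
    apply hmn
    exact (Nat.dvd_add_right (dvd_mul_right m (s 0))).1 (by rw [this, hi]; exact dvd_mul_right _ _)
  have c1 : (X 0 : R2) ∣ JD Ap (X 1) := by
    rw [D1]
    apply X_dvd_of_supp
    intro s hs h0
    rw [coeff_pderiv] at hs
    have := (wAp _ (left_ne_zero_of_mul hs)).1
    simp [h0] at this
    apply hnm
    exact (Nat.dvd_add_left (dvd_mul_right n (s 1))).1 (by rw [this, hj]; exact dvd_mul_right _ _)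
  obtain ⟨g, hg⟩ := c0
  obtain ⟨g', hg'⟩ := c1
  exact no_cross hD hg ne0 hg' ne1

theorem pderiv_nil (i : Fin 2) : ∀ (n : ℕ) (F : R2), F.totalDegree < n →
    (pderiv i : Derivation K R2 R2)^[n] F = 0 := by
  intro n
  induction n with
  | zero => intro F h; omega
  | succ n ih =>
    intro F h
    rw [Function.iterate_succ_apply]
    by_cases h0 : pderiv i F = 0
    · rw [h0]; exact iterate_map_zero _ n
    · have := totalDegree_pderiv_lt i h0
      exact ih _ (by omega)

theorem lnd_of_auto {A : R2} (φ : R2 →ₐ[K] R2) (hφ : Function.Surjective φ) (i : Fin 2) (u : K)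
    (h : ∀ F, Jac A (φ F) = C u * φ (pderiv i F)) : LND (JD A) := by
  intro F
  obtain ⟨G, rfl⟩ := hφ F
  have key : ∀ n, (JD A)^[n] (φ G) = C u ^ n * φ ((pderiv i : Derivation K R2 R2)^[n] G) := by
    intro n
    induction n with
    | zero => simp
    | succ n ih =>
      rw [Function.iterate_succ_apply', ih, Function.iterate_succ_apply', ← C_pow,
        ← smul_eq_C_mul, Derivation.map_smul, JD_apply, h, smul_eq_C_mul, C_pow, pow_succ]
      ring
  exact ⟨G.totalDegree + 1, by rw [key, pderiv_nil i _ _ (Nat.lt_succ_self _)]; simp⟩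


theorem algHom_eval_sum (f : R2 →ₐ[K] R2) (A : R2) :
    f A = ∑ s ∈ A.support, C (coeff s A) * (f (X 0) ^ s 0 * f (X 1) ^ s 1) := by
  conv_lhs => rw [as_sum A]
  rw [map_sum]
  refine Finset.sum_congr rfl fun s _ => ?_
  rw [monomial_eq2, map_mul, map_mul, map_pow, map_pow, algHom_C2]

theorem coeff_eval (mo : MonomialOrder (Fin 2)) (f : R2 →ₐ[K] R2) {e e' : Fin 2 →₀ ℕ}
    (he : mo.degree (f (X 0)) = e) (he' : mo.degree (f (X 1)) = e')
    (hP : f (X 0) ≠ 0) (hQ : f (X 1) ≠ 0) {A : R2} {k : Fin 2 →₀ ℕ} (hk : coeff k A ≠ 0)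
    (h : ∀ s, coeff s A ≠ 0 → s = k ∨
      mo.toSyn (s 0 • e + s 1 • e') < mo.toSyn (k 0 • e + k 1 • e')) :
    coeff (k 0 • e + k 1 • e') (f A) ≠ 0 := by
  have hdeg : ∀ s : Fin 2 →₀ ℕ, mo.degree (f (X 0) ^ s 0 * f (X 1) ^ s 1) =
      s 0 • e + s 1 • e' := by
    intro s
    rw [mo.degree_mul (pow_ne_zero _ hP) (pow_ne_zero _ hQ), mo.degree_pow, mo.degree_pow, he, he']
  rw [algHom_eval_sum, coeff_sum, Finset.sum_eq_single k]
  · rw [coeff_C_mul]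
    refine mul_ne_zero hk ?_
    rw [← hdeg k, mo.coeff_degree_ne_zero_iff]
    exact mul_ne_zero (pow_ne_zero _ hP) (pow_ne_zero _ hQ)
  · intro s hs hne
    rw [coeff_C_mul]
    refine mul_eq_zero_of_right _ (mo.coeff_eq_zero_of_lt ?_)
    rw [hdeg]
    exact (h s (mem_support_iff.1 hs)).resolve_left hne
  · intro h; exact absurd (mem_support_iff.2 hk) h

theorem ray_lt (mo : MonomialOrder (Fin 2)) {e a b : Fin 2 →₀ ℕ} (he : e ≠ 0) {m u v : ℕ}
    (hm : 0 < m) (ha : m • a = u • e) (hb : m • b = v • e) (h : u < v) :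
    mo.toSyn a < mo.toSyn b := by
  have he' : 0 < mo.toSyn e := by
    rw [mo.toSyn_lt_iff_ne_zero]
    intro h; exact he ((mo.toSyn_eq_zero_iff e).1 h)
  by_contra hcon
  push Not at hcon
  have h1 : m • mo.toSyn b ≤ m • mo.toSyn a := nsmul_le_nsmul_right hcon m
  rw [← map_nsmul, ← map_nsmul, ha, hb, map_nsmul, map_nsmul] at h1
  exact absurd h1 (not_le.2 (nsmul_lt_nsmul_left he' h))

theorem supp_bound [CharZero K] (mo : MonomialOrder (Fin 2)) (f : R2 →ₐ[K] R2)
    {e e' d : Fin 2 →₀ ℕ}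
    (he : mo.degree (f (X 0)) = e) (he' : mo.degree (f (X 1)) = e')
    (hP : f (X 0) ≠ 0) (hQ : f (X 1) ≠ 0) (e0 : e ≠ 0) {m n r : ℕ} (hm : 0 < m) (hn : 0 < n)
    (hmn : ¬ m ∣ n) (hnm : ¬ n ∣ m) (hray : n • e = m • e') (hr : r • e = m • d)
    {A : R2} (hA0 : A ≠ 0) (hA : LND (JD A))
    (hfA : ∀ s, coeff s (f A) ≠ 0 → mo.toSyn s ≤ mo.toSyn d) :
    ∀ s, coeff s A ≠ 0 → m * s 0 + n * s 1 ≤ r := by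
  have hw : ∀ s : Fin 2 →₀ ℕ, m • (s 0 • e + s 1 • e') = (m * s 0 + n * s 1) • e := by
    intro s
    rw [smul_add, smul_comm m (s 1), ← hray, add_smul, smul_smul, smul_smul, mul_comm n]
  obtain ⟨k, hk, -, hmax⟩ := lead_pure hA0 hA hm hn hmn hnm
  have h1 := coeff_eval mo f he he' hP hQ hk (fun s hs => (hmax s hs).imp_right fun h =>
    ray_lt mo e0 hm (hw s) (hw k) h)
  have h2 := hfA _ h1
  have h3 : m * k 0 + n * k 1 ≤ r := by
    by_contra hcon
    push Not at hcon
    exact absurd h2 (not_le.2 (ray_lt mo e0 hm hr.symm (hw k) hcon))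
  intro s hs
  rcases hmax s hs with rfl | h
  · exact h3
  · omega

theorem finish [CharZero K] {P Q G : R2} {a b c' c : K} {S : Subalgebra K R2} (hPS : P ∈ S)
    (hQS : Q ∈ S) (hGS : G ∈ S) (hc : c ≠ 0) (hJ : Jac P Q = C c) (hG : Jac P G = 0)
    (hP : eps K P = C a * P + C b) (hQ : eps K Q = C c' * Q + G) : X 0 ∈ S ∧ X 1 ∈ S := by
  have hCS : ∀ t : K, (C t : R2) ∈ S := fun t => S.algebraMap_mem t
  have two : (C (1/2) : R2) * 2 = 1 := by
    have : (2 : R2) = C 2 := (map_ofNat C 2).symm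
    rw [this, ← C_mul]; norm_num
  have hC : (C c : R2) ≠ 0 := by simpa using hc
  have jl : ∀ U V W : R2, Jac U (V + W) = Jac U V + Jac U W := by
    intro U V W; simp only [Jac, map_add]; ring
  have j1 : Jac (C a * P + C b) (C c' * Q + G) = C a * C c' * Jac P Q + C a * Jac P G := by
    simp only [Jac, map_add, pderiv_C_mul, pderiv_C]; ring
  rw [← hP, ← hQ, Jac_eps, hJ, hG, algHom_C2, mul_zero, add_zero] at j1
  have h1 : C a * C c' = (-1 : R2) := by
    apply mul_right_cancel₀ hC; rw [← j1]; ring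
  have e1 := eps_eps P
  rw [hP, map_add, map_mul, algHom_C2, algHom_C2, hP] at e1
  have e2 := eps_eps Q
  rw [hQ, map_add, map_mul, algHom_C2, hQ] at e2
  have j2 : Jac (C a * (C a * P + C b) + C b) Q = C a * C a * Jac P Q := by
    simp only [Jac, map_add, pderiv_C_mul, pderiv_C]; ring
  rw [e1, hJ] at j2
  have h2 : (C a - 1) * (C a + 1) = (0 : R2) := by
    apply mul_right_cancel₀ hC; linear_combination -j2
  rcases mul_eq_zero.1 h2 with h | h
  · have ha : (C a : R2) = 1 := by linear_combination h
    rw [ha] at h1 e1 hP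
    have hc' : (C c' : R2) = -1 := by linear_combination h1
    rw [hc'] at e2 hQ
    have hb : (C b : R2) = 0 := by linear_combination C (1/2) * e1 - C b * two
    have hG' : eps K G = G := by linear_combination e2
    refine even_odd (P := P) (Q := Q - C (1/2) * G) ?_ ?_ hc ?_ hPS
      (S.sub_mem hQS (S.mul_mem (hCS _) hGS))
    · rw [hP, hb]; ring
    · rw [map_sub, map_mul, algHom_C2, hQ, hG']
      linear_combination -G * two
    · have : Jac P (Q - C (1/2) * G) = Jac P Q - C (1/2) * Jac P G := by
        simp only [Jac, map_sub, pderiv_C_mul]; ring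
      rw [this, hJ, hG]; ring
  · have ha : (C a : R2) = -1 := by linear_combination h
    rw [ha] at h1 e1 hP
    have hc' : (C c' : R2) = 1 := by linear_combination -h1
    rw [hc'] at e2 hQ
    have hG' : eps K G = -G := by linear_combination e2
    refine even_odd (Q := P - C (1/2) * C b) (P := Q + C (1/2) * G) (c := -c) ?_ ?_
      (neg_ne_zero.2 hc) ?_ (S.add_mem hQS (S.mul_mem (hCS _) hGS))
      (S.sub_mem hPS (S.mul_mem (hCS _) (hCS _)))
    · rw [map_add, map_mul, algHom_C2, hQ, hG']
      linear_combination -G * two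
    · rw [map_sub, map_mul, algHom_C2, algHom_C2, hP]
      linear_combination -C b * two
    · have : Jac (Q + C (1/2) * G) (P - C (1/2) * C b) = - Jac P Q - C (1/2) * Jac P G := by
        simp only [Jac, map_sub, map_add, pderiv_C_mul, pderiv_C]; ring
      rw [this, hJ, hG, C_neg]; ring

theorem Jac_swap (P Q : R2) : Jac P Q = - Jac Q P := by unfold Jac; ring

/-- linear polynomials in one variable -/
theorem decompA {A : R2} {i j : Fin 2} (hij : i ≠ j)
    (h : ∀ s, coeff s A ≠ 0 → s j = 0 ∧ s i ≤ 1) : ∃ a b : K, A = C a * X i + C b := by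
  classical
  refine ⟨coeff (Finsupp.single i 1) A, coeff 0 A, ?_⟩
  ext s
  rw [coeff_add, coeff_C_mul, coeff_X, coeff_C]
  by_cases hs : coeff s A = 0
  · split_ifs with h1 h2 h2
    · rw [← h2] at h1; simp at h1
    · subst h1; simp [hs]
    · subst h2; simp [hs]
    · simp [hs]
  · obtain ⟨h1, h2⟩ := h s hs
    have h3 : ∀ k, k = i ∨ k = j := by intro k; omega
    rcases Nat.le_one_iff_eq_zero_or_eq_one.1 h2 with h4 | h4
    · have : s = 0 := by ext k; rcases h3 k with rfl | rfl <;> simp [*]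
      subst this; simp
    · have : s = Finsupp.single i 1 := by
        ext k; rcases h3 k with rfl | rfl
        · simp [h4]
        · simp [h1, hij]
      subst this
      have h0 : (0 : Fin 2 →₀ ℕ) ≠ Finsupp.single i 1 := fun h => by simp [← h] at h4
      simp [h0]

theorem decompB {B : R2} {i j : Fin 2} (hij : i ≠ j)
    (h : ∀ s, coeff s B ≠ 0 → s j = 0 ∨ (s j = 1 ∧ s i = 0)) :
    ∃ (a : K) (g : R2), B = C a * X j + g ∧ pderiv j g = 0 := by
  classical
  refine ⟨coeff (Finsupp.single j 1) B, B - C (coeff (Finsupp.single j 1) B) * X j, by ring, ?_⟩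
  ext s
  rw [coeff_pderiv, coeff_zero, coeff_sub, coeff_C_mul, coeff_X]
  by_cases hs : coeff (s + Finsupp.single j 1) B = 0
  · split_ifs with h1
    · rw [← h1] at hs ⊢; simp
    · simp [hs]
  · have h3 : ∀ k, k = i ∨ k = j := by intro k; omega
    have h4 := h _ hs
    simp [hij.symm] at h4
    have : s = 0 := by ext k; rcases h3 k with rfl | rfl <;> simp [*]
    subst this; simp

theorem lex_le2 {s t : Fin 2 →₀ ℕ}
    (h : (MonomialOrder.lex (σ := Fin 2)).toSyn s ≤ (MonomialOrder.lex (σ := Fin 2)).toSyn t) :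
    s 0 < t 0 ∨ (s 0 = t 0 ∧ s 1 ≤ t 1) := by
  rw [MonomialOrder.lex_le_iff, le_iff_eq_or_lt] at h
  rcases h with h | h
  · have : s = t := toLex.injective h
    subst this; right; exact ⟨rfl, le_rfl⟩
  · rw [Finsupp.Lex.lt_iff] at h
    obtain ⟨i, h1, h2⟩ := h
    fin_cases i
    · left; exact h2
    · right; exact ⟨h1 0 (by simp), le_of_lt h2⟩

theorem base_case [CharZero K] {P Q : R2} {S : Subalgebra K R2} (hPS : P ∈ S) (hQS : Q ∈ S)
    (hP : (MonomialOrder.lex (σ := Fin 2)).degree P = ex 1 0)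
    (hQ : (MonomialOrder.lex (σ := Fin 2)).degree Q = ex 0 1)
    (hP0 : P ≠ 0) (hQ0 : Q ≠ 0) : X 0 ∈ S ∧ X 1 ∈ S := by
  have hCS : ∀ t : K, (C t : R2) ∈ S := fun t => S.algebraMap_mem t
  have cP := (MonomialOrder.lex (σ := Fin 2)).coeff_degree_ne_zero_iff.2 hP0
  have cQ := (MonomialOrder.lex (σ := Fin 2)).coeff_degree_ne_zero_iff.2 hQ0
  rw [hP] at cP
  rw [hQ] at cQ
  have sP : ∀ s, coeff s P ≠ 0 → s 0 < 1 ∨ (s 0 = 1 ∧ s 1 ≤ 0) := by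
    intro s hs
    have := lex_le2 (MonomialOrder.le_degree (mem_support_iff.2 hs))
    rw [hP] at this; simpa using this
  have sQ : ∀ s, coeff s Q ≠ 0 → s 0 < 0 ∨ (s 0 = 0 ∧ s 1 ≤ 1) := by
    intro s hs
    have := lex_le2 (MonomialOrder.le_degree (mem_support_iff.2 hs))
    rw [hQ] at this; simpa using this
  have inv : ∀ {a : K} {Y : R2}, a ≠ 0 → C a * Y ∈ S → Y ∈ S := by
    intro a Y ha h
    have : Y = C a⁻¹ * (C a * Y) := by
      rw [← mul_assoc, ← C_mul, inv_mul_cancel₀ ha, C_1, one_mul]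
    rw [this]; exact S.mul_mem (hCS _) h
  have x1 : X 1 ∈ S := by
    obtain ⟨a, b, e⟩ := decompA (A := Q) (i := 1) (j := 0) (by simp)
      (fun s hs => by have := sQ s hs; omega)
    have ha : a ≠ 0 := by
      rintro rfl
      rw [e] at cQ
      apply cQ
      classical
      rw [C_0, zero_mul, zero_add, coeff_C, if_neg]
      intro h
      have := DFunLike.congr_fun h 1
      simp at this
    apply inv ha
    have : C a * X 1 = Q - C b := by rw [e]; ring
    rw [this]; exact S.sub_mem hQS (hCS _)
  refine ⟨?_, x1⟩
  obtain ⟨a, g, e, hg⟩ := decompB (B := P) (i := 1) (j := 0) (by simp)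
      (fun s hs => by have := sP s hs; omega)
  have hgS : g ∈ S := by
    rw [as_sum g]
    refine S.sum_mem fun s hs => ?_
    rw [monomial_eq2, supp_of_pderiv_zero hg (mem_support_iff.1 hs), pow_zero, one_mul]
    exact S.mul_mem (hCS _) (S.pow_mem x1 _)
  have ha : a ≠ 0 := by
    rintro rfl
    rw [e, C_0, zero_mul, zero_add] at cP
    have := supp_of_pderiv_zero hg cP
    simp at this
  apply inv ha
  have : C a * X 0 = P - g := by rw [e]; ring
  rw [this]; exact S.sub_mem hPS hgS

theorem reduce_deg (mo : MonomialOrder (Fin 2)) {P Q : R2} {k : ℕ}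
    (h : mo.degree Q = k • mo.degree P) (hP : P ≠ 0)
    (h0 : ∀ t : K, mo.degree (Q - C t * P ^ k) ≠ 0) :
    ∃ t : K, mo.toSyn (mo.degree (Q - C t * P ^ k)) < mo.toSyn (mo.degree Q) := by
  have hd : mo.degree (P ^ k) = mo.degree Q := by rw [mo.degree_pow, h]
  have hc : coeff (mo.degree Q) (P ^ k) ≠ 0 := by
    rw [← hd, mo.coeff_degree_ne_zero_iff]; exact pow_ne_zero _ hP
  set t : K := coeff (mo.degree Q) Q / coeff (mo.degree Q) (P ^ k) with ht
  refine ⟨t, lt_of_le_of_ne ?_ ?_⟩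
  · refine mo.degree_sub_le.trans (sup_le le_rfl ?_)
    rw [← hd, ← smul_eq_C_mul]
    exact mo.degree_smul_le
  · intro he
    have he := mo.toSyn.injective he
    have hne : Q - C t * P ^ k ≠ 0 := by
      intro hz; apply h0 t; rw [hz, mo.degree_zero]
    have h1 := mo.coeff_degree_ne_zero_iff.2 hne
    apply h1
    rw [he, coeff_sub, coeff_C_mul, ht, div_mul_cancel₀ _ hc, sub_self]

theorem deg_ne_zero (mo : MonomialOrder (Fin 2)) {P Q : R2} {c : K} (hc : c ≠ 0)
    (hJ : Jac P Q = C c) : mo.degree P ≠ 0 := by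
  intro h
  rw [mo.eq_C_of_degree_eq_zero h] at hJ
  simp [Jac] at hJ
  exact hc (C_eq_zero.1 hJ.symm)

/-- the incommensurable case -/
theorem bad_case [CharZero K] (mo : MonomialOrder (Fin 2)) (f : R2 →ₐ[K] R2) {c : K} (hc : c ≠ 0)
    (hJ : Jac (f (X 0)) (f (X 1)) = C c) (hS : ∀ y ∈ f.range, eps K y ∈ f.range)
    {e e' : Fin 2 →₀ ℕ} (he : mo.degree (f (X 0)) = e) (he' : mo.degree (f (X 1)) = e')
    (e0 : e ≠ 0) {m n : ℕ} (hm : 0 < m) (hn : 0 < n)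
    (hmn : ¬ m ∣ n) (hnm : ¬ n ∣ m) (hray : n • e = m • e') : X 0 ∈ f.range ∧ X 1 ∈ f.range := by
  have hC : (C c : R2) ≠ 0 := by simpa using hc
  have hP : f (X 0) ≠ 0 := by intro h; rw [h] at hJ; simp [Jac] at hJ; exact hc (C_eq_zero.1 hJ.symm)
  have hQ : f (X 1) ≠ 0 := by intro h; rw [h] at hJ; simp [Jac] at hJ; exact hc (C_eq_zero.1 hJ.symm)
  have finj := keller_inj f (by rw [hJ]; exact hC)
  obtain ⟨A, hA⟩ := hS _ ⟨X 0, rfl⟩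
  obtain ⟨B, hB⟩ := hS _ ⟨X 1, rfl⟩
  replace hA : f A = eps K (f (X 0)) := hA
  replace hB : f B = eps K (f (X 1)) := hB
  set φ : R2 →ₐ[K] R2 := aeval ![A, B] with hφ
  have φ0 : φ (X 0) = A := by simp [hφ]
  have φ1 : φ (X 1) = B := by simp [hφ]
  have comp1 : f.comp φ = (eps K).comp f := by
    apply algHom_ext2
    · simp [φ0, hA]
    · simp [φ1, hB]
  have comp2 : ∀ F, f (φ F) = eps K (f F) := fun F => DFunLike.congr_fun comp1 F
  have φsurj : Function.Surjective φ := by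
    intro F
    refine ⟨φ F, finj ?_⟩
    rw [comp2, comp2, eps_eps]
  have jAB : Jac A B = -1 := by
    apply finj
    apply mul_right_cancel₀ hC
    have := Jac_comp f A B
    rw [hA, hB, Jac_eps, hJ, algHom_C2] at this
    rw [← this]; simp
  have lA : LND (JD A) := by
    refine lnd_of_auto φ φsurj 1 (-1) fun F => ?_
    have := Jac_comp φ (X 0) F
    rw [φ0, φ1, jAB] at this
    rw [this]; simp [Jac]
  have lB : LND (JD B) := by
    refine lnd_of_auto φ φsurj 0 1 fun F => ?_
    have := Jac_comp φ (X 1) F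
    rw [φ0, φ1, jAB] at this
    rw [this]; simp [Jac]
  have A0 : A ≠ 0 := by rintro rfl; simp [Jac] at jAB
  have B0 : B ≠ 0 := by rintro rfl; simp [Jac] at jAB
  have epsle : ∀ F s, coeff s (eps K F) ≠ 0 → mo.toSyn s ≤ mo.toSyn (mo.degree F) := by
    intro F s hs
    rw [coeff_eps] at hs
    exact mo.le_degree (mem_support_iff.2 (right_ne_zero_of_mul hs))
  have sA := supp_bound mo f he he' hP hQ e0 hm hn hmn hnm hray (r := m) rfl A0 lA
    (by rw [hA]; intro s hs; have := epsle _ _ hs; rwa [he] at this)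
  have sB := supp_bound mo f he he' hP hQ e0 hm hn hmn hnm hray (r := n) hray B0 lB
    (by rw [hB]; intro s hs; have := epsle _ _ hs; rwa [he'] at this)
  have key : ∀ u v s t : ℕ, 0 < u → u < v → u * s + v * t ≤ u → t = 0 ∧ s ≤ 1 := by
    intro u v s t hu huv h
    constructor
    · by_contra ht
      have : v * 1 ≤ v * t := Nat.mul_le_mul_left v (by omega)
      omega
    · by_contra hs
      have : u * 2 ≤ u * s := Nat.mul_le_mul_left u (by omega)
      omega
  have key2 : ∀ u v s t : ℕ, 0 < u → u < v → u * s + v * t ≤ v → t = 0 ∨ (t = 1 ∧ s = 0) := by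
    intro u v s t hu huv h
    by_cases ht : t = 0
    · exact Or.inl ht
    right
    have h1 : v * 1 ≤ v * t := Nat.mul_le_mul_left v (by omega)
    have h2 : u * s = 0 := by omega
    have h3 : s = 0 := by rcases Nat.mul_eq_zero.1 h2 with h | h <;> omega
    refine ⟨?_, h3⟩
    by_contra ht1
    have : v * 2 ≤ v * t := Nat.mul_le_mul_left v (by omega)
    omega
  have m0 : ∀ F, f F ∈ f.range := fun F => ⟨F, rfl⟩
  rcases lt_trichotomy m n with h | h | h
  · obtain ⟨a, b, eA⟩ := decompA (A := A) (i := 0) (j := 1) (by simp)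
      fun s hs => key m n _ _ hm h (sA s hs)
    obtain ⟨c', g, eB, hg⟩ := decompB (B := B) (i := 0) (j := 1) (by simp)
      fun s hs => key2 m n _ _ hm h (sB s hs)
    refine finish (P := f (X 0)) (Q := f (X 1)) (G := f g) (a := a) (b := b) (c' := c')
      (m0 _) (m0 _) (m0 _) hc hJ ?_ ?_ ?_
    · rw [Jac_comp]; simp [Jac, hg]
    · rw [← hA, eA]; simp
    · rw [← hB, eB]; simp
  · exact absurd h.dvd hmn
  · obtain ⟨a, b, eB⟩ := decompA (A := B) (i := 1) (j := 0) (by simp)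
      fun s hs => key n m _ _ hn h (by have := sB s hs; omega)
    obtain ⟨c', g, eA, hg⟩ := decompB (B := A) (i := 1) (j := 0) (by simp)
      fun s hs => key2 n m _ _ hn h (by have := sA s hs; omega)
    refine finish (P := f (X 1)) (Q := f (X 0)) (G := f g) (a := a) (b := b) (c' := c')
      (c := -c) (m0 _) (m0 _) (m0 _) (neg_ne_zero.2 hc) ?_ ?_ ?_ ?_
    · rw [Jac_swap, hJ, C_neg]
    · rw [Jac_comp]; simp [Jac, hg]
    · rw [← hB, eB]; simp
    · rw [← hA, eA]; simp

theorem main_surj [CharZero K] : ∀ (w : (MonomialOrder.lex (σ := Fin 2)).syn)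
    (f : R2 →ₐ[K] R2) (c : K), c ≠ 0 → Jac (f (X 0)) (f (X 1)) = C c →
    (∀ y ∈ f.range, eps K y ∈ f.range) →
    (MonomialOrder.lex (σ := Fin 2)).toSyn ((MonomialOrder.lex (σ := Fin 2)).degree (f (X 0))) +
      (MonomialOrder.lex (σ := Fin 2)).toSyn ((MonomialOrder.lex (σ := Fin 2)).degree (f (X 1)))
      = w →
    X 0 ∈ f.range ∧ X 1 ∈ f.range := by
  intro w
  induction w using WellFoundedLT.induction with
  | ind w ih =>
  intro f c hc hJ hS hw
  set mo := MonomialOrder.lex (σ := Fin 2) with hmo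
  have hJ' : Jac (f (X 1)) (f (X 0)) = C (-c) := by rw [Jac_swap, hJ, C_neg]
  have hP : f (X 0) ≠ 0 := by intro h; rw [h] at hJ; simp [Jac] at hJ; exact hc (C_eq_zero.1 hJ.symm)
  have hQ : f (X 1) ≠ 0 := by intro h; rw [h] at hJ; simp [Jac] at hJ; exact hc (C_eq_zero.1 hJ.symm)
  obtain ⟨e, he⟩ : ∃ e, mo.degree (f (X 0)) = e := ⟨_, rfl⟩
  obtain ⟨e', he'⟩ : ∃ e', mo.degree (f (X 1)) = e' := ⟨_, rfl⟩
  have e0 : e ≠ 0 := he ▸ deg_ne_zero mo hc hJ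
  have e0' : e' ≠ 0 := he' ▸ deg_ne_zero mo (neg_ne_zero.2 hc) hJ'
  have m0 : ∀ F, f F ∈ f.range := fun F => ⟨F, rfl⟩
  have pos : ∀ d : Fin 2 →₀ ℕ, d ≠ 0 → 0 < d 0 + d 1 := by
    intro d hd
    by_contra h
    exact hd (ex_ext (by simp; omega) (by simp; omega))
  have hm := pos e e0
  have hn := pos e' e0'
  by_cases hdet : e 0 * e' 1 = e 1 * e' 0
  swap
  · have lead : ∀ (F : R2) d, mo.degree F = d → ∀ s, coeff s F ≠ 0 →
        s = d ∨ (mo.toSyn : (Fin 2 →₀ ℕ) →+ mo.syn) s < (mo.toSyn : (Fin 2 →₀ ℕ) →+ mo.syn) d := by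
      rintro F d rfl s hs
      rcases (mo.le_degree (mem_support_iff.2 hs)).eq_or_lt with h | h
      · left; exact mo.toSyn.injective h
      · right; exact h
    have h := jac_lead (mo.toSyn : (Fin 2 →₀ ℕ) →+ mo.syn) (lead (f (X 0)) e he)
      (lead (f (X 1)) e' he') (by rw [← he]; exact mo.coeff_degree_ne_zero_iff.2 hP)
      (by rw [← he']; exact mo.coeff_degree_ne_zero_iff.2 hQ) hdet hJ
    have h0 := DFunLike.congr_fun h 0
    have h1 := DFunLike.congr_fun h 1
    simp at h0 h1
    by_cases hh : e 0 = 1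
    · have : e' 0 = 0 := by omega
      have : e' 1 = 1 := by omega
      have : e 1 = 0 := by omega
      refine base_case (m0 (X 0)) (m0 (X 1)) ?_ ?_ hP hQ
      · rw [← hmo, he]; apply ex_ext <;> simp [*]
      · rw [← hmo, he']; apply ex_ext <;> simp [*]
    · have : e 0 = 0 := by omega
      have : e 1 = 1 := by omega
      have : e' 0 = 1 := by omega
      have : e' 1 = 0 := by omega
      refine base_case (m0 (X 1)) (m0 (X 0)) ?_ ?_ hQ hP
      · rw [← hmo, he']; apply ex_ext <;> simp [*]
      · rw [← hmo, he]; apply ex_ext <;> simp [*]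
  have hray : (e' 0 + e' 1) • e = (e 0 + e 1) • e' := by
    apply ex_ext <;> simp <;> linarith
  by_cases d1 : (e 0 + e 1) ∣ (e' 0 + e' 1)
  · obtain ⟨k, hk⟩ := d1
    have hek : e' = k • e := by
      rw [hk, mul_smul] at hray
      ext i
      have := DFunLike.congr_fun hray i
      simp only [Finsupp.smul_apply, smul_eq_mul] at this ⊢
      exact (Nat.eq_of_mul_eq_mul_left hm this).symm
    have hJt : ∀ t : K, Jac (f (X 0)) (f (X 1) - C t * f (X 0) ^ k) = C c := by
      intro t
      rw [← hJ]
      simp only [Jac, map_sub, pderiv_C_mul, Derivation.leibniz_pow, smul_eq_mul, nsmul_eq_mul]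
      ring
    obtain ⟨t, ht⟩ := reduce_deg mo (P := f (X 0)) (Q := f (X 1)) (k := k) (by rw [he, he', hek])
      hP (fun t => deg_ne_zero mo (neg_ne_zero.2 hc) (by rw [Jac_swap, hJt t, C_neg]))
    set g : R2 →ₐ[K] R2 := aeval ![f (X 0), f (X 1) - C t * f (X 0) ^ k] with hg
    have g0 : g (X 0) = f (X 0) := by simp [hg]
    have g1 : g (X 1) = f (X 1) - C t * f (X 0) ^ k := by simp [hg]
    have hr : g.range = f.range := by
      apply le_antisymm
      · apply range_le2
        · rw [g0]; exact m0 _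
        · rw [g1]
          exact ⟨X 1 - C t * X 0 ^ k, by simp⟩
      · apply range_le2
        · exact ⟨X 0, g0⟩
        · refine ⟨X 1 + C t * X 0 ^ k, ?_⟩
          simp [g0, g1]
    have := ih _ ?_ g c hc (by rw [g0, g1, hJt]) (by rw [hr]; exact hS) rfl
    · rwa [hr] at this
    · rw [← hw, g0, g1]
      exact add_lt_add_of_le_of_lt le_rfl ht
  by_cases d2 : (e' 0 + e' 1) ∣ (e 0 + e 1)
  · obtain ⟨k, hk⟩ := d2
    have hek : e = k • e' := by
      rw [hk, mul_smul] at hray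
      ext i
      have := DFunLike.congr_fun hray i
      simp only [Finsupp.smul_apply, smul_eq_mul] at this ⊢
      exact Nat.eq_of_mul_eq_mul_left hn this
    have hJt : ∀ t : K, Jac (f (X 0) - C t * f (X 1) ^ k) (f (X 1)) = C c := by
      intro t
      rw [← hJ]
      simp only [Jac, map_sub, pderiv_C_mul, Derivation.leibniz_pow, smul_eq_mul, nsmul_eq_mul]
      ring
    obtain ⟨t, ht⟩ := reduce_deg mo (P := f (X 1)) (Q := f (X 0)) (k := k) (by rw [he, he', hek])
      hQ (fun t => deg_ne_zero mo hc (hJt t))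
    set g : R2 →ₐ[K] R2 := aeval ![f (X 0) - C t * f (X 1) ^ k, f (X 1)] with hg
    have g0 : g (X 0) = f (X 0) - C t * f (X 1) ^ k := by simp [hg]
    have g1 : g (X 1) = f (X 1) := by simp [hg]
    have hr : g.range = f.range := by
      apply le_antisymm
      · apply range_le2
        · rw [g0]
          exact ⟨X 0 - C t * X 1 ^ k, by simp⟩
        · rw [g1]; exact m0 _
      · apply range_le2
        · refine ⟨X 0 + C t * X 1 ^ k, ?_⟩
          simp [g0, g1]
        · exact ⟨X 1, g1⟩
    have := ih _ ?_ g c hc (by rw [g0, g1, hJt]) (by rw [hr]; exact hS) rfl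
    · rwa [hr] at this
    · rw [← hw, g0, g1]
      exact add_lt_add_of_lt_of_le ht le_rfl
  exact bad_case mo f hc hJ hS he he' e0 hm hn d1 d2 hray

end helpers

/-- The restriction theorem: `α(P) ∈ T` and `α(Q) ∈ T` iff `f` is an automorphism. -/
theorem stmt6 {K : Type*} [Field K] [CharZero K]
    (f : MvPolynomial (Fin 2) K →ₐ[K] MvPolynomial (Fin 2) K)
    (hJac : ∃ c : K, c ≠ 0 ∧ Jac (f (X 0)) (f (X 1)) = C c) :
    (exch K (f (X 0)) ∈ f.range ∧ exch K (f (X 1)) ∈ f.range) ↔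
    Function.Bijective f := by
  obtain ⟨c, hc, hJ⟩ := hJac
  constructor
  swap
  · intro h
    exact ⟨h.2 _, h.2 _⟩
  rintro ⟨h0, h1⟩
  refine ⟨keller_inj f (by rw [hJ]; simpa using hc), ?_⟩
  set σ : MvPolynomial (Fin 2) K →ₐ[K] MvPolynomial (Fin 2) K := aeval ![X 0 + X 1, X 0 - X 1]
    with hσ
  set τ : MvPolynomial (Fin 2) K →ₐ[K] MvPolynomial (Fin 2) K :=
    aeval ![C (1/2) * (X 0 + X 1), C (1/2) * (X 0 - X 1)] with hτ
  have two : (C (1/2) : MvPolynomial (Fin 2) K) * 2 = 1 := by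
    have : (2 : MvPolynomial (Fin 2) K) = C 2 := (map_ofNat C 2).symm
    rw [this, ← C_mul]; norm_num
  have s0 : σ (X 0) = X 0 + X 1 := by simp [hσ]
  have s1 : σ (X 1) = X 0 - X 1 := by simp [hσ]
  have t0 : τ (X 0) = C (1/2) * (X 0 + X 1) := by simp [hτ]
  have t1 : τ (X 1) = C (1/2) * (X 0 - X 1) := by simp [hτ]
  have hτσ : ∀ F, τ (σ F) = F := by
    have : τ.comp σ = AlgHom.id K _ := by
      apply algHom_ext2
      · show τ (σ (X 0)) = X 0
        rw [s0, map_add, t0, t1]; linear_combination X 0 * two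
      · show τ (σ (X 1)) = X 1
        rw [s1, map_sub, t0, t1]; linear_combination X 1 * two
    exact fun F => DFunLike.congr_fun this F
  have hστ : ∀ F, σ (τ F) = F := by
    have : σ.comp τ = AlgHom.id K _ := by
      apply algHom_ext2
      · show σ (τ (X 0)) = X 0
        rw [t0, map_mul, algHom_C2, map_add, s0, s1]; linear_combination X 0 * two
      · show σ (τ (X 1)) = X 1
        rw [t1, map_mul, algHom_C2, map_sub, s0, s1]; linear_combination X 1 * two
    exact fun F => DFunLike.congr_fun this F
  have ex0 : exch K (X 0) = X 1 := by simp [exch]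
  have ex1 : exch K (X 1) = X 0 := by simp [exch]
  have hconj : ∀ F, σ (exch K F) = eps K (σ F) := by
    have : σ.comp (exch K : MvPolynomial (Fin 2) K →ₐ[K] MvPolynomial (Fin 2) K) =
        (eps K).comp σ := by
      apply algHom_ext2
      · show σ (exch K (X 0)) = eps K (σ (X 0))
        rw [ex0, s0, s1, map_add, eps_X0, eps_X1]; ring
      · show σ (exch K (X 1)) = eps K (σ (X 1))
        rw [ex1, s0, s1, map_sub, eps_X0, eps_X1]; ring
    exact fun F => DFunLike.congr_fun this F
  have hstab : ∀ F, exch K (f F) ∈ f.range := by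
    intro F
    have : ((exch K : MvPolynomial (Fin 2) K →ₐ[K] MvPolynomial (Fin 2) K).comp f).range
        ≤ f.range := range_le2 h0 h1
    exact this ⟨F, rfl⟩
  have hS : ∀ y ∈ (σ.comp f).range, eps K y ∈ (σ.comp f).range := by
    rintro _ ⟨F, rfl⟩
    obtain ⟨G, hG⟩ := hstab F
    refine ⟨G, ?_⟩
    show σ (f G) = eps K (σ (f F))
    rw [← hconj, ← hG]; rfl
  have hJσ : Jac ((σ.comp f) (X 0)) ((σ.comp f) (X 1)) = C (-2 * c) := by
    show Jac (σ (f (X 0))) (σ (f (X 1))) = _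
    rw [Jac_comp, hJ, algHom_C2, s0, s1, C_mul, C_neg, map_ofNat]
    simp [Jac]; ring
  have hfin := main_surj _ (σ.comp f) (-2 * c) (by simpa using hc) hJσ hS rfl
  have htop : ∀ F, F ∈ (σ.comp f).range := by
    intro F
    have : (AlgHom.id K (MvPolynomial (Fin 2) K)).range ≤ (σ.comp f).range :=
      range_le2 hfin.1 hfin.2
    exact this ⟨F, rfl⟩
  intro F
  obtain ⟨G, hG⟩ := htop (σ F)
  refine ⟨G, ?_⟩
  have hG : σ (f G) = σ F := hG
  rw [← hτσ (f G), hG, hτσ]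
end

section
/- Let K = ℂ and let f be a ℂ-algebra endomorphism of ℂ[x,y] that is a generalized α-endomorphism, i.e., Jac(P,Q) is a nonzero scalar and at least one of Jac(P, α(P)) and Jac(Q, α(Q)) is a nonzero scalar, where P = f(x), Q = f(y) and α is the exchange involution. Then f is a ℂ-algebra automorphism of ℂ[x,y]. -/
open MvPolynomial

abbrev PolyXY := MvPolynomial (Fin 2) ℂ

lemma C_two : (C 2 : PolyXY) = 2 := map_ofNat C 2

lemma euler_coeff (i : Fin 2) (p : PolyXY) (m : Fin 2 →₀ ℕ) :
    coeff m (X i * pderiv i p) = (m i : ℂ) * coeff m p := by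
  rw [coeff_X_mul']
  split_ifs with h
  · rw [coeff_pderiv]
    have h1 : 1 ≤ m i := Nat.one_le_iff_ne_zero.mpr (Finsupp.mem_support_iff.mp h)
    have h2 : m - Finsupp.single i 1 + Finsupp.single i 1 = m := by
      apply tsub_add_cancel_of_le
      simpa using h1
    rw [h2]
    have h3 : (((m - Finsupp.single i 1 : Fin 2 →₀ ℕ) i : ℕ) : ℂ) + 1 = (m i : ℂ) := by
      conv_rhs => rw [← h2]
      simp
    rw [h3, mul_comm]
  · simp [Finsupp.notMem_support_iff.mp h]

lemma jac_coeff (F G : PolyXY) (m : Fin 2 →₀ ℕ) :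
    coeff m (X 0 * X 1 * Jac F G) =
      ∑ a ∈ Finset.HasAntidiagonal.antidiagonal m,
        ((a.1 0 : ℂ) * a.2 1 - a.1 1 * a.2 0) * (coeff a.1 F * coeff a.2 G) := by
  have : X 0 * X 1 * Jac F G = (X 0 * pderiv 0 F) * (X 1 * pderiv 1 G)
      - (X 1 * pderiv 1 F) * (X 0 * pderiv 0 G) := by
    unfold Jac; ring
  rw [this, coeff_sub, coeff_mul, coeff_mul, ← Finset.sum_sub_distrib]
  refine Finset.sum_congr rfl fun a _ => ?_
  simp only [euler_coeff]
  ring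

lemma coeff_xyC (c : ℂ) (m : Fin 2 →₀ ℕ) :
    coeff m (X 0 * X 1 * C c : PolyXY) = if m 0 = 1 ∧ m 1 = 1 then c else 0 := by
  have : (X 0 * X 1 * C c : PolyXY)
      = monomial (Finsupp.single 0 1 + Finsupp.single 1 1) c := by
    rw [X, X, monomial_mul, mul_comm, C_mul_monomial]; simp
  rw [this, coeff_monomial]
  congr 1
  rw [Finsupp.ext_iff]
  simp [Fin.forall_fin_two]
  constructor <;> rintro ⟨h1, h2⟩ <;> exact ⟨h1.symm, h2.symm⟩

lemma uniq_sum {F G : PolyXY} {c : ℂ} (hJ : Jac F G = C c) (m n : Fin 2 →₀ ℕ)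
    (hm : coeff m F ≠ 0) (hn : coeff n G ≠ 0)
    (hu : ∀ m' n' : Fin 2 →₀ ℕ, coeff m' F ≠ 0 → coeff n' G ≠ 0 →
      m' 0 + n' 0 = m 0 + n 0 → m' 1 + n' 1 = m 1 + n 1 → m' 0 = m 0 ∧ m' 1 = m 1)
    (hd : m 0 * n 1 ≠ m 1 * n 0) : m 0 + n 0 = 1 ∧ m 1 + n 1 = 1 := by
  by_contra hcon
  have h := jac_coeff F G (m + n)
  rw [hJ, coeff_xyC, if_neg (by simpa using hcon), Finset.sum_eq_single (m, n)] at h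
  · have : ((m 0 : ℂ) * n 1 - m 1 * n 0) ≠ 0 := by
      rw [sub_ne_zero]; exact_mod_cast hd
    exact mul_ne_zero this (mul_ne_zero hm hn) h.symm
  · rintro ⟨m', n'⟩ hmem hne
    rw [Finset.HasAntidiagonal.mem_antidiagonal] at hmem
    by_contra h0
    have h1 : coeff m' F ≠ 0 := fun h => h0 (by simp [h])
    have h2 : coeff n' G ≠ 0 := fun h => h0 (by simp [h])
    have e0 := DFunLike.congr_fun hmem 0
    have e1 := DFunLike.congr_fun hmem 1
    simp only [Finsupp.add_apply] at e0 e1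
    obtain ⟨r0, r1⟩ := hu m' n' h1 h2 e0 e1
    apply hne
    have hmm : m' = m := by
      ext i; fin_cases i <;> simp [r0, r1]
    subst hmm
    simp at hmem
    simp [hmem]
  · intro h; simp at h

lemma step0 {F G : PolyXY} {c : ℂ} (hJ : Jac F G = C c) (hc : c ≠ 0)
    (hG : ∀ n, coeff n G ≠ 0 → n 1 ≠ 0) :
    (∃ m, coeff m F ≠ 0 ∧ m 0 = 1 ∧ m 1 = 0) ∧
    (∃ n, coeff n G ≠ 0 ∧ n 0 = 0 ∧ n 1 = 1) := by
  have h := jac_coeff F G (Finsupp.single 0 1 + Finsupp.single 1 1)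
  rw [hJ, coeff_xyC, if_pos (by simp)] at h
  obtain ⟨⟨m, n⟩, hmem, h0⟩ := Finset.exists_ne_zero_of_sum_ne_zero (h ▸ hc)
  rw [Finset.HasAntidiagonal.mem_antidiagonal] at hmem
  have h1 : coeff m F ≠ 0 := fun h => h0 (by simp [h])
  have h2 : coeff n G ≠ 0 := fun h => h0 (by simp [h])
  have e0 := DFunLike.congr_fun hmem 0
  have e1 := DFunLike.congr_fun hmem 1
  simp at e0 e1
  have h3 := hG n h2
  have h4 : n 1 = 1 := by omega
  have h5 : m 1 = 0 := by omega
  have h6 : m 0 ≠ 0 := fun h => h0 (by simp [h, h5])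
  exact ⟨⟨m, h1, by omega, h5⟩, ⟨n, h2, by omega, h4⟩⟩

lemma exists_max_of {F : PolyXY} (p : (Fin 2 →₀ ℕ) → Prop) (g : (Fin 2 →₀ ℕ) → ℕ)
    (h : ∃ m, coeff m F ≠ 0 ∧ p m) :
    ∃ m, coeff m F ≠ 0 ∧ p m ∧ ∀ m', coeff m' F ≠ 0 → p m' → g m' ≤ g m := by
  classical
  obtain ⟨m₀, h1, h2⟩ := h
  obtain ⟨m, hm, hmax⟩ := Finset.exists_max_image (F.support.filter p) g
    ⟨m₀, by simp [h1, h2]⟩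
  simp at hm
  exact ⟨m, hm.1, hm.2, fun m' a b => hmax m' (by simp [a, b])⟩

lemma step1 {F G : PolyXY} {c : ℂ} (hJ : Jac F G = C c) (hc : c ≠ 0)
    (hG : ∀ n, coeff n G ≠ 0 → n 1 ≠ 0) :
    (∀ m, coeff m F ≠ 0 → m 1 = 0 → m 0 ≤ 1) ∧
    (∀ n, coeff n G ≠ 0 → n 1 = 1 → n 0 = 0) := by
  obtain ⟨⟨a, a1, a2, a3⟩, ⟨b, b1, b2, b3⟩⟩ := step0 hJ hc hG
  obtain ⟨m, m1, m2, m3⟩ := exists_max_of (F := F) (fun m => m 1 = 0) (fun m => m 0) ⟨a, a1, a3⟩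
  obtain ⟨n, n1, n2, n3⟩ := exists_max_of (F := G) (fun m => m 1 = 1) (fun m => m 0) ⟨b, b1, b3⟩
  have hma := m3 a a1 a3
  have := uniq_sum hJ m n m1 n1 (by
    intro m' n' hm' hn' e0 e1
    have h3 := hG n' hn'
    have h4 : m' 1 = 0 := by omega
    have h5 : n' 1 = 1 := by omega
    have h6 := m3 m' hm' h4
    have h7 := n3 n' hn' h5
    try simp only at h6 h7
    omega) (by
    rw [m2, n2]; omega)
  refine ⟨fun m' h h' => ?_, fun n' h h' => ?_⟩
  · have := m3 m' h h'; omega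
  · have := n3 n' h h'; omega

lemma step2 {F G : PolyXY} {c : ℂ} (hJ : Jac F G = C c) (hc : c ≠ 0)
    (hG : ∀ n, coeff n G ≠ 0 → n 1 ≠ 0) :
    (∀ m, coeff m F ≠ 0 → m 1 ≠ 0 → m 0 = 0) ∧
    (∀ n, coeff n G ≠ 0 → n 1 = 1) := by
  classical
  obtain ⟨⟨a, a1, a2, a3⟩, ⟨b, b1, b2, b3⟩⟩ := step0 hJ hc hG
  obtain ⟨hF0, hG1⟩ := step1 hJ hc hG
  let T : Finset (ℚ × ℚ) := F.support.image (fun m => ((m 0 : ℚ) - 1, (m 1 : ℚ))) ∪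
    G.support.image (fun n => ((n 0 : ℚ), (n 1 : ℚ) - 1))
  have hTF : ∀ m, coeff m F ≠ 0 → ((m 0 : ℚ) - 1, (m 1 : ℚ)) ∈ T := fun m hm =>
    Finset.mem_union_left _ (Finset.mem_image_of_mem _ (by simpa using hm))
  have hTG : ∀ n, coeff n G ≠ 0 → ((n 0 : ℚ), (n 1 : ℚ) - 1) ∈ T := fun n hn =>
    Finset.mem_union_right _ (Finset.mem_image_of_mem (fun n : Fin 2 →₀ ℕ => ((n 0 : ℚ), (n 1 : ℚ) - 1)) (by simpa using hn))
  have hT : ∀ z ∈ T, 0 ≤ z.2 ∧ (z.2 = 0 → z.1 ≤ 0) := by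
    intro z hz
    rcases Finset.mem_union.mp hz with h | h
    · obtain ⟨m, hm, rfl⟩ := Finset.mem_image.mp h
      refine ⟨by positivity, fun h => ?_⟩
      have := hF0 m (by simpa using hm) (by simpa using h)
      simpa using this
    · obtain ⟨n, hn, rfl⟩ := Finset.mem_image.mp h
      have hn' : coeff n G ≠ 0 := by simpa using hn
      have h1 : 1 ≤ n 1 := Nat.one_le_iff_ne_zero.mpr (hG n hn')
      refine ⟨by simpa using h1, fun h => ?_⟩
      have h2 : (n 1 : ℚ) = 1 := by simpa [sub_eq_zero] using h
      have := hG1 n hn' (by exact_mod_cast h2)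
      simp [this]
  -- no element of `T` is bad
  have key : ∀ z ∈ T, 0 < z.2 → z.1 < 0 := by
    intro z₀ hz₀ hz₀p
    by_contra hz₀n
    push Not at hz₀n
    obtain ⟨z, hz, hzmax⟩ := Finset.exists_max_image (T.filter (fun z => 0 < z.2))
      (fun z => z.1 / z.2) ⟨z₀, by simp [hz₀, hz₀p]⟩
    obtain ⟨hzT, hzp⟩ := Finset.mem_filter.mp hz
    set t : ℚ := z.1 / z.2 with ht
    have ht0 : 0 ≤ t := le_trans (div_nonneg hz₀n hz₀p.le)
      (hzmax z₀ (by simp [hz₀, hz₀p]))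
    have hle : ∀ w ∈ T, w.1 ≤ t * w.2 := by
      intro w hw
      obtain ⟨h1, h2⟩ := hT w hw
      rcases h1.eq_or_lt with h | h
      · rw [← h]; simpa using h2 h.symm
      · have := hzmax w (by simp [hw, h])
        exact (div_le_iff₀ h).mp this
    have hzt : z.1 = t * z.2 := by rw [ht]; field_simp
    obtain ⟨m, m1, m2, m3⟩ := exists_max_of (F := F)
      (fun m => (m 0 : ℚ) - 1 = t * m 1) (fun m => m 1) ⟨a, a1, by simp [a2, a3]⟩
    obtain ⟨n, n1, n2, n3⟩ := exists_max_of (F := G)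
      (fun n => (n 0 : ℚ) = t * ((n 1 : ℚ) - 1)) (fun m => m 1) ⟨b, b1, by simp [b2, b3]⟩
    have hn1 : 1 ≤ n 1 := Nat.one_le_iff_ne_zero.mpr (hG n n1)
    have hs := uniq_sum hJ m n m1 n1 (by
      intro m' n' hm' hn' e0 e1
      have l1 := hle _ (hTF m' hm')
      have l2 := hle _ (hTG n' hn')
      try simp only at l1 l2 m2 n2
      have e0' : (m' 0 : ℚ) + n' 0 = m 0 + n 0 := by exact_mod_cast e0
      have e1' : (m' 1 : ℚ) + n' 1 = m 1 + n 1 := by exact_mod_cast e1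
      have e2 : t * (m' 1 : ℚ) + t * n' 1 = t * m 1 + t * n 1 := by
        rw [← mul_add, e1', mul_add]
      have q1 : (m' 0 : ℚ) - 1 = t * m' 1 := by linarith
      have q2 : (n' 0 : ℚ) = t * ((n' 1 : ℚ) - 1) := by linarith
      have r1 := m3 m' hm' q1
      have r2 := n3 n' hn' q2
      try simp only at r1 r2
      have r3 : m' 1 = m 1 := by omega
      refine ⟨?_, r3⟩
      rw [r3] at q1
      have : (m' 0 : ℚ) = m 0 := by linarith
      exact_mod_cast this) (by
      intro h
      have h' : (m 0 : ℚ) * n 1 = m 1 * n 0 := by exact_mod_cast h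
      try simp only at m2 n2
      have hm0 : (m 0 : ℚ) = 1 + t * m 1 := by linarith
      rw [hm0, n2] at h'
      have h3 : (n 1 : ℚ) + t * m 1 = 0 := by linarith
      have h4 : (1 : ℚ) ≤ n 1 := by exact_mod_cast hn1
      have h5 : 0 ≤ t * (m 1 : ℚ) := by positivity
      linarith)
    have hm10 : m 1 = 0 := by omega
    have hn11 : n 1 = 1 := by omega
    rcases Finset.mem_union.mp hzT with h | h
    · obtain ⟨m', hm', rfl⟩ := Finset.mem_image.mp h
      have := m3 m' (by simpa using hm') hzt
      try simp only at this hzp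
      have hp : 0 < m' 1 := by exact_mod_cast hzp
      omega
    · obtain ⟨n', hn', rfl⟩ := Finset.mem_image.mp h
      have := n3 n' (by simpa using hn') hzt
      try simp only at this hzp
      have hp : 1 < n' 1 := by
        have : (1 : ℚ) < n' 1 := by linarith
        exact_mod_cast this
      omega
  refine ⟨fun m hm h => ?_, fun n hn => ?_⟩
  · have := key _ (hTF m hm) (by simp only; exact_mod_cast Nat.pos_of_ne_zero h)
    try simp only at this
    have h' : (m 0 : ℚ) < 1 := by linarith
    have : m 0 < 1 := by exact_mod_cast h'
    omega
  · by_contra h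
    have h1 : 1 < n 1 := by have := hG n hn; omega
    have h1' : (1 : ℚ) < n 1 := by exact_mod_cast h1
    have := key _ (hTG n hn) (by simp only; linarith)
    try simp only at this
    have : (0 : ℚ) ≤ n 0 := by positivity
    linarith

lemma chain (g : PolyXY →ₐ[ℂ] PolyXY) (i : Fin 2) (p : PolyXY) :
    pderiv i (g p) = g (pderiv 0 p) * pderiv i (g (X 0)) + g (pderiv 1 p) * pderiv i (g (X 1)) := by
  induction p using MvPolynomial.induction_on with
  | C a =>
    have : g (C a) = C a := by simpa [algebraMap_eq] using g.commutes a
    simp [this]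
  | add p q hp hq => simp only [map_add, hp, hq]; ring
  | mul_X p j hp =>
    simp only [map_mul, Derivation.leibniz, smul_eq_mul, hp, map_add]
    fin_cases j <;> simp [pderiv_X] <;> ring

lemma jac_chain (g : PolyXY →ₐ[ℂ] PolyXY) (p q : PolyXY) :
    Jac (g p) (g q) = Jac (g (X 0)) (g (X 1)) * g (Jac p q) := by
  unfold Jac
  rw [chain g 0 p, chain g 0 q, chain g 1 p, chain g 1 q]
  simp only [map_sub, map_mul]
  ring

lemma g_C (g : PolyXY →ₐ[ℂ] PolyXY) (c : ℂ) : g (C c) = C c := by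
  simpa [algebraMap_eq] using g.commutes c

/-- `v ↦ -v`. -/
noncomputable def sg : PolyXY →ₐ[ℂ] PolyXY := aeval ![X 0, - X 1]

/-- `x ↦ u + v`, `y ↦ u - v`. -/
noncomputable def LL : PolyXY →ₐ[ℂ] PolyXY := aeval ![X 0 + X 1, X 0 - X 1]

lemma LL_bij : Function.Bijective LL := by
  rw [Function.bijective_iff_has_inverse]
  let M : PolyXY →ₐ[ℂ] PolyXY :=
    aeval ![C (1/2) * (X 0 + X 1), C (1/2) * (X 0 - X 1)]
  have hC : (C (1/2) : PolyXY) * 2 = 1 := by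
    rw [← C_two, ← C_mul]; norm_num
  have h1 : M.comp LL = AlgHom.id ℂ _ := by
    ext i : 1
    fin_cases i
    · simp only [M, LL, AlgHom.comp_apply]
      simp [-one_div]
      linear_combination (X 0) * hC
    · simp only [M, LL, AlgHom.comp_apply]
      simp [-one_div]
      linear_combination (X 1) * hC
  have h2 : LL.comp M = AlgHom.id ℂ _ := by
    ext i : 1
    fin_cases i
    · simp [M, LL, -one_div]
      linear_combination (X 0) * hC
    · simp [M, LL, -one_div]
      linear_combination (X 1) * hC
  exact ⟨M, fun p => DFunLike.congr_fun h1 p, fun p => DFunLike.congr_fun h2 p⟩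

lemma LL_exch (p : PolyXY) : LL (exch ℂ p) = sg (LL p) := by
  have : LL.comp (exch ℂ).toAlgHom = sg.comp LL := by
    ext i : 1
    fin_cases i <;> simp [LL, sg, exch] <;> ring
  exact DFunLike.congr_fun this p

lemma sg_coeff (p : PolyXY) (m : Fin 2 →₀ ℕ) :
    coeff m (sg p) = (-1) ^ (m 1) * coeff m p := by
  induction p using MvPolynomial.induction_on' with
  | monomial n a =>
    have : sg (monomial n a) = monomial n ((-1) ^ (n 1) * a) := by
      rw [sg, aeval_monomial, Finsupp.prod_fintype _ _ (by simp), monomial_eq,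
        Finsupp.prod_fintype _ _ (by simp)]
      simp [Fin.prod_univ_two, algebraMap_eq]
      rw [neg_pow]; ring
    rw [this, coeff_monomial, coeff_monomial]
    split_ifs with h
    · rw [h]
    · simp
  | add p q hp hq => simp [hp, hq, mul_add]

lemma jac_LL : Jac (LL (X 0)) (LL (X 1)) = C (-2) := by
  simp [Jac, LL, pderiv_X, C_two]
  norm_num

/-- Shape of `p = LL P`. -/
lemma shape (p : PolyXY) (c : ℂ) (hc : c ≠ 0) (h : Jac p (sg p) = C c) :
    (∃ m, coeff m p ≠ 0 ∧ m 0 = 1 ∧ m 1 = 0) ∧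
    ∀ m, coeff m p ≠ 0 → m 0 = 0 ∨ (m 0 = 1 ∧ m 1 = 0) := by
  have hJ : Jac (p + sg p) (p - sg p) = C (-2 * c) := by
    have : Jac (p + sg p) (p - sg p) = C (-2) * Jac p (sg p) := by
      simp [Jac, C_two]; ring
    rw [this, h, ← C_mul]
  have hc' : -2 * c ≠ 0 := by simpa using hc
  have hF : ∀ m, coeff m (p + sg p) = (1 + (-1) ^ (m 1)) * coeff m p := by
    intro m; rw [coeff_add, sg_coeff]; ring
  have hGc : ∀ m, coeff m (p - sg p) = (1 - (-1) ^ (m 1)) * coeff m p := by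
    intro m; rw [coeff_sub, sg_coeff]; ring
  have hG : ∀ n, coeff n (p - sg p) ≠ 0 → n 1 ≠ 0 := by
    intro n hn h0; apply hn; rw [hGc, h0]; simp
  obtain ⟨⟨a, a1, a2, a3⟩, -⟩ := step0 hJ hc' hG
  obtain ⟨s1, s2⟩ := step1 hJ hc' hG
  obtain ⟨r1, r2⟩ := step2 hJ hc' hG
  refine ⟨⟨a, fun h => a1 (by rw [hF, h, mul_zero]), a2, a3⟩, fun m hm => ?_⟩
  rcases Nat.even_or_odd (m 1) with he | ho
  · have hm' : coeff m (p + sg p) ≠ 0 := by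
      rw [hF, he.neg_one_pow]; norm_num; exact hm
    by_cases h0 : m 1 = 0
    · have := s1 m hm' h0; omega
    · exact Or.inl (r1 m hm' h0)
  · have hm' : coeff m (p - sg p) ≠ 0 := by
      rw [hGc, ho.neg_one_pow]; norm_num; exact hm
    exact Or.inl (s2 m hm' (r2 m hm'))

/-- A polynomial whose monomials do not involve variable `i` comes from the other variable. -/
lemma mem_range (i j : Fin 2) (hij : i ≠ j) (p : PolyXY)
    (h : ∀ m, coeff m p ≠ 0 → m i = 0) :
    ∃ q : Polynomial ℂ, p = Polynomial.aeval (X j) q := by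
  suffices hs : p ∈ (Polynomial.aeval (R := ℂ) (X j : PolyXY)).range by
    obtain ⟨q, hq⟩ := hs; exact ⟨q, hq.symm⟩
  rw [p.as_sum]
  refine Subalgebra.sum_mem _ fun m hm => ?_
  have hi := h m (by simpa using hm)
  refine ⟨Polynomial.C (coeff m p) * Polynomial.X ^ (m j), ?_⟩
  have hmm : m = Finsupp.single j (m j) := by
    ext k
    by_cases hk : k = j
    · simp [hk]
    · have : k = i := by omega
      rw [Finsupp.single_eq_of_ne hk, this, hi]
  conv_rhs => rw [hmm]
  simp [algebraMap_eq, C_mul_X_pow_eq_monomial]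
  rw [← hmm]

lemma shape' (p : PolyXY) (c : ℂ) (hc : c ≠ 0) (h : Jac p (sg p) = C c) :
    ∃ (a : ℂ) (q : Polynomial ℂ), a ≠ 0 ∧ p = C a * X 0 + Polynomial.aeval (X 1) q := by
  obtain ⟨⟨m, m1, m2, m3⟩, hall⟩ := shape p c hc h
  have hm : m = Finsupp.single 0 1 := by
    ext k; fin_cases k <;> simp [m2, m3]
  obtain ⟨q, hq⟩ := mem_range 0 1 (by decide) (p - C (coeff m p) * X 0) (by
    intro n hn
    by_contra hne
    rw [coeff_sub, coeff_C_mul, coeff_X] at hn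
    by_cases hnm : Finsupp.single 0 1 = n
    · apply hn; rw [if_pos hnm, hm, hnm]; simp
    · rw [if_neg hnm] at hn
      rcases hall n (by simpa using hn) with h | ⟨h, h'⟩
      · exact hne h
      · apply hnm; ext k; fin_cases k <;> simp [h, h'])
  exact ⟨coeff m p, q, m1, by rw [← hq]; ring⟩

lemma g_aeval (g : PolyXY →ₐ[ℂ] PolyXY) (z : PolyXY) (q : Polynomial ℂ) :
    g (Polynomial.aeval z q) = Polynomial.aeval (g z) q :=
  (Polynomial.aeval_algHom_apply g z q).symm

lemma theta_exists (a : ℂ) (q : Polynomial ℂ) (ha : a ≠ 0) :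
    ∃ θ : PolyXY →ₐ[ℂ] PolyXY, Function.Bijective θ ∧
      θ (C a * X 0 + Polynomial.aeval (X 1) q) = X 0 ∧
      Jac (θ (X 0)) (θ (X 1)) = C a⁻¹ := by
  let θ : PolyXY →ₐ[ℂ] PolyXY :=
    aeval ![C a⁻¹ * (X 0 - Polynomial.aeval (X 1) q), X 1]
  let M : PolyXY →ₐ[ℂ] PolyXY :=
    aeval ![C a * X 0 + Polynomial.aeval (X 1) q, X 1]
  have t0 : θ (X 0) = C a⁻¹ * (X 0 - Polynomial.aeval (X 1) q) := by simp [θ]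
  have t1 : θ (X 1) = X 1 := by simp [θ]
  have u0 : M (X 0) = C a * X 0 + Polynomial.aeval (X 1) q := by simp [M]
  have u1 : M (X 1) = X 1 := by simp [M]
  have hC : (C a * C a⁻¹ : PolyXY) = 1 := by
    rw [← C_mul, mul_inv_cancel₀ ha, C_1]
  have key : θ (C a * X 0 + Polynomial.aeval (X 1) q) = X 0 := by
    rw [map_add, map_mul, g_C, t0, g_aeval, t1]
    linear_combination (X 0 - Polynomial.aeval (X 1) q) * hC
  have h1 : M.comp θ = AlgHom.id ℂ _ := by
    ext i : 1
    fin_cases i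
    · change M (θ (X 0)) = X 0
      rw [t0, map_mul, map_sub, g_C, u0, g_aeval, u1]
      linear_combination (X 0) * hC
    · change M (θ (X 1)) = X 1
      rw [t1, u1]
  have h2 : θ.comp M = AlgHom.id ℂ _ := by
    ext i : 1
    fin_cases i
    · change θ (M (X 0)) = X 0
      rw [u0, key]
    · change θ (M (X 1)) = X 1
      rw [u1, t1]
  refine ⟨θ, Function.bijective_iff_has_inverse.mpr
    ⟨M, fun p => DFunLike.congr_fun h1 p, fun p => DFunLike.congr_fun h2 p⟩, key, ?_⟩
  have hd : pderiv (0 : Fin 2) (Polynomial.aeval (X 1 : PolyXY) q) = 0 := by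
    rw [Derivation.map_aeval]; simp [pderiv_X]
  rw [t0, t1]
  simp [Jac, pderiv_X, hd]

lemma tri_bij (g : PolyXY →ₐ[ℂ] PolyXY) (h0 : g (X 0) = X 0) (e : ℂ) (he : e ≠ 0)
    (h : Jac (X 0) (g (X 1)) = C e) : Function.Bijective g := by
  have hd : pderiv 1 (g (X 1)) = C e := by simpa [Jac, pderiv_X] using h
  obtain ⟨q, hq⟩ := mem_range 1 0 (by decide) (g (X 1) - C e * X 1) (by
    intro m hm
    by_contra hne
    apply hm
    have h1 : pderiv 1 (g (X 1) - C e * X 1) = 0 := by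
      rw [map_sub, hd]; simp [pderiv_X]
    have h2 := euler_coeff 1 (g (X 1) - C e * X 1) m
    rw [h1, mul_zero, coeff_zero] at h2
    rcases mul_eq_zero.mp h2.symm with h | h
    · exact absurd (by exact_mod_cast h) hne
    · exact h)
  have h1 : g (X 1) = C e * X 1 + Polynomial.aeval (X 0) q := by rw [← hq]; ring
  have hC : (C e * C e⁻¹ : PolyXY) = 1 := by
    rw [← C_mul, mul_inv_cancel₀ he, C_1]
  let M : PolyXY →ₐ[ℂ] PolyXY :=
    aeval ![X 0, C e⁻¹ * (X 1 - Polynomial.aeval (X 0) q)]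
  have u0 : M (X 0) = X 0 := by simp [M]
  have u1 : M (X 1) = C e⁻¹ * (X 1 - Polynomial.aeval (X 0) q) := by simp [M]
  have k1 : M.comp g = AlgHom.id ℂ _ := by
    ext i : 1
    fin_cases i
    · change M (g (X 0)) = X 0
      rw [h0, u0]
    · change M (g (X 1)) = X 1
      rw [h1, map_add, map_mul, g_C, u1, g_aeval, u0]
      linear_combination (X 1 - Polynomial.aeval (X 0) q) * hC
  have k2 : g.comp M = AlgHom.id ℂ _ := by
    ext i : 1
    fin_cases i
    · change g (M (X 0)) = X 0
      rw [u0, h0]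
    · change g (M (X 1)) = X 1
      rw [u1, map_mul, map_sub, g_C, h1, g_aeval, h0]
      linear_combination (X 1) * hC
  exact Function.bijective_iff_has_inverse.mpr
    ⟨M, fun p => DFunLike.congr_fun k1 p, fun p => DFunLike.congr_fun k2 p⟩

lemma main_case (f : PolyXY →ₐ[ℂ] PolyXY) (d : ℂ) (hd : d ≠ 0)
    (hJac : Jac (f (X 0)) (f (X 1)) = C d)
    (c : ℂ) (hc : c ≠ 0) (h : Jac (f (X 0)) (exch ℂ (f (X 0))) = C c) :
    Function.Bijective f := by
  have h1 : Jac (LL (f (X 0))) (sg (LL (f (X 0)))) = C (-2 * c) := by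
    rw [← LL_exch, jac_chain, jac_LL, h, g_C, ← C_mul]
  obtain ⟨a, q, ha, hp⟩ := shape' _ _ (by simpa using hc) h1
  obtain ⟨θ, hθ, hθ0, hθJ⟩ := theta_exists a q ha
  rw [← hp] at hθ0
  have hJ2 : Jac (X 0) ((θ.comp (LL.comp f)) (X 1)) = C (a⁻¹ * (-2 * d)) := by
    change Jac (X 0) (θ (LL (f (X 1)))) = _
    conv_lhs => rw [← hθ0]
    rw [jac_chain, hθJ, jac_chain, jac_LL, hJac, g_C, ← C_mul, g_C, ← C_mul]
  have hb := tri_bij (θ.comp (LL.comp f)) hθ0 _ (by simp [ha, hd]) hJ2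
  have hb' : Function.Bijective ((θ ∘ LL) ∘ f) := hb
  exact (Function.Bijective.of_comp_iff' (hθ.comp LL_bij) f).mp hb'

/-- Over `ℂ`, a generalized `α`-endomorphism is an automorphism. -/
theorem stmt9
    (f : MvPolynomial (Fin 2) ℂ →ₐ[ℂ] MvPolynomial (Fin 2) ℂ)
    (hJac : ∃ c : ℂ, c ≠ 0 ∧ Jac (f (X 0)) (f (X 1)) = C c)
    (hgen : (∃ c : ℂ, c ≠ 0 ∧ Jac (f (X 0)) (exch ℂ (f (X 0))) = C c) ∨
            (∃ c : ℂ, c ≠ 0 ∧ Jac (f (X 1)) (exch ℂ (f (X 1))) = C c)) :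
    Function.Bijective f := by
  obtain ⟨d, hd, hJ⟩ := hJac
  rcases hgen with ⟨c, hc, h⟩ | ⟨c, hc, h⟩
  · exact main_case f d hd hJ c hc h
  · let g : PolyXY →ₐ[ℂ] PolyXY := f.comp (exch ℂ).toAlgHom
    have g0 : g (X 0) = f (X 1) := by simp [g, exch]
    have g1 : g (X 1) = f (X 0) := by simp [g, exch]
    have hg : Function.Bijective g := by
      refine main_case g (-d) (neg_ne_zero.mpr hd) ?_ c hc ?_
      · rw [g0, g1, C_neg, ← hJ]; unfold Jac; ring
      · rw [g0, h]
    have hg' : Function.Bijective (f ∘ exch ℂ) := hg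
    exact (Function.Bijective.of_comp_iff f (exch ℂ).bijective).mp hg'
end

section
/- Let K = ℂ, let ε be an involution on ℂ[x,y], and let f be a ℂ-algebra endomorphism of ℂ[x,y] that is a generalized ε-endomorphism, i.e., Jac(P,Q) is a nonzero scalar and at least one of Jac(P, ε(P)) and Jac(Q, ε(Q)) is a nonzero scalar, where P = f(x), Q = f(y). Then f is a ℂ-algebra automorphism of ℂ[x,y]. -/
open MvPolynomial

namespace Plane

/-- The polynomial ring in two variables. -/
abbrev A := MvPolynomial (Fin 2) ℂ

/-- all monomials of `p` have weight at most `d` -/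
def LE (a b d : ℤ) (p : A) : Prop := ∀ m, coeff m p ≠ 0 → a * m 0 + b * m 1 ≤ d

/-- all monomials of `p` have weight `d` -/
def Hom (a b d : ℤ) (p : A) : Prop := ∀ m, coeff m p ≠ 0 → a * m 0 + b * m 1 = d

lemma hom_iff {a b d : ℤ} {p : A} : Hom a b d p ↔ LE a b d p ∧ LE (-a) (-b) (-d) p := by
  constructor
  · intro h
    exact ⟨fun m hm => (h m hm).le, fun m hm => by have := h m hm; linarith⟩
  · rintro ⟨h1, h2⟩ m hm
    have := h1 m hm; have := h2 m hm; linarith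

lemma LE.add {a b d : ℤ} {p q : A} (hp : LE a b d p) (hq : LE a b d q) : LE a b d (p + q) := by
  intro m hm
  rw [coeff_add] at hm
  by_cases h : coeff m p = 0
  · exact hq m (by simpa [h] using hm)
  · exact hp m h

lemma LE.neg {a b d : ℤ} {p : A} (hp : LE a b d p) : LE a b d (-p) := by
  intro m hm
  rw [coeff_neg] at hm
  exact hp m (by simpa using hm)

lemma LE.sub {a b d : ℤ} {p q : A} (hp : LE a b d p) (hq : LE a b d q) : LE a b d (p - q) := by
  rw [sub_eq_add_neg]; exact hp.add hq.neg

lemma LE.mono {a b d e : ℤ} {p : A} (hp : LE a b d p) (h : d ≤ e) : LE a b e p :=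
  fun m hm => (hp m hm).trans h

lemma LE.zero {a b d : ℤ} : LE a b d 0 := by
  intro m hm; simp at hm

lemma LE.mul {a b d e : ℤ} {p q : A} (hp : LE a b d p) (hq : LE a b e q) :
    LE a b (d + e) (p * q) := by
  intro m hm
  rw [coeff_mul] at hm
  obtain ⟨x, hx, hx2⟩ := Finset.exists_ne_zero_of_sum_ne_zero hm
  rw [Finset.HasAntidiagonal.mem_antidiagonal] at hx
  have h1 := hp x.1 (left_ne_zero_of_mul hx2)
  have h2 := hq x.2 (right_ne_zero_of_mul hx2)
  rw [← hx]
  simp only [Finsupp.add_apply]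
  push_cast
  linarith

lemma LE.monomial {a b d : ℤ} {m : Fin 2 →₀ ℕ} {c : ℂ} (h : a * m 0 + b * m 1 ≤ d) :
    LE a b d (monomial m c) := by
  intro n hn
  rw [coeff_monomial] at hn
  split_ifs at hn with h2
  · subst h2; exact h
  · simp at hn

lemma LE.C {a b : ℤ} {c : ℂ} : LE a b 0 (C c) := LE.monomial (by simp)

lemma LE.X0 {a b : ℤ} : LE a b a (X 0) := LE.monomial (by simp)

lemma LE.X1 {a b : ℤ} : LE a b b (X 1) := LE.monomial (by simp)

lemma LE.pow {a b d : ℤ} {p : A} (hp : LE a b d p) (n : ℕ) : LE a b (n * d) (p ^ n) := by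
  induction n with
  | zero => simpa using LE.C (c := 1)
  | succ n ih =>
    rw [pow_succ]
    exact (ih.mul hp).mono (by push_cast; linarith)

lemma LE.sum {a b d : ℤ} {ι : Type*} (s : Finset ι) (p : ι → A) (h : ∀ i ∈ s, LE a b d (p i)) :
    LE a b d (∑ i ∈ s, p i) := by
  classical
  induction s using Finset.induction_on with
  | empty => simpa using LE.zero
  | insert i s hi ih =>
    rw [Finset.sum_insert hi]
    exact (h i (by simp)).add (ih fun j hj => h j (by simp [hj]))

lemma LE.pderiv0 {a b d : ℤ} {p : A} (hp : LE a b d p) : LE a b (d - a) (pderiv 0 p) := by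
  intro m hm
  rw [coeff_pderiv] at hm
  have := hp _ (left_ne_zero_of_mul hm)
  simp at this
  linarith

lemma LE.pderiv1 {a b d : ℤ} {p : A} (hp : LE a b d p) : LE a b (d - b) (pderiv 1 p) := by
  intro m hm
  rw [coeff_pderiv] at hm
  have := hp _ (left_ne_zero_of_mul hm)
  simp at this
  linarith

lemma LE.jac {a b d e : ℤ} {p q : A} (hp : LE a b d p) (hq : LE a b e q) :
    LE a b (d + e - a - b) (Jac p q) := by
  unfold Jac
  exact ((hp.pderiv0.mul hq.pderiv1).mono (by linarith)).sub
    ((hp.pderiv1.mul hq.pderiv0).mono (by linarith))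

lemma Hom.jac {a b d e : ℤ} {p q : A} (hp : Hom a b d p) (hq : Hom a b e q) :
    Hom a b (d + e - a - b) (Jac p q) := by
  rw [hom_iff] at *
  exact ⟨hp.1.jac hq.1, (hp.2.jac hq.2).mono (by linarith)⟩

/-- weighted homogeneous component -/
noncomputable def comp (a b d : ℤ) (p : A) : A :=
  ∑ m ∈ p.support with a * (m 0 : ℤ) + b * (m 1 : ℤ) = d, monomial m (coeff m p)

lemma coeff_comp (a b d : ℤ) (p : A) (m : Fin 2 →₀ ℕ) :
    coeff m (comp a b d p) = if a * (m 0 : ℤ) + b * (m 1 : ℤ) = d then coeff m p else 0 := by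
  classical
  unfold comp
  rw [coeff_sum]
  simp only [coeff_monomial]
  rw [Finset.sum_ite_eq']
  simp only [Finset.mem_filter, mem_support_iff]
  split_ifs <;> simp_all

lemma hom_comp (a b d : ℤ) (p : A) : Hom a b d (comp a b d p) := by
  intro m hm
  rw [coeff_comp] at hm
  by_contra h
  simp [h] at hm

lemma comp_add (a b d : ℤ) (p q : A) : comp a b d (p + q) = comp a b d p + comp a b d q := by
  ext m
  simp only [coeff_comp, coeff_add]
  split_ifs <;> simp

lemma comp_of_hom {a b d : ℤ} {p : A} (h : Hom a b d p) : comp a b d p = p := by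
  ext m
  rw [coeff_comp]
  split_ifs with h1
  · rfl
  · by_contra h2
    exact h1 (h m (Ne.symm h2))

lemma comp_of_lt {a b d e : ℤ} {p : A} (h : LE a b e p) (hd : e < d) : comp a b d p = 0 := by
  ext m
  rw [coeff_comp]
  split_ifs with h1
  · by_contra h2
    have := h m h2
    omega
  · simp

lemma LE.sub_comp {a b d : ℤ} {p : A} (h : LE a b d p) : LE a b (d - 1) (p - comp a b d p) := by
  intro m hm
  rw [coeff_sub, coeff_comp] at hm
  split_ifs at hm with h1
  · simp at hm
  · have := h m (by simpa using hm)
    omega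

lemma Hom.le {a b d : ℤ} {p : A} (h : Hom a b d p) : LE a b d p := (hom_iff.1 h).1

lemma jac_add_left (p q r : A) : Jac (p + q) r = Jac p r + Jac q r := by
  simp only [Jac, map_add]; ring

lemma jac_add_right (p q r : A) : Jac p (q + r) = Jac p q + Jac p r := by
  simp only [Jac, map_add]; ring

/-- The leading component of a Jacobian. -/
lemma comp_jac {a b d e : ℤ} {p q : A} (hp : LE a b d p) (hq : LE a b e q) :
    comp a b (d + e - a - b) (Jac p q) = Jac (comp a b d p) (comp a b e q) := by
  have e1 : Jac p q = Jac (comp a b d p) (comp a b e q) +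
      (Jac (p - comp a b d p) q + Jac (comp a b d p) (q - comp a b e q)) := by
    simp only [Jac, map_sub]; ring
  rw [e1, comp_add, comp_of_hom ((hom_comp a b d p).jac (hom_comp a b e q)),
    comp_of_lt (p := Jac (p - comp a b d p) q + Jac (comp a b d p) (q - comp a b e q))
      (e := d + e - a - b - 1), add_zero]
  · exact ((hp.sub_comp.jac hq).mono (by linarith)).add
      (((hom_comp a b d p).le.jac hq.sub_comp).mono (by linarith))
  · linarith

/-- The derivation `Jac F ·`. -/
noncomputable def J (F : A) : Derivation ℂ A A := pderiv 0 F • pderiv 1 - pderiv 1 F • pderiv 0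

lemma J_apply (F p : A) : J F p = Jac F p := by
  simp [J, Jac]

/-- local nilpotency -/
def LND (D : Derivation ℂ A A) : Prop := ∀ p, ∃ n : ℕ, D^[n] p = 0

lemma iter_zero (D : Derivation ℂ A A) (n : ℕ) : D^[n] 0 = 0 := by
  induction n with
  | zero => rfl
  | succ n ih => rw [Function.iterate_succ_apply', ih, map_zero]

lemma iter_add (D : Derivation ℂ A A) (n : ℕ) (p q : A) : D^[n] (p + q) = D^[n] p + D^[n] q := by
  induction n with
  | zero => rfl
  | succ n ih => simp only [Function.iterate_succ_apply', ih, map_add]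

lemma LND.of_J_comp {F : A} {a b d : ℤ} (hF : LE a b d F) (h : LND (J F)) :
    LND (J (comp a b d F)) := by
  -- homogeneous elements
  have key : ∀ (n : ℕ) (p : A) (e : ℤ), LE a b e p →
      LE a b (e + n * (d - a - b)) ((J F)^[n] p) ∧
      comp a b (e + n * (d - a - b)) ((J F)^[n] p) = (J (comp a b d F))^[n] (comp a b e p) := by
    intro n p e hp
    induction n with
    | zero => simpa using hp
    | succ n ih =>
      have e1 : e + ((n + 1 : ℕ) : ℤ) * (d - a - b) = d + (e + n * (d - a - b)) - a - b := by
        push_cast; ring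
      rw [e1, Function.iterate_succ_apply', Function.iterate_succ_apply', J_apply, J_apply]
      exact ⟨hF.jac ih.1, by rw [comp_jac hF ih.1, ih.2]⟩
  intro p
  induction p using MvPolynomial.induction_on' with
  | monomial m c =>
    obtain ⟨n, hn⟩ := h (monomial m c)
    have hm : Hom a b (a * m 0 + b * m 1) (monomial m c) := by
      rw [hom_iff]; exact ⟨LE.monomial le_rfl, LE.monomial (by linarith)⟩
    refine ⟨n, ?_⟩
    have := (key n _ _ hm.le).2
    rw [comp_of_hom hm, hn] at this
    rw [← this]
    exact comp_of_lt (e := a * m 0 + b * m 1 + n * (d - a - b) - 1) LE.zero (by linarith)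
  | add p q hp hq =>
    obtain ⟨n, hn⟩ := hp
    obtain ⟨k, hk⟩ := hq
    refine ⟨n + k, ?_⟩
    rw [iter_add]
    nth_rewrite 1 [add_comm n k]
    rw [Function.iterate_add_apply, Function.iterate_add_apply, hn, hk, iter_zero, iter_zero,
      add_zero]

lemma iter_mul (D : Derivation ℂ A A) : ∀ (n m : ℕ) (p q : A), D^[n + 1] p = 0 → D^[m + 1] q = 0 →
    D^[n + m] (p * q) = ((n + m).choose n : A) * (D^[n] p * D^[m] q) := by
  intro n m
  induction hs : n + m generalizing n m with
  | zero =>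
    intro p q _ _
    obtain ⟨rfl, rfl⟩ : n = 0 ∧ m = 0 := by omega
    simp
  | succ s ih =>
    intro p q hp hq
    rw [Function.iterate_succ_apply, D.leibniz, smul_eq_mul, smul_eq_mul, iter_add]
    rcases n with _ | n
    · obtain rfl : m = s + 1 := by omega
      have hp' : D p = 0 := by simpa using hp
      rw [hp', mul_zero, iter_zero, add_zero, ih 0 s (by omega) p (D q) hp hq]
      simp
    · rcases m with _ | m
      · obtain rfl : n = s := by omega
        have hq' : D q = 0 := by simpa using hq
        rw [hq', mul_zero, iter_zero, zero_add, mul_comm q, ih n 0 (by omega) (D p) q hp hq]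
        simp
      · rw [ih (n + 1) m (by omega) p (D q) hp hq, mul_comm q,
          ih n (m + 1) (by omega) (D p) q hp hq]
        simp only [← Function.iterate_succ_apply]
        rw [Nat.choose_succ_succ]
        push_cast
        ring

lemma LND.index {D : Derivation ℂ A A} (h : LND D) {p : A} (hp : p ≠ 0) :
    ∃ n : ℕ, D^[n] p ≠ 0 ∧ D^[n + 1] p = 0 := by
  classical
  have h1 := Nat.find_spec (h p)
  have h2 := fun m => Nat.find_min (h p) (m := m)
  rcases hn : Nat.find (h p) with _ | n
  · rw [hn] at h1; exact absurd h1 hp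
  · rw [hn] at h1
    exact ⟨n, h2 n (by omega), h1⟩

lemma iter_ge (D : Derivation ℂ A A) {p : A} {n k : ℕ} (h : D^[n] p = 0) (hk : n ≤ k) :
    D^[k] p = 0 := by
  obtain ⟨j, rfl⟩ := Nat.exists_eq_add_of_le hk
  rw [add_comm, Function.iterate_add_apply, h, iter_zero]

lemma iter_mul_ne {D : Derivation ℂ A A} {n m : ℕ} {p q : A} (hp : D^[n] p ≠ 0)
    (hp' : D^[n + 1] p = 0) (hq : D^[m] q ≠ 0) (hq' : D^[m + 1] q = 0) :
    D^[n + m] (p * q) ≠ 0 := by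
  rw [iter_mul D n m p q hp' hq']
  refine mul_ne_zero ?_ (mul_ne_zero hp hq)
  exact_mod_cast (Nat.choose_pos (by omega)).ne'

lemma LND.factor {D : Derivation ℂ A A} (h : LND D) {p q : A} (hpq : p * q ≠ 0)
    (hD : D (p * q) = 0) : D p = 0 := by
  obtain ⟨n, hn, hn'⟩ := h.index (left_ne_zero_of_mul hpq)
  obtain ⟨m, hm, hm'⟩ := h.index (right_ne_zero_of_mul hpq)
  have := iter_mul_ne hn hn' hm hm'
  have h0 : n = 0 := by
    by_contra h1
    exact this (iter_ge D (n := 1) hD (by omega))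
  subst h0
  exact hn'

lemma LND.lt_of_dvd {D : Derivation ℂ A A} (h : LND D) {p q : A} (hp : D p ≠ 0) (hd : q ∣ D p)
    {n m : ℕ} (hn' : D^[n + 1] p = 0)
    (hm : D^[m] q ≠ 0) (hm' : D^[m + 1] q = 0) : m < n := by
  obtain ⟨r, hr⟩ := hd
  have hr0 : r ≠ 0 := by rintro rfl; simp [hr] at hp
  obtain ⟨k, hk, hk'⟩ := h.index hr0
  have := iter_mul_ne hm hm' hk hk'
  rw [← hr, ← Function.iterate_succ_apply] at this
  by_contra hlt
  exact this (iter_ge D hn' (by omega))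

lemma LND.cycle {D : Derivation ℂ A A} (h : LND D) {p q : A} (hp : D p ≠ 0) (hq : D q ≠ 0)
    (h1 : q ∣ D p) (h2 : p ∣ D q) : False := by
  have hp0 : p ≠ 0 := by rintro rfl; simp at hp
  have hq0 : q ≠ 0 := by rintro rfl; simp at hq
  obtain ⟨n, hn, hn'⟩ := h.index hp0
  obtain ⟨m, hm, hm'⟩ := h.index hq0
  have := h.lt_of_dvd hp h1 hn' hm hm'
  have := h.lt_of_dvd hq h2 hm' hn hn'
  omega

/-! ### chain rule -/

lemma pderiv_hom (φ : A →ₐ[ℂ] A) (i : Fin 2) (p : A) : pderiv i (φ p) =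
    φ (pderiv 0 p) * pderiv i (φ (X 0)) + φ (pderiv 1 p) * pderiv i (φ (X 1)) := by
  induction p using MvPolynomial.induction_on with
  | C c =>
    have : φ (C c) = C c := φ.commutes c
    simp [this]
  | add p q hp hq => simp only [map_add, hp, hq]; ring
  | mul_X p j hp =>
    rw [map_mul, Derivation.leibniz, hp]
    fin_cases j <;> simp [Derivation.leibniz] <;> ring

lemma jac_hom (φ : A →ₐ[ℂ] A) (p q : A) :
    Jac (φ p) (φ q) = φ (Jac p q) * Jac (φ (X 0)) (φ (X 1)) := by
  unfold Jac
  rw [pderiv_hom φ 0 p, pderiv_hom φ 1 p, pderiv_hom φ 0 q, pderiv_hom φ 1 q]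
  simp only [map_sub, map_mul]
  ring

lemma equiv_C (φ : A ≃ₐ[ℂ] A) (c : ℂ) : φ (C c) = C c := φ.commutes c

lemma jac_equiv (φ : A ≃ₐ[ℂ] A) : ∃ c : ℂ, c ≠ 0 ∧ ∀ p q, Jac (φ p) (φ q) = φ (Jac p q) * C c := by
  have h1 := jac_hom φ.toAlgHom (φ.symm (X 0)) (φ.symm (X 1))
  have h2 : Jac (X 0 : A) (X 1) = 1 := by simp [Jac]
  simp [h2] at h1
  have h3 : IsUnit (Jac (φ (X 0)) (φ (X 1))) := IsUnit.of_mul_eq_one _ (by rw [mul_comm]; exact h1.symm)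
  rw [MvPolynomial.isUnit_iff_eq_C_of_isReduced] at h3
  obtain ⟨c, hc, hc2⟩ := h3
  refine ⟨c, hc.ne_zero, fun p q => ?_⟩
  rw [← hc2]
  exact jac_hom φ.toAlgHom p q

lemma pderiv1_nil (p : A) : ∃ n : ℕ, (pderiv 1 : Derivation ℂ A A)^[n] p = 0 := by
  have h0 : ∃ d : ℕ, LE 0 1 d p := by
    refine ⟨p.support.sup (fun m => m 1), fun m hm => ?_⟩
    have := Finset.le_sup (f := fun m : Fin 2 →₀ ℕ => m 1) (mem_support_iff.2 hm)
    simp only [zero_mul, one_mul, zero_add]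
    exact_mod_cast this
  obtain ⟨d, hd⟩ := h0
  refine ⟨d + 1, ?_⟩
  have key : ∀ n : ℕ, LE 0 1 (d - n) ((pderiv 1 : Derivation ℂ A A)^[n] p) := by
    intro n
    induction n with
    | zero => simpa using hd
    | succ n ih =>
      rw [Function.iterate_succ_apply']
      exact ih.pderiv1.mono (by push_cast; linarith)
  ext m
  by_contra h
  have := key (d + 1) m h
  push_cast at this
  omega

lemma lnd_coord (φ : A ≃ₐ[ℂ] A) : LND (J (φ (X 0))) := by
  obtain ⟨c, hc, h⟩ := jac_equiv φ
  have key : ∀ (n : ℕ) (p : A), (J (φ (X 0)))^[n] (φ p) =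
      C c ^ n * φ ((pderiv 1 : Derivation ℂ A A)^[n] p) := by
    intro n p
    induction n with
    | zero => simp
    | succ n ih =>
      rw [Function.iterate_succ_apply', Function.iterate_succ_apply', ih, ← C_pow,
        ← MvPolynomial.algebraMap_eq, ← Algebra.smul_def, Derivation.map_smul, J_apply, h]
      simp [Jac, Algebra.smul_def, MvPolynomial.algebraMap_eq]
      ring
  intro p
  obtain ⟨n, hn⟩ := pderiv1_nil (φ.symm p)
  refine ⟨n, ?_⟩
  have := key n (φ.symm p)
  rw [hn] at this
  simpa using this

/-! ### one-variable polynomials and elementary automorphisms -/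

lemma monomial_eq2 (m : Fin 2 →₀ ℕ) (c : ℂ) :
    (monomial m c : A) = C c * X 0 ^ m 0 * X 1 ^ m 1 := by
  rw [monomial_eq, Finsupp.prod_fintype _ _ (by simp)]
  simp [mul_assoc]

lemma sum_eq (p : A) : p = ∑ m ∈ p.support, C (coeff m p) * X 0 ^ m 0 * X 1 ^ m 1 := by
  conv_lhs => rw [← support_sum_monomial_coeff p]
  exact Finset.sum_congr rfl fun m _ => monomial_eq2 m _

lemma pderiv_zero_exp {i : Fin 2} {p : A} (h : pderiv i p = 0) {m : Fin 2 →₀ ℕ}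
    (hm : coeff m p ≠ 0) : m i = 0 := by
  by_contra h0
  have h1 := coeff_pderiv (i := i) p (m - Finsupp.single i 1)
  have h2 : m - Finsupp.single i 1 + Finsupp.single i 1 = m := by
    ext j
    by_cases hj : j = i
    · subst hj
      simp
      omega
    · simp [Ne.symm hj]
  rw [h, h2, coeff_zero] at h1
  refine mul_ne_zero hm ?_ h1.symm
  exact Nat.cast_add_one_ne_zero _

lemma exists_poly0 {p : A} (h : pderiv 1 p = 0) :
    ∃ g : Polynomial ℂ, p = Polynomial.aeval (X 0) g := by
  refine ⟨∑ m ∈ p.support, Polynomial.monomial (m 0) (coeff m p), ?_⟩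
  rw [map_sum]
  conv_lhs => rw [sum_eq p]
  refine Finset.sum_congr rfl fun m hm => ?_
  rw [pderiv_zero_exp h (mem_support_iff.1 hm), Polynomial.aeval_monomial,
    MvPolynomial.algebraMap_eq, pow_zero, mul_one]

lemma exists_poly1 {p : A} (h : pderiv 0 p = 0) :
    ∃ g : Polynomial ℂ, p = Polynomial.aeval (X 1) g := by
  refine ⟨∑ m ∈ p.support, Polynomial.monomial (m 1) (coeff m p), ?_⟩
  rw [map_sum]
  conv_lhs => rw [sum_eq p]
  refine Finset.sum_congr rfl fun m hm => ?_
  rw [pderiv_zero_exp h (mem_support_iff.1 hm), Polynomial.aeval_monomial,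
    MvPolynomial.algebraMap_eq, pow_zero, mul_one]

lemma const_of_pderiv {p : A} (h0 : pderiv 0 p = 0) (h1 : pderiv 1 p = 0) : ∃ c, p = C c := by
  refine ⟨coeff 0 p, ?_⟩
  ext m
  rw [coeff_C]
  split_ifs with h
  · rw [h]
  · by_contra hm
    apply h
    ext i
    fin_cases i
    · exact (pderiv_zero_exp h0 hm).symm
    · exact (pderiv_zero_exp h1 hm).symm

lemma affine_of_pderiv {p : A} {e f : ℂ} (h0 : pderiv 0 p = C e) (h1 : pderiv 1 p = C f) :
    ∃ c, p = C e * X 0 + C f * X 1 + C c := by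
  obtain ⟨c, hc⟩ := const_of_pderiv (p := p - C e * X 0 - C f * X 1)
    (by simp [h0, Derivation.leibniz]) (by simp [h1, Derivation.leibniz])
  exact ⟨c, by rw [← hc]; ring⟩

lemma map_paeval (φ : A →ₐ[ℂ] A) (p : A) (g : Polynomial ℂ) :
    φ (Polynomial.aeval p g) = Polynomial.aeval (φ p) g :=
  (Polynomial.aeval_algHom_apply φ p g).symm

/-- elementary automorphism `x ↦ x`, `y ↦ c y + g(x)` -/
noncomputable def elY (c : ℂ) (hc : c ≠ 0) (g : Polynomial ℂ) : A ≃ₐ[ℂ] A :=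
  AlgEquiv.ofAlgHom (MvPolynomial.aeval ![X 0, C c * X 1 + Polynomial.aeval (X 0) g])
    (MvPolynomial.aeval ![X 0, C c⁻¹ * (X 1 - Polynomial.aeval (X 0) g)])
    (by
      apply MvPolynomial.algHom_ext
      intro i
      fin_cases i
      · simp
      · simp [map_paeval]
        rw [← mul_assoc, ← C_mul, inv_mul_cancel₀ hc, C_1, one_mul])
    (by
      apply MvPolynomial.algHom_ext
      intro i
      fin_cases i
      · simp
      · simp [map_paeval]
        rw [← mul_assoc, ← C_mul, mul_inv_cancel₀ hc, C_1, one_mul]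
        ring)

lemma elY_X0 (c : ℂ) (hc : c ≠ 0) (g : Polynomial ℂ) : elY c hc g (X 0) = X 0 := by
  simp [elY]

lemma elY_X1 (c : ℂ) (hc : c ≠ 0) (g : Polynomial ℂ) :
    elY c hc g (X 1) = C c * X 1 + Polynomial.aeval (X 0) g := by
  simp [elY]

lemma exch_X0 : exch ℂ (X 0) = X 1 := by simp [exch]

lemma exch_X1 : exch ℂ (X 1) = X 0 := by simp [exch]

/-- elementary automorphism `x ↦ c x + g(y)`, `y ↦ y` -/
noncomputable def elX (c : ℂ) (hc : c ≠ 0) (g : Polynomial ℂ) : A ≃ₐ[ℂ] A :=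
  ((exch ℂ).trans (elY c hc g)).trans (exch ℂ)

lemma elX_X1 (c : ℂ) (hc : c ≠ 0) (g : Polynomial ℂ) : elX c hc g (X 1) = X 1 := by
  simp [elX, exch_X0, exch_X1, elY_X0]

lemma elX_X0 (c : ℂ) (hc : c ≠ 0) (g : Polynomial ℂ) :
    elX c hc g (X 0) = C c * X 0 + Polynomial.aeval (X 1) g := by
  have := map_paeval (exch ℂ).toAlgHom (X 0) g
  simp only [AlgEquiv.toAlgHom_apply, exch_X0] at this
  simp [elX, exch_X0, exch_X1, elY_X1, equiv_C, this]

lemma LE.hom {a b d0 d1 n : ℤ} {p : A} (φ : A →ₐ[ℂ] A) (h0 : LE a b d0 (φ (X 0)))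
    (h1 : LE a b d1 (φ (X 1))) (hp : LE d0 d1 n p) : LE a b n (φ p) := by
  rw [sum_eq p, map_sum]
  refine LE.sum _ _ fun m hm => ?_
  have hc : φ (MvPolynomial.C (coeff m p)) = (MvPolynomial.C (coeff m p) : A) := φ.commutes _
  rw [map_mul, map_mul, map_pow, map_pow, hc]
  refine ((LE.C.mul (h0.pow _)).mul (h1.pow _)).mono ?_
  have := hp m (mem_support_iff.1 hm)
  linarith

lemma comp_mul {a b d e : ℤ} {p q : A} (hp : LE a b d p) (hq : LE a b e q) :
    comp a b (d + e) (p * q) = comp a b d p * comp a b e q := by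
  have e1 : p * q = comp a b d p * comp a b e q +
      ((p - comp a b d p) * q + comp a b d p * (q - comp a b e q)) := by
    ring
  have h1 := hom_iff.1 (hom_comp a b d p)
  have h2 := hom_iff.1 (hom_comp a b e q)
  have h3 : Hom a b (d + e) (comp a b d p * comp a b e q) :=
    hom_iff.2 ⟨h1.1.mul h2.1, (h1.2.mul h2.2).mono (by linarith)⟩
  rw [e1, comp_add, comp_of_hom h3,
    comp_of_lt (p := (p - comp a b d p) * q + comp a b d p * (q - comp a b e q))
      (e := d + e - 1), add_zero]
  · exact ((hp.sub_comp.mul hq).mono (by linarith)).add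
      ((h1.1.mul hq.sub_comp).mono (by linarith))
  · linarith

lemma comp_pow {a b d : ℤ} {p : A} (hp : LE a b d p) (n : ℕ) :
    comp a b (n * d) (p ^ n) = comp a b d p ^ n := by
  induction n with
  | zero =>
    have : Hom a b 0 (1 : A) := hom_iff.2 ⟨by simpa using LE.C (c := 1), by simpa using LE.C (c := 1)⟩
    simpa using comp_of_hom this
  | succ n ih =>
    have e1 : ((n + 1 : ℕ) : ℤ) * d = n * d + d := by push_cast; ring
    rw [e1, pow_succ, pow_succ, comp_mul (hp.pow n) hp, ih]

lemma comp_ne_zero {a b d : ℤ} {p : A} (hp : LE a b d p) (h : ¬ LE a b (d - 1) p) :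
    comp a b d p ≠ 0 := by
  intro h0
  have := hp.sub_comp
  rw [h0, sub_zero] at this
  exact h this

lemma exists_LE (p : A) : ∃ d : ℕ, LE 1 1 d p := by
  refine ⟨p.support.sup (fun m => m 0 + m 1), fun m hm => ?_⟩
  have := Finset.le_sup (f := fun m : Fin 2 →₀ ℕ => m 0 + m 1) (mem_support_iff.2 hm)
  simp only [one_mul]
  exact_mod_cast this

lemma exists_deg {p : A} (hp : p ≠ 0) : ∃ d : ℕ, LE 1 1 d p ∧ ¬ LE 1 1 ((d : ℤ) - 1) p := by
  classical
  have h1 := Nat.find_spec (exists_LE p)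
  have h2 := fun m => Nat.find_min (exists_LE p) (m := m)
  refine ⟨_, h1, fun h => ?_⟩
  rcases hn : Nat.find (exists_LE p) with _ | n
  · rw [hn] at h
    apply hp
    ext m
    by_contra hm
    have := h m hm
    push_cast at this
    omega
  · rw [hn] at h
    exact h2 n (by omega) (by simpa using h)

lemma caseY {τ : A ≃ₐ[ℂ] A} (hτ : ∀ p, τ (τ p) = p) {a : ℕ} (ha : 2 ≤ a)
    (hF : LE 1 1 a (τ (X 0))) {c : ℂ} (hc : c ≠ 0) (hcomp : comp 1 1 a (τ (X 0)) = C c * X 1 ^ a)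
    (hG : ¬ LE 1 1 ((a : ℤ) - 1) (τ (X 1))) : False := by
  have hG0 : τ (X 1) ≠ 0 := by simp
  obtain ⟨b, hb, hb'⟩ := exists_deg hG0
  have hab : (a : ℤ) ≤ b := by
    by_contra h
    exact hG (hb.mono (by omega))
  have e1 : (X 0 : A) = C c * τ (X 1) ^ a + τ (τ (X 0) - comp 1 1 a (τ (X 0))) := by
    rw [map_sub, hτ, hcomp, map_mul, equiv_C, map_pow]
    ring
  have l1 : LE 1 1 (((a : ℤ) - 1) * b) (τ (τ (X 0) - comp 1 1 a (τ (X 0)))) := by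
    refine LE.hom τ.toAlgHom (d0 := b) (d1 := b) (hF.mono hab) hb ?_
    intro m hm
    have := hF.sub_comp m hm
    nlinarith
  have e2 := congrArg (comp 1 1 (0 + a * b)) e1
  have hc0 : Hom 1 1 0 (C c : A) := hom_iff.2 ⟨LE.C, by simpa using LE.C⟩
  rw [comp_add, comp_of_lt (LE.X0 (a := 1) (b := 1)), comp_of_lt l1,
    comp_mul LE.C (hb.pow a), comp_pow hb, comp_of_hom hc0, add_zero] at e2
  · have := comp_ne_zero hb hb'
    have h3 : (C c : A) ≠ 0 := by simpa using hc
    exact mul_ne_zero h3 (pow_ne_zero _ this) e2.symm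
  · nlinarith
  · nlinarith

lemma root {α β a : ℕ} (hα : 0 < α) (hco : Nat.Coprime α β) {p : A}
    (hp : Hom α β (α * a) p) {m₀ : Fin 2 →₀ ℕ} (hm₀ : coeff m₀ p ≠ 0) (hm₀' : m₀ 1 ≠ 0) :
    ∃ ν : ℂ, (X 1 ^ α - C ν * X 0 ^ β) ∣ p ∧ ((∃ m, coeff m p ≠ 0 ∧ m 1 = 0) → ν ≠ 0) := by
  classical
  have hk : ∀ m, coeff m p ≠ 0 → ∃ k, m 1 = α * k ∧ m 0 + β * k = a := by
    intro m hm
    have h1 := hp m hm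
    have h2 : α * m 0 + β * m 1 = α * a := by exact_mod_cast h1
    have h3 : α ∣ β * m 1 := (Nat.dvd_add_right (Dvd.intro _ rfl)).1 (h2 ▸ Dvd.intro _ rfl)
    obtain ⟨k, hk⟩ := hco.dvd_of_dvd_mul_left h3
    refine ⟨k, hk, ?_⟩
    rw [hk] at h2
    exact Nat.eq_of_mul_eq_mul_left hα (by rw [← h2]; ring)
  set Φ : Polynomial ℂ := ∑ m ∈ p.support, Polynomial.monomial (m 1 / α) (coeff m p) with hΦ
  have hΦc : ∀ m, coeff m p ≠ 0 → Φ.coeff (m 1 / α) = coeff m p := by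
    intro m hm
    rw [hΦ, Polynomial.finsetSum_coeff, Finset.sum_eq_single m]
    · simp
    · intro n hn hnm
      rw [Polynomial.coeff_monomial, if_neg]
      intro h
      apply hnm
      obtain ⟨k, hk1, hk2⟩ := hk m hm
      obtain ⟨l, hl1, hl2⟩ := hk n (mem_support_iff.1 hn)
      rw [hk1, hl1, Nat.mul_div_cancel_left _ hα, Nat.mul_div_cancel_left _ hα] at h
      subst h
      ext i
      fin_cases i
      · simp; omega
      · simp; omega
    · intro h
      simp at h
      exact absurd h hm
  have hdeg : 0 < Φ.degree := by
    obtain ⟨k, hk1, hk2⟩ := hk m₀ hm₀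
    have h1 : Φ.coeff k ≠ 0 := by
      have := hΦc m₀ hm₀
      rw [hk1, Nat.mul_div_cancel_left _ hα] at this
      rwa [this]
    have hk0 : 0 < k := by
      rcases Nat.eq_zero_or_pos k with rfl | h
      · simp at hk1; exact absurd hk1 hm₀'
      · exact h
    exact lt_of_lt_of_le (by exact_mod_cast hk0) (Polynomial.le_degree_of_ne_zero h1)
  obtain ⟨ν, hν⟩ := Complex.exists_root hdeg
  refine ⟨ν, ?_, ?_⟩
  · have e0 : (0 : A) = ∑ m ∈ p.support, C (coeff m p) * C ν ^ (m 1 / α) * X 0 ^ a := by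
      have : Φ.eval ν = 0 := hν
      rw [hΦ, Polynomial.eval_finsetSum] at this
      rw [← Finset.sum_mul]
      have e2 : (∑ m ∈ p.support, C (coeff m p) * C ν ^ (m 1 / α) : A) =
          C (∑ m ∈ p.support, Polynomial.eval ν (Polynomial.monomial (m 1 / α) (coeff m p))) := by
        rw [map_sum]
        refine Finset.sum_congr rfl fun m _ => ?_
        rw [Polynomial.eval_monomial, C_mul, C_pow]
      rw [e2, this]
      simp
    have e1 : p = ∑ m ∈ p.support, (C (coeff m p) * X 0 ^ m 0 * X 1 ^ m 1 -
        C (coeff m p) * C ν ^ (m 1 / α) * X 0 ^ a) := by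
      rw [Finset.sum_sub_distrib, ← e0, sub_zero]
      exact sum_eq p
    rw [e1]
    refine Finset.dvd_sum fun m hm => ?_
    obtain ⟨k, hk1, hk2⟩ := hk m (mem_support_iff.1 hm)
    rw [hk1, Nat.mul_div_cancel_left _ hα]
    have e3 : (C (coeff m p) * X 0 ^ m 0 * X 1 ^ (α * k) : A) - C (coeff m p) * C ν ^ k * X 0 ^ a =
        C (coeff m p) * X 0 ^ m 0 * ((X 1 ^ α) ^ k - (C ν * X 0 ^ β) ^ k) := by
      rw [← hk2]; ring
    rw [e3]
    exact Dvd.dvd.mul_left (sub_dvd_pow_sub_pow _ _ k) _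
  · rintro ⟨m, hm, hm1⟩ rfl
    have := hΦc m hm
    rw [hm1, Nat.zero_div, Polynomial.coeff_zero_eq_eval_zero] at this
    exact hm (by rw [← this]; exact hν)

lemma jac_self (p : A) : Jac p p = 0 := by unfold Jac; ring

lemma jac_factor {p H : A} (hp : p ≠ 0) (h : LND (J p)) (hd : H ∣ p) : Jac p H = 0 := by
  obtain ⟨q, hq⟩ := hd
  rw [← J_apply]
  refine h.factor (q := q) (by rwa [← hq]) ?_
  rw [← hq, J_apply, jac_self]

lemma caseOne {p : A} (hp : p ≠ 0) (h : LND (J p)) {ν : ℂ} {β : ℕ}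
    (hd : (X 1 - C ν * X 0 ^ β) ∣ p) :
    pderiv 0 (elY 1 one_ne_zero (Polynomial.monomial β ν) p) = 0 := by
  set φ := elY 1 one_ne_zero (Polynomial.monomial β ν)
  have h1 := jac_factor hp h hd
  have h2 := jac_hom φ.toAlgHom p (X 1 - C ν * X 0 ^ β)
  rw [h1] at h2
  have h3 : φ (X 1 - C ν * X 0 ^ β) = X 1 := by
    rw [map_sub, map_mul, map_pow, equiv_C, elY_X0, elY_X1, Polynomial.aeval_monomial,
      MvPolynomial.algebraMap_eq]
    simp
  simp only [AlgEquiv.toAlgHom_apply, h3, map_zero, zero_mul] at h2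
  simpa [Jac] using h2

lemma caseTwo {p : A} (hp : p ≠ 0) (h : LND (J p)) {ν : ℂ} (hν : ν ≠ 0) {α β : ℕ} (hα : 2 ≤ α)
    (hβ : 2 ≤ β) (hd : (X 1 ^ α - C ν * X 0 ^ β) ∣ p) (h0 : pderiv 0 p ≠ 0)
    (h1 : pderiv 1 p ≠ 0) : False := by
  have hj := jac_factor hp h hd
  have e1 : pderiv 0 p * (C (α : ℂ) * X 1 ^ (α - 1)) =
      - (pderiv 1 p * (C (ν * β) * X 0 ^ (β - 1))) := by
    have : Jac p (X 1 ^ α - C ν * X 0 ^ β) = pderiv 0 p * (C (α : ℂ) * X 1 ^ (α - 1)) +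
      (pderiv 1 p * (C (ν * β) * X 0 ^ (β - 1))) := by
      have d0 : pderiv 0 (X 1 ^ α - C ν * X 0 ^ β : A) = - (C (ν * β) * X 0 ^ (β - 1)) := by
        rw [map_sub, pderiv_C_mul, pderiv_pow, pderiv_pow, pderiv_X_self,
          pderiv_X_of_ne (by decide), C_mul]
        simp [mul_assoc]
      have d1 : pderiv 1 (X 1 ^ α - C ν * X 0 ^ β : A) = C (α : ℂ) * X 1 ^ (α - 1) := by
        rw [map_sub, pderiv_C_mul, pderiv_pow, pderiv_pow, pderiv_X_self,
          pderiv_X_of_ne (by decide)]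
        simp
      rw [Jac, d0, d1]
      ring
    rw [hj] at this
    linear_combination -this
  have hx : (X 0 : A) ∣ pderiv 0 p := by
    have hdv : (X 0 : A) ∣ pderiv 0 p * (C (α : ℂ) * X 1 ^ (α - 1)) := by
      rw [e1]
      exact (Dvd.dvd.mul_left (Dvd.dvd.mul_left (dvd_pow_self _ (by omega)) _) _).neg_right
    rcases (MvPolynomial.X_prime (R := ℂ) (i := (0 : Fin 2))).dvd_or_dvd hdv with h | ⟨q, hq⟩
    · exact h
    · exfalso
      have := congrArg (MvPolynomial.eval ![0, 1]) hq
      simp at this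
      omega
  have hy : (X 1 : A) ∣ pderiv 1 p := by
    have hdv : (X 1 : A) ∣ pderiv 1 p * (C (ν * β) * X 0 ^ (β - 1)) := by
      have e2 : pderiv 1 p * (C (ν * β) * X 0 ^ (β - 1)) =
        -(pderiv 0 p * (C (α : ℂ) * X 1 ^ (α - 1))) := by rw [e1]; ring
      rw [e2]
      exact (Dvd.dvd.mul_left (Dvd.dvd.mul_left (dvd_pow_self _ (by omega)) _) _).neg_right
    rcases (MvPolynomial.X_prime (R := ℂ) (i := (1 : Fin 2))).dvd_or_dvd hdv with h | ⟨q, hq⟩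
    · exact h
    · exfalso
      have := congrArg (MvPolynomial.eval ![1, 0]) hq
      simp [hν] at this
      omega
  have e3 : J p (X 0) = - pderiv 1 p := by simp [J_apply, Jac]
  have e4 : J p (X 1) = pderiv 0 p := by simp [J_apply, Jac]
  refine h.cycle (p := X 0) (q := X 1) ?_ ?_ ?_ ?_
  · rw [e3]; simpa using h1
  · rwa [e4]
  · rw [e3]; exact hy.neg_right
  · rwa [e4]

/-! ### descent -/

lemma unit_of_mul {p q : A} {c : ℂ} (hc : c ≠ 0) (h : p * q = C c) : ∃ e, e ≠ 0 ∧ p = C e := by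
  have h3 : IsUnit p := by
    refine IsUnit.of_mul_eq_one (q * C c⁻¹) ?_
    rw [← mul_assoc, h, ← C_mul, mul_inv_cancel₀ hc, C_1]
  rw [MvPolynomial.isUnit_iff_eq_C_of_isReduced] at h3
  obtain ⟨e, he, he2⟩ := h3
  exact ⟨e, he.ne_zero, he2⟩

lemma LE.aeval_monomial {a b d : ℤ} {ν : ℂ} {n : ℕ} (h : n * a ≤ d) :
    LE a b d (Polynomial.aeval (X 0 : A) (Polynomial.monomial n ν)) := by
  rw [Polynomial.aeval_monomial, MvPolynomial.algebraMap_eq]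
  exact (LE.C.mul (LE.X0.pow n)).mono (by linarith)

lemma LE.elY {a b n : ℤ} {ν : ℂ} {β : ℕ} (h : β * a ≤ b) {p : A} (hp : LE a b n p) :
    LE a b n (elY 1 one_ne_zero (Polynomial.monomial β ν) p) := by
  refine LE.hom (Plane.elY 1 one_ne_zero (Polynomial.monomial β ν)).toAlgHom ?_ ?_ hp
  · simp only [AlgEquiv.toAlgHom_apply, elY_X0]
    exact LE.X0
  · simp only [AlgEquiv.toAlgHom_apply, elY_X1, C_1, one_mul]
    exact LE.X1.add (LE.aeval_monomial h)

lemma step {τ : A ≃ₐ[ℂ] A} (hτ : ∀ p, τ (τ p) = p) {a : ℕ} (ha : 2 ≤ a)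
    (hF : LE 1 1 a (τ (X 0)))
    (hmin : ∀ ψ : A ≃ₐ[ℂ] A, ¬ LE 1 1 ((a : ℤ) - 1) (ψ.symm (τ (ψ (X 0))))) : False := by
  set F := τ (X 0) with hFdef
  have hF1 : ¬ LE 1 1 ((a : ℤ) - 1) F := hmin AlgEquiv.refl
  have hlnd : LND (J F) := lnd_coord τ
  set Fb := comp 1 1 a F with hFb
  have hFb0 : Fb ≠ 0 := comp_ne_zero hF hF1
  have hel : ∀ (g : Polynomial ℂ), ¬ LE 1 1 ((a : ℤ) - 1) (elY 1 one_ne_zero g F) := by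
    intro g
    have := hmin (elY 1 one_ne_zero g).symm
    have e : (elY 1 one_ne_zero g).symm (X 0) = X 0 := by
      rw [AlgEquiv.symm_apply_eq, elY_X0]
    rw [e] at this
    exact this
  by_cases hy : ∃ m, coeff m Fb ≠ 0 ∧ m 1 ≠ 0
  · obtain ⟨m, hm, hm1⟩ := hy
    have hh : Hom ((1 : ℕ) : ℤ) ((1 : ℕ) : ℤ) (((1 : ℕ) : ℤ) * a) Fb := by
      simpa using hom_comp 1 1 a F
    obtain ⟨ν, hν, -⟩ := root (by norm_num) (by norm_num) hh hm hm1
    have hd := caseOne (ν := ν) (β := 1) hFb0 (hlnd.of_J_comp hF) (by simpa using hν)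
    set φ := elY 1 one_ne_zero (Polynomial.monomial 1 ν) with hφ
    have hs0 : φ.symm (X 0) = X 0 := by rw [AlgEquiv.symm_apply_eq, hφ, elY_X0]
    set τ' : A ≃ₐ[ℂ] A := (φ.symm.trans τ).trans φ with hτ'
    have t0 : τ' (X 0) = φ F := by simp [hτ', hs0, hFdef]
    have hhb := hom_iff.1 (hom_comp 1 1 a F)
    have hφFb : Hom 1 1 a (φ Fb) :=
      hom_iff.2 ⟨hhb.1.elY (by simp), hhb.2.elY (by simp)⟩
    have hle : LE 1 1 a (φ F) := hF.elY (by simp)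
    have hcomp : comp 1 1 a (φ F) = φ Fb := by
      have e : φ F = φ Fb + φ (F - Fb) := by rw [map_sub]; ring
      rw [e, comp_add, comp_of_hom hφFb, comp_of_lt (hF.sub_comp.elY (by simp)) (by linarith),
        add_zero]
    have hmono : φ Fb = C (coeff (Finsupp.single 1 a) (φ Fb)) * X 1 ^ a := by
      have : (C (coeff (Finsupp.single 1 a) (φ Fb)) * X 1 ^ a : A) =
          monomial (Finsupp.single 1 a) (coeff (Finsupp.single 1 a) (φ Fb)) := by
        rw [monomial_eq2]; simp
      rw [this]
      ext n
      rw [coeff_monomial]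
      split_ifs with h
      · rw [h]
      · by_contra hn
        apply h
        have h1 := pderiv_zero_exp hd hn
        have h2 := hφFb n hn
        ext i
        fin_cases i
        · simp [h1]
        · simp [h1] at h2 ⊢
          omega
    have hc : coeff (Finsupp.single 1 a) (φ Fb) ≠ 0 := by
      intro h
      rw [h, C_0, zero_mul] at hmono
      exact hFb0 (by simpa using hmono)
    refine caseY (τ := τ') (fun p => by simp [hτ', hτ]) ha (by rwa [t0]) hc
      (by rw [t0, hcomp]; exact hmono) ?_
    intro hG
    apply hmin ((exch ℂ).trans φ.symm)
    have e : ((exch ℂ).trans φ.symm).symm (τ (((exch ℂ).trans φ.symm) (X 0))) =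
        exch ℂ (τ' (X 1)) := by
      rw [AlgEquiv.symm_apply_eq]
      have e2 : ∀ p, exch ℂ (exch ℂ p) = p := by
        intro p
        simp [exch, rename_rename]
        have : (⇑(Equiv.swap (0 : Fin 2) 1) ∘ ⇑(Equiv.swap (0 : Fin 2) 1)) = id := by
          ext i; simp
        rw [this, rename_id_apply]
      simp [hτ', exch_X0, e2]
    rw [e]
    refine LE.hom (exch ℂ).toAlgHom ?_ ?_ hG
    · simp only [AlgEquiv.toAlgHom_apply, exch_X0]; exact LE.X1
    · simp only [AlgEquiv.toAlgHom_apply, exch_X1]; exact LE.X0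
  · push Not at hy
    -- `Fb` is a multiple of `x ^ a`
    have hlt : ∀ m, coeff m F ≠ 0 → m 1 ≠ 0 → m 0 + m 1 < a := by
      intro m hm hm1
      have h1 := hF m hm
      have h2 : m 0 + m 1 ≤ a := by
        have : (m 0 : ℤ) + m 1 ≤ a := by linarith
        exact_mod_cast this
      refine lt_of_le_of_ne h2 fun h3 => hm1 (hy m ?_)
      rw [hFb, coeff_comp, if_pos]
      · exact hm
      · rw [one_mul, one_mul]; exact_mod_cast h3
    obtain ⟨mx, hmx, hmx0, hmx1⟩ : ∃ m, coeff m F ≠ 0 ∧ m 0 = a ∧ m 1 = 0 := by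
      obtain ⟨m, hm⟩ := ne_zero_iff.1 hFb0
      have h1 := hy m hm
      have h2 := hom_comp 1 1 a F m hm
      rw [hFb, coeff_comp] at hm
      refine ⟨m, fun h => hm (by simp [h]), ?_, h1⟩
      rw [h1] at h2
      simp at h2
      exact h2
    have hex : (F.support.filter fun m => m 1 ≠ 0).Nonempty := by
      by_contra hne
      rw [Finset.not_nonempty_iff_eq_empty, Finset.filter_eq_empty_iff] at hne
      have hd1 : pderiv 1 F = 0 := by
        ext m
        rw [coeff_pderiv]
        by_contra h
        have := hne (mem_support_iff.2 (left_ne_zero_of_mul h))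
        simp at this
      obtain ⟨c, hc, hJ⟩ := jac_equiv τ
      have h1 := hJ (X 0) (X 1)
      have h2 : Jac (X 0 : A) (X 1) = 1 := by simp [Jac]
      rw [h2, map_one, one_mul, ← hFdef, Jac, hd1, zero_mul, sub_zero] at h1
      obtain ⟨e, -, he⟩ := unit_of_mul hc h1
      obtain ⟨f, hf⟩ := affine_of_pderiv (e := e) (f := 0) he (by simpa using hd1)
      apply hF1
      rw [hf]
      have l1 : LE 1 1 1 (C e * X 0 : A) := (LE.C.mul LE.X0).mono (by norm_num)
      have l2 : LE 1 1 1 (C 0 * X 1 : A) := (LE.C.mul LE.X1).mono (by norm_num)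
      have l3 : LE 1 1 1 (C f : A) := LE.C.mono (by norm_num)
      exact ((l1.add l2).add l3).mono (by omega)
    obtain ⟨m₀, hm₀, hmin₀⟩ := Finset.exists_min_image _
      (fun m : Fin 2 →₀ ℕ => ((a : ℚ) - m 0) / m 1) hex
    rw [Finset.mem_filter, mem_support_iff] at hm₀
    obtain ⟨hm₀, hm₀1⟩ := hm₀
    have hlt0 := hlt m₀ hm₀ hm₀1
    obtain ⟨α, β, hco, hα', hβ'⟩ := Nat.exists_coprime (m₀ 1) (a - m₀ 0)
    set g := Nat.gcd (m₀ 1) (a - m₀ 0)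
    have hg : 0 < g := Nat.gcd_pos_of_pos_left _ (Nat.pos_of_ne_zero hm₀1)
    have hα : 0 < α := by
      rcases Nat.eq_zero_or_pos α with h | h
      · rw [h, zero_mul] at hα'; exact absurd hα' hm₀1
      · exact h
    have hαβ : α < β := by
      have : α * g < β * g := by rw [← hα', ← hβ']; omega
      exact Nat.lt_of_mul_lt_mul_right this
    have hwF : LE α β (α * a) F := by
      intro m hm
      by_cases h1 : m 1 = 0
      · have h2 := hF m hm
        rw [h1] at h2 ⊢
        simp only [one_mul, Nat.cast_zero, mul_zero, add_zero] at h2 ⊢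
        exact mul_le_mul_of_nonneg_left h2 (by positivity)
      · have h2 := hmin₀ m (by rw [Finset.mem_filter, mem_support_iff]; exact ⟨hm, h1⟩)
        have p1 : (0 : ℚ) < m₀ 1 := by exact_mod_cast Nat.pos_of_ne_zero hm₀1
        have p2 : (0 : ℚ) < m 1 := by exact_mod_cast Nat.pos_of_ne_zero h1
        rw [div_le_div_iff₀ p1 p2] at h2
        have e1 : ((a : ℚ) - m₀ 0) = β * g := by
          rw [← Nat.cast_mul, ← hβ', Nat.cast_sub (by omega)]
        have e2 : (m₀ 1 : ℚ) = α * g := by rw [← Nat.cast_mul, ← hα']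
        rw [e1, e2] at h2
        have pg : (0 : ℚ) < g := by exact_mod_cast hg
        have h3 : (β : ℚ) * m 1 ≤ (a - m 0) * α := by
          refine le_of_mul_le_mul_right ?_ pg
          linarith
        have h4 : (α : ℚ) * m 0 + β * m 1 ≤ α * a := by linarith
        exact_mod_cast h4
    set Fw := comp α β (α * a) F with hFw
    have cx : coeff mx Fw ≠ 0 := by
      rw [hFw, coeff_comp, if_pos]
      · exact hmx
      · rw [hmx0, hmx1]; simp
    have c0 : coeff m₀ Fw ≠ 0 := by
      rw [hFw, coeff_comp, if_pos]
      · exact hm₀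
      · have e1 : (a : ℤ) - m₀ 0 = β * g := by
          rw [← Nat.cast_mul, ← hβ', Nat.cast_sub (by omega)]
        have e2 : (m₀ 1 : ℤ) = α * g := by rw [← Nat.cast_mul, ← hα']
        rw [e2]
        linear_combination -(α : ℤ) * e1
    have hFw0 : Fw ≠ 0 := fun h => by simp [h] at cx
    have hl := hlnd.of_J_comp hwF
    obtain ⟨ν, hν, hν0⟩ := root hα hco (hom_comp α β (α * a) F) c0 hm₀1
    have hν0 := hν0 ⟨mx, cx, hmx1⟩
    by_cases hα2 : 2 ≤ α
    · refine caseTwo hFw0 hl hν0 hα2 (by omega) hν ?_ ?_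
      · intro h
        have := pderiv_zero_exp h cx
        omega
      · intro h
        exact hm₀1 (pderiv_zero_exp h c0)
    · obtain rfl : α = 1 := by omega
      have hd := caseOne (ν := ν) (β := β) hFw0 hl (by rw [pow_one] at hν; exact hν)
      apply hel (Polynomial.monomial β ν)
      set φ := elY 1 one_ne_zero (Polynomial.monomial β ν)
      have e : φ F = φ Fw + φ (F - Fw) := by rw [map_sub]; ring
      rw [e]
      refine LE.add ?_ ?_
      · intro m hm
        have h1 := (hom_comp ((1 : ℕ) : ℤ) β (((1 : ℕ) : ℤ) * a) F).le.elY (ν := ν) (β := β)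
          (by simp) m hm
        have h2 := pderiv_zero_exp hd hm
        rw [h2] at h1 ⊢
        have h3 : (2 : ℤ) * m 1 ≤ β * m 1 := by
          apply mul_le_mul_of_nonneg_right _ (by positivity)
          exact_mod_cast hαβ
        simp at h1 ⊢
        omega
      · intro m hm
        have h1 := hwF.sub_comp.elY (ν := ν) (β := β) (by simp) m hm
        have h3 : (1 : ℤ) * m 1 ≤ β * m 1 := by
          apply mul_le_mul_of_nonneg_right _ (by positivity)
          exact_mod_cast hαβ.le
        push_cast at h1
        linarith

lemma descent {ε : A ≃ₐ[ℂ] A} (hε : ∀ p, ε (ε p) = p) :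
    ∃ φ : A ≃ₐ[ℂ] A, LE 1 1 1 (φ.symm (ε (φ (X 0)))) := by
  classical
  have hex : ∃ n : ℕ, ∃ φ : A ≃ₐ[ℂ] A, LE 1 1 n (φ.symm (ε (φ (X 0)))) := by
    obtain ⟨d, hd⟩ := exists_LE (ε (X 0))
    exact ⟨d, AlgEquiv.refl, hd⟩
  have h1 := Nat.find_spec hex
  have h2 := fun m => Nat.find_min hex (m := m)
  set a := Nat.find hex
  obtain ⟨φ, hφ⟩ := h1
  by_cases ha : 2 ≤ a
  · exfalso
    refine step (τ := (φ.trans ε).trans φ.symm) (fun p => by simp [hε]) ha hφ fun ψ hψ => ?_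
    refine h2 (a - 1) (by omega) ⟨ψ.trans φ, ?_⟩
    rw [Nat.cast_sub (by omega)]
    exact hψ
  · exact ⟨φ, hφ.mono (by omega)⟩


lemma const_of_LE {p : A} (h : LE 1 1 0 p) : ∃ c, p = C c := by
  refine const_of_pderiv ?_ ?_
  · ext m
    by_contra hm
    have := h.pderiv0 m (by simpa using hm)
    omega
  · ext m
    by_contra hm
    have := h.pderiv1 m (by simpa using hm)
    omega

lemma linearize0 {τ : A ≃ₐ[ℂ] A} (hτ : ∀ p, τ (τ p) = p)
    (hJ : ∀ p q, Jac (τ p) (τ q) = -τ (Jac p q)) (h : LE 1 1 1 (τ (X 0))) :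
    ∃ φ : A ≃ₐ[ℂ] A, τ (φ (X 0)) = φ (X 0) ∧ τ (φ (X 1)) = -φ (X 1) := by
  obtain ⟨e, he⟩ := const_of_LE h.pderiv0
  obtain ⟨f, hf⟩ := const_of_LE h.pderiv1
  obtain ⟨g, hg⟩ := affine_of_pderiv he hf
  by_cases hf0 : f = 0
  · subst hf0
    simp only [map_zero, zero_mul, add_zero] at hg
    have h2 := hτ (X 0)
    rw [hg] at h2
    simp only [map_add, map_mul, equiv_C, hg] at h2
    have e2 : e * g + g = 0 := by
      have := congrArg (MvPolynomial.eval ![0, 0]) h2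
      simpa using this
    have e1 : e * e = 1 := by
      have := congrArg (MvPolynomial.eval ![1, 0]) h2
      simp at this
      linear_combination this - e2
    have hJ1 := hJ (X 0) (X 1)
    have hj : Jac (X 0 : A) (X 1) = 1 := by simp [Jac]
    rw [hj, map_one] at hJ1
    unfold Jac at hJ1
    rw [he, hf, map_zero, zero_mul, sub_zero] at hJ1
    have hy : pderiv 1 (τ (X 1)) = C (-e) := by
      have : C e * (C e * pderiv 1 (τ (X 1))) = C e * (-1) := by rw [hJ1]
      rw [← mul_assoc, ← C_mul, e1] at this
      simpa using this
    obtain ⟨q, hq⟩ := exists_poly0 (p := τ (X 1) - C (-e) * X 1) (by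
      simp [hy, Derivation.leibniz])
    have hτ1 : τ (X 1) = C (-e) * X 1 + Polynomial.aeval (X 0) q := by rw [← hq]; ring
    have hm : ∀ r : Polynomial ℂ, τ (Polynomial.aeval (X 0 : A) r) = Polynomial.aeval (τ (X 0)) r :=
      fun r => map_paeval τ.toAlgHom (X 0) r
    have hsq : (e - 1) * (e + 1) = 0 := by linear_combination e1
    rcases mul_eq_zero.1 hsq with h3 | h3
    · obtain rfl : e = 1 := by linear_combination h3
      obtain rfl : g = 0 := by linear_combination e2 / 2
      have hx : τ (X 0) = X 0 := by simpa using hg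
      refine ⟨elY 1 one_ne_zero (Polynomial.C (-1/2) * q), ?_, ?_⟩
      · rw [elY_X0, hx]
      · rw [elY_X1]
        simp only [map_add, map_mul, equiv_C, hm, hx, hτ1, Polynomial.aeval_C, MvPolynomial.algebraMap_eq]
        have : (C (-1/2) : A) * 2 = -1 := by
          rw [show (2 : A) = C 2 from (map_ofNat C 2).symm, ← C_mul, ← C_1, ← C_neg]; norm_num
        simp only [map_neg, map_one]
        linear_combination (Polynomial.aeval (X 0 : A) q) * this
    · obtain rfl : e = -1 := by linear_combination h3
      have hx : τ (X 0) = -X 0 + C g := by simpa using hg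
      have hy1 : τ (X 1) = X 1 + Polynomial.aeval (X 0) q := by simpa using hτ1
      have h4 := hτ (X 1)
      rw [hy1, map_add, hm, hy1] at h4
      have h12 : (C (1/2) : A) * 2 = 1 := by
        rw [show (2 : A) = C 2 from (map_ofNat C 2).symm, ← C_mul, ← C_1]; norm_num
      have hgg : (C (-g/2) : A) = - C (1/2) * C g := by
        rw [← C_neg, ← C_mul]; congr 1; ring
      refine ⟨((exch ℂ).trans (elX 1 one_ne_zero (Polynomial.C (-g/2)))).trans
        (elY 1 one_ne_zero (Polynomial.C (1/2) * q)), ?_, ?_⟩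
      · simp only [AlgEquiv.trans_apply, exch_X0, elX_X1, elY_X1]
        simp only [map_add, map_mul, equiv_C, hm, hy1, Polynomial.aeval_C, MvPolynomial.algebraMap_eq,
          map_one, one_mul]
        linear_combination C (1/2) * h4 - (Polynomial.aeval (X 0 : A) q) * h12
      · simp only [AlgEquiv.trans_apply, exch_X1, elX_X0, elY_X0]
        simp only [map_add, map_mul, equiv_C, hx, elY_X0, Polynomial.aeval_C, MvPolynomial.algebraMap_eq,
          map_one, one_mul]
        rw [hgg]
        linear_combination (-C g) * h12
  · have hF : τ (τ (X 0)) = X 0 := hτ _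
    have key : C f * X 1 + Polynomial.aeval (X 0 : A) (Polynomial.C e * Polynomial.X + Polynomial.C g)
        = τ (X 0) := by
      rw [hg]; simp; ring
    obtain ⟨ρ, hρ0, hρ1⟩ : ∃ ρ : A ≃ₐ[ℂ] A, ρ (X 0) = X 0 ∧ ρ (X 1) = τ (X 0) :=
      ⟨elY f hf0 (Polynomial.C e * Polynomial.X + Polynomial.C g), elY_X0 _ _ _, by
        rw [elY_X1, key]⟩
    refine ⟨((elY (-2) (by norm_num) Polynomial.X).trans (elX 1 one_ne_zero Polynomial.X)).trans ρ,
      ?_, ?_⟩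
    · simp only [AlgEquiv.trans_apply, elY_X0, elX_X0, map_add, map_mul, equiv_C,
        Polynomial.aeval_X, hρ0, hρ1, hF, map_one]
      ring
    · simp only [AlgEquiv.trans_apply, elY_X1, elX_X0, elX_X1, map_add, map_mul, equiv_C,
        Polynomial.aeval_X, hρ0, hρ1, hF, map_one, map_neg, map_ofNat]
      ring

lemma linearize {ε : A ≃ₐ[ℂ] A} (hε : ∀ p, ε (ε p) = p)
    (hJ : ∀ p q, Jac (ε p) (ε q) = -ε (Jac p q)) :
    ∃ φ : A ≃ₐ[ℂ] A, ε (φ (X 0)) = φ (X 0) ∧ ε (φ (X 1)) = -φ (X 1) := by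
  obtain ⟨φ, hφ⟩ := descent hε
  obtain ⟨c, hc, h1⟩ := jac_equiv φ
  have hc' : (C c : A) ≠ 0 := by simpa using hc
  obtain ⟨ψ, h2, h3⟩ := linearize0 (τ := (φ.trans ε).trans φ.symm) (fun p => by simp [hε]) (by
    intro p q
    apply φ.injective
    apply mul_right_cancel₀ hc'
    rw [← h1]
    simp only [AlgEquiv.trans_apply, AlgEquiv.apply_symm_apply, map_neg]
    rw [hJ, h1, map_mul, equiv_C]
    ring) hφ
  refine ⟨ψ.trans φ, ?_, ?_⟩
  · have := congrArg φ h2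
    simpa using this
  · have := congrArg φ h3
    simpa using this

lemma top_mono {u v d : ℤ} (hv : v ≠ 0) {p : A} (hp : Hom v u d p) (h0 : p ≠ 0) :
    ∃ m, coeff m p ≠ 0 ∧ LE 0 1 (m 1) p ∧ comp 0 1 (m 1) p = monomial m (coeff m p) := by
  classical
  obtain ⟨m, hm, hmax⟩ := Finset.exists_max_image p.support (fun m => m 1) (by simpa using h0)
  rw [mem_support_iff] at hm
  refine ⟨m, hm, ?_, ?_⟩
  · intro n hn
    have := hmax n (mem_support_iff.2 hn)
    omega
  · ext n
    rw [coeff_comp, coeff_monomial]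
    by_cases hn : coeff n p = 0
    · by_cases hmn : m = n
      · subst hmn; exact absurd hn hm
      · simp [hn, hmn]
    · have iff : (0 * (n 0 : ℤ) + 1 * (n 1 : ℤ) = (m 1 : ℤ)) ↔ m = n := by
        constructor
        · intro h
          have h1 : n 1 = m 1 := by omega
          have h2 := hp n hn
          have h3 := hp m hm
          rw [h1] at h2
          have h4 : (n 0 : ℤ) = m 0 := by
            apply mul_left_cancel₀ hv
            linarith
          ext i
          fin_cases i
          · simpa using by exact_mod_cast h4.symm
          · simpa using h1.symm
        · rintro rfl; simp
      by_cases hmn : m = n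
      · rw [if_pos (iff.2 hmn), if_pos hmn, hmn]
      · rw [if_neg (fun h => hmn (iff.1 h)), if_neg hmn]

lemma jac_mono {m n : Fin 2 →₀ ℕ} {a b : ℂ} (ha : a ≠ 0) (hb : b ≠ 0)
    (h : Jac (monomial m a : A) (monomial n b) = 0) : m 0 * n 1 = m 1 * n 0 := by
  have h1 : (X 0 * X 1 : A) * Jac (monomial m a : A) (monomial n b) = 0 := by rw [h, mul_zero]
  have h2 : (X 0 * X 1 : A) * Jac (monomial m a : A) (monomial n b) =
      (X 0 * pderiv 0 (monomial m a)) * (X 1 * pderiv 1 (monomial n b)) -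
      (X 1 * pderiv 1 (monomial m a)) * (X 0 * pderiv 0 (monomial n b)) := by
    unfold Jac; ring
  rw [h2] at h1
  simp only [X_mul_pderiv_monomial, nsmul_eq_mul] at h1
  have h3 : ((m 0 : A) * (n 1 : A) - (m 1 : A) * (n 0 : A)) *
      ((monomial m a : A) * monomial n b) = 0 := by linear_combination h1
  have h4 : ((monomial m a : A) * monomial n b) ≠ 0 := by
    apply mul_ne_zero <;> simpa
  have h5 := (mul_eq_zero.1 h3).resolve_right h4
  have h6 : ((m 0 * n 1 : ℕ) : A) = ((m 1 * n 0 : ℕ) : A) := by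
    push_cast; linear_combination h5
  exact_mod_cast h6

lemma hom_C {a b : ℤ} (c : ℂ) : Hom a b 0 (C c : A) :=
  hom_iff.2 ⟨LE.C, by simpa using LE.C⟩

lemma vertex {s k : A} {c : ℂ} (hc : c ≠ 0) (hJ : Jac s k = C c) (hk : LE 0 (-1) (-1) k) :
    pderiv 0 k = 0 := by
  classical
  have hs : LE 0 (-1) 0 s := fun m _ => by omega
  have hj := comp_jac hs hk
  rw [hJ, show (0 : ℤ) + -1 - 0 - -1 = 0 by norm_num, comp_of_hom (hom_C c)] at hj
  have hp1 : pderiv 1 (comp 0 (-1) 0 s) = 0 := by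
    ext m
    by_contra hm
    have h1 : LE 0 1 0 (comp 0 (-1) 0 s) := by simpa using (hom_iff.1 (hom_comp 0 (-1) 0 s)).2
    have := h1.pderiv1 m (by simpa using hm)
    omega
  have hj2 : pderiv 0 (comp 0 (-1) 0 s) * pderiv 1 (comp 0 (-1) (-1) k) = C c := by
    rw [hj, Jac, hp1]; ring
  obtain ⟨e, he, hse⟩ := unit_of_mul hc hj2
  obtain ⟨f, hf, hkf⟩ := unit_of_mul hc ((mul_comm _ _).trans hj2)
  -- monomials of s on the axis
  have hs1 : ∀ m, coeff m s ≠ 0 → m 1 = 0 → m 0 ≤ 1 := by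
    intro m hm hm1
    obtain ⟨g, hg⟩ := affine_of_pderiv (f := 0) hse (by rw [hp1, map_zero])
    have h1 : LE 1 0 1 (comp 0 (-1) 0 s) := by
      rw [hg, map_zero, zero_mul, add_zero]
      exact ((LE.C.mul LE.X0).mono (by norm_num)).add (LE.C.mono (by norm_num))
    have := h1 m (by rw [coeff_comp, if_pos (by simp [hm1])]; exact hm)
    omega
  have hk1 : ∀ m, coeff m k ≠ 0 → m 1 = 1 → m 0 = 0 := by
    intro m hm hm1
    by_contra h0
    have h1 : coeff m (comp 0 (-1) (-1) k - C f * X 1) ≠ 0 := by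
      rw [coeff_sub, coeff_comp, if_pos (by simp [hm1]), coeff_C_mul, coeff_X, if_neg]
      · simpa using hm
      · rintro rfl; simp at h0
    have := pderiv_zero_exp (i := 1) (by simp [hkf, Derivation.leibniz]) h1
    omega
  have hk2 : ∀ m, coeff m k ≠ 0 → 1 ≤ m 1 := fun m hm => by
    have := hk m hm
    omega
  by_contra hne
  obtain ⟨m, hm, hm0⟩ : ∃ m, coeff m k ≠ 0 ∧ m 0 ≠ 0 := by
    by_contra hcon
    push Not at hcon
    apply hne
    ext m
    rw [coeff_pderiv]
    have : coeff (m + Finsupp.single 0 1) k = 0 := by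
      by_contra h
      have := hcon _ h
      simp at this
    simp [this]
  have hm2 : 2 ≤ m 1 := by
    have h1 := hk2 m hm
    have h2 := hk1 m hm
    omega
  set T : Finset (ℕ × ℕ) := (s.support.filter (fun m => m 1 ≠ 0)).image (fun m => (m 0 - 1, m 1)) ∪
    (k.support.filter (fun m => 2 ≤ m 1)).image (fun m => (m 0, m 1 - 1)) with hT
  have hTs : ∀ n, coeff n s ≠ 0 → n 1 ≠ 0 → (n 0 - 1, n 1) ∈ T := by
    intro n hn hn1
    rw [hT]
    refine Finset.mem_union_left _ (Finset.mem_image.2 ⟨n, ?_, rfl⟩)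
    simp [hn, hn1]
  have hTk : ∀ n, coeff n k ≠ 0 → 2 ≤ n 1 → (n 0, n 1 - 1) ∈ T := by
    intro n hn hn1
    rw [hT]
    refine Finset.mem_union_right _ (Finset.mem_image.2 ⟨n, ?_, rfl⟩)
    simp [hn, hn1]
  have hT' : ∀ t ∈ T, 0 < t.2 ∧ ((∃ n, coeff n s ≠ 0 ∧ n 1 ≠ 0 ∧ t = (n 0 - 1, n 1)) ∨
      (∃ n, coeff n k ≠ 0 ∧ 2 ≤ n 1 ∧ t = (n 0, n 1 - 1))) := by
    intro t ht
    rw [hT, Finset.mem_union, Finset.mem_image, Finset.mem_image] at ht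
    rcases ht with ⟨n, hn, rfl⟩ | ⟨n, hn, rfl⟩
    · rw [Finset.mem_filter, mem_support_iff] at hn
      exact ⟨Nat.pos_of_ne_zero hn.2, Or.inl ⟨n, hn.1, hn.2, rfl⟩⟩
    · rw [Finset.mem_filter, mem_support_iff] at hn
      exact ⟨by simp only; omega, Or.inr ⟨n, hn.1, hn.2, rfl⟩⟩
  obtain ⟨⟨u, v⟩, huv, hmax⟩ := Finset.exists_max_image T (fun t => (t.1 : ℚ) / t.2)
    ⟨_, hTk m hm hm2⟩
  obtain ⟨hv, hor⟩ := hT' _ huv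
  simp only at hv
  have hmax' : ∀ t ∈ T, t.1 * v ≤ u * t.2 := by
    intro t ht
    have h1 := hmax t ht
    have h2 := (hT' t ht).1
    simp only at h1
    rw [div_le_div_iff₀ (by exact_mod_cast h2) (by exact_mod_cast hv)] at h1
    exact_mod_cast h1
  have hu : 0 < u := by
    have h1 := hmax' _ (hTk m hm hm2)
    simp only at h1
    by_contra h
    have : u = 0 := by omega
    subst this
    have : 0 < m 0 * v := Nat.mul_pos (by omega) hv
    omega
  have Ls : LE v (-u) v s := by
    intro n hn
    by_cases h1 : n 1 = 0
    · have h2 := hs1 n hn h1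
      have : (v : ℤ) * n 0 ≤ v * 1 := mul_le_mul_of_nonneg_left (by exact_mod_cast h2) (by positivity)
      rw [h1]; simp; linarith
    · have h2 := hmax' _ (hTs n hn h1)
      simp only at h2
      have h3 : (v : ℤ) * n 0 ≤ v * ((n 0 - 1 : ℕ) + 1) :=
        mul_le_mul_of_nonneg_left (by omega) (by positivity)
      have h4 : ((n 0 - 1 : ℕ) : ℤ) * v ≤ u * n 1 := by exact_mod_cast h2
      linarith
  have Lk : LE v (-u) (-u) k := by
    intro n hn
    by_cases h1 : n 1 = 1
    · have h2 := hk1 n hn h1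
      simp [h1, h2]
    · have h2 := hk2 n hn
      have h3 := hmax' _ (hTk n hn (by omega))
      simp only at h3
      have h4 : ((n 1 - 1 : ℕ) : ℤ) = n 1 - 1 := by omega
      have h5 : (n 0 : ℤ) * v ≤ u * ((n 1 - 1 : ℕ) : ℤ) := by exact_mod_cast h3
      rw [h4] at h5
      linarith
  have hjj := comp_jac Ls Lk
  rw [hJ, show (v : ℤ) + -u - v - -u = 0 by ring, comp_of_hom (hom_C c)] at hjj
  have hcC : (C c : A) ≠ 0 := by simpa using hc
  have hv0 : (v : ℤ) ≠ 0 := by omega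
  obtain ⟨p, hp, hpL, hpc⟩ := top_mono hv0 (hom_comp (v : ℤ) (-u) v s) (fun h => by
    rw [h] at hjj; simp [Jac, hc] at hjj)
  obtain ⟨q, hq, hqL, hqc⟩ := top_mono hv0 (hom_comp (v : ℤ) (-u) (-u) k) (fun h => by
    rw [h] at hjj; simp [Jac, hc] at hjj)
  have hph := hom_comp _ _ _ _ p hp
  have hqh := hom_comp _ _ _ _ q hq
  have hq1 : 1 ≤ q 1 := by
    have hq' := hq
    rw [coeff_comp, if_pos hqh] at hq'
    exact hk2 q hq'
  have hsum : 2 ≤ p 1 + q 1 := by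
    rcases hor with ⟨n, hn, hn1, heq⟩ | ⟨n, hn, hn1, heq⟩
    · rw [Prod.mk.injEq] at heq
      have hn0 : 1 ≤ n 0 := by omega
      have := hpL n (by
        rw [coeff_comp, if_pos]
        · exact hn
        · obtain ⟨hu', hv'⟩ := heq
          have : (u : ℤ) = n 0 - 1 := by omega
          rw [this, hv']; ring)
      omega
    · rw [Prod.mk.injEq] at heq
      have := hqL n (by
        rw [coeff_comp, if_pos]
        · exact hn
        · obtain ⟨hu', hv'⟩ := heq
          have : (v : ℤ) = n 1 - 1 := by omega
          rw [this, hu']; ring)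
      omega
  have hz := comp_jac hpL hqL
  rw [← hjj, hpc, hqc, comp_of_lt (LE.C (c := c)) (by omega)] at hz
  have hfin := jac_mono hp hq hz.symm
  have hfin' : (p 0 : ℤ) * q 1 = p 1 * q 0 := by exact_mod_cast hfin
  have h1 : (v : ℤ) * q 1 + u * p 1 = 0 := by
    linear_combination (-(q 1 : ℤ)) * hph + (p 1 : ℤ) * hqh + (v : ℤ) * hfin'
  have h2 : (0 : ℤ) < v * q 1 := by positivity
  have h3 : (0 : ℤ) ≤ u * p 1 := by positivity
  omega

lemma odd_part {σ : A ≃ₐ[ℂ] A} (h0 : σ (X 0) = X 0) (h1 : σ (X 1) = -X 1) (p : A) :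
    (X 1 : A) ∣ p - σ p := by
  induction p using MvPolynomial.induction_on with
  | C c => rw [equiv_C, sub_self]; exact dvd_zero _
  | add p q hp hq =>
    rw [map_add, show p + q - (σ p + σ q) = (p - σ p) + (q - σ q) by ring]
    exact dvd_add hp hq
  | mul_X p i hp =>
    fin_cases i
    · simp only [Fin.zero_eta, Fin.isValue, map_mul, h0]
      rw [← sub_mul]
      exact hp.mul_right _
    · simp only [Fin.mk_one, Fin.isValue, map_mul, h1]
      exact ⟨p + σ p, by ring⟩

lemma finish1 {ε : A ≃ₐ[ℂ] A} (hε : ∀ p, ε (ε p) = p) {f : A →ₐ[ℂ] A} {c c' : ℂ} (hc : c ≠ 0)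
    (hc' : c' ≠ 0) (hJ : Jac (f (X 0)) (f (X 1)) = C c)
    (hP : Jac (f (X 0)) (ε (f (X 0))) = C c') : Function.Bijective f := by
  have hεJ : ∀ p q, Jac (ε p) (ε q) = -ε (Jac p q) := by
    obtain ⟨d, hd, h⟩ := jac_equiv ε
    have h1 := h (f (X 0)) (ε (f (X 0)))
    rw [hε, hP, equiv_C] at h1
    have h2 : Jac (ε (f (X 0))) (f (X 0)) = - C c' := by
      rw [← hP]; unfold Jac; ring
    rw [h2, ← C_mul, ← C_neg] at h1
    have h3 := C_injective _ _ h1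
    have h4 : d = -1 := by
      apply mul_left_cancel₀ hc'
      rw [← h3]; ring
    intro p q
    rw [h, h4]; simp
  obtain ⟨φ, hφ0, hφ1⟩ := linearize hε hεJ
  set σ : A ≃ₐ[ℂ] A := (φ.trans ε).trans φ.symm with hσ
  have hσ0 : σ (X 0) = X 0 := by simp [hσ, hφ0]
  have hσ1 : σ (X 1) = - X 1 := by simp [hσ, hφ1]
  obtain ⟨d, hd, hφJ⟩ := jac_equiv φ.symm
  set P : A := φ.symm (f (X 0)) with hPdef
  have hσP : σ P = φ.symm (ε (f (X 0))) := by simp [hσ, hPdef]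
  have hPJ : Jac P (σ P) = C (c' * d) := by
    rw [hσP, hPdef, hφJ, hP, equiv_C, C_mul]
  have hsk : Jac (P + σ P) (P - σ P) = C (-2 * (c' * d)) := by
    rw [C_mul, ← hPJ]
    simp only [Jac, map_add, map_sub, map_neg, map_ofNat]
    ring
  have hne : -2 * (c' * d) ≠ 0 := mul_ne_zero (by norm_num) (mul_ne_zero hc' hd)
  have hk : pderiv 0 (P - σ P) = 0 := by
    refine vertex hne hsk ?_
    obtain ⟨r, hr⟩ := odd_part hσ0 hσ1 P
    rw [hr]
    have : LE 0 (-1) 0 r := fun m _ => by omega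
    exact (LE.X1.mul this).mono (by norm_num)
  have hprod : pderiv 0 (P + σ P) * pderiv 1 (P - σ P) = C (-2 * (c' * d)) := by
    rw [← hsk, Jac, hk]; ring
  obtain ⟨e, he, hes⟩ := unit_of_mul hne hprod
  have hP0 : pderiv 0 P = C (e / 2) := by
    have h1 : (2 : A) * pderiv 0 P = C e := by
      rw [← hes, map_add]
      rw [map_sub] at hk
      linear_combination hk
    have h2 : (2 : A) * C (e / 2) = C e := by
      rw [show (2 : A) = C 2 from (map_ofNat C 2).symm, ← C_mul]; congr 1; ring
    exact mul_left_cancel₀ (two_ne_zero) (h1.trans h2.symm)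
  have he2 : e / 2 ≠ 0 := div_ne_zero he two_ne_zero
  obtain ⟨g, hg⟩ := exists_poly1 (p := P - C (e / 2) * X 0) (by simp [hP0, Derivation.leibniz])
  set ψ := elX (e / 2) he2 g with hψ
  have hψ0 : ψ (X 0) = P := by rw [hψ, elX_X0, ← hg]; ring
  set R : A := ψ.symm (φ.symm (f (X 1))) with hR
  obtain ⟨d2, hd2, hψJ⟩ := jac_equiv ψ.symm
  have hPX : ψ.symm P = X 0 := by rw [← hψ0, AlgEquiv.symm_apply_apply]
  have hRJ : Jac (X 0) R = C (c * d * d2) := by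
    rw [← hPX, hR, hPdef, hψJ, hφJ, hJ, equiv_C, ← C_mul, equiv_C, ← C_mul]
  have hR1 : pderiv 1 R = C (c * d * d2) := by
    rw [← hRJ]; simp [Jac]
  have hr0 : c * d * d2 ≠ 0 := mul_ne_zero (mul_ne_zero hc hd) hd2
  obtain ⟨h, hh⟩ := exists_poly0 (p := R - C (c * d * d2) * X 1) (by simp [hR1, Derivation.leibniz])
  set θ := elY (c * d * d2) hr0 h with hθ
  have hθ1 : θ (X 1) = R := by rw [hθ, elY_X1, ← hh]; ring
  have hθ0 : θ (X 0) = X 0 := by rw [hθ, elY_X0]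
  have hf : f = ((θ.trans ψ).trans φ).toAlgHom := by
    apply MvPolynomial.algHom_ext
    intro i
    fin_cases i
    · simp only [Fin.zero_eta, Fin.isValue, AlgEquiv.toAlgHom_apply, AlgEquiv.trans_apply, hθ0, hψ0, hPdef,
        AlgEquiv.apply_symm_apply]
    · simp only [Fin.mk_one, Fin.isValue, AlgEquiv.toAlgHom_apply, AlgEquiv.trans_apply, hθ1, hR,
        AlgEquiv.apply_symm_apply]
  rw [hf]
  exact ((θ.trans ψ).trans φ).bijective

end Plane

/-- Over `ℂ`, a generalized `ε`-endomorphism is an automorphism. -/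
theorem stmt10
    (ε : MvPolynomial (Fin 2) ℂ ≃ₐ[ℂ] MvPolynomial (Fin 2) ℂ)
    (hε : IsInvolution ε)
    (f : MvPolynomial (Fin 2) ℂ →ₐ[ℂ] MvPolynomial (Fin 2) ℂ)
    (hJac : ∃ c : ℂ, c ≠ 0 ∧ Jac (f (X 0)) (f (X 1)) = C c)
    (hgen : (∃ c : ℂ, c ≠ 0 ∧ Jac (f (X 0)) (ε (f (X 0))) = C c) ∨
            (∃ c : ℂ, c ≠ 0 ∧ Jac (f (X 1)) (ε (f (X 1))) = C c)) :
    Function.Bijective f := by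
  obtain ⟨c, hc, hJ⟩ := hJac
  rcases hgen with ⟨c', hc', h⟩ | ⟨c', hc', h⟩
  · exact Plane.finish1 hε.1 hc hc' hJ h
  · have h0 : (f.comp (exch ℂ).toAlgHom) (X 0) = f (X 1) := by
      rw [AlgHom.comp_apply, AlgEquiv.toAlgHom_apply, Plane.exch_X0]
    have h1 : (f.comp (exch ℂ).toAlgHom) (X 1) = f (X 0) := by
      rw [AlgHom.comp_apply, AlgEquiv.toAlgHom_apply, Plane.exch_X1]
    have hb : Function.Bijective (f.comp (exch ℂ).toAlgHom) := by
      refine Plane.finish1 (c := -c) hε.1 (neg_ne_zero.2 hc) hc' ?_ (by rw [h0]; exact h)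
      rw [h0, h1, C_neg, ← hJ]
      unfold Jac
      ring
    have hb' : Function.Bijective (f ∘ (exch ℂ)) := hb
    exact (Function.Bijective.of_comp_iff f (exch ℂ).bijective).1 hb'
end
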